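/- There exists a constant C, depending only on V_F, V_E, g_L, g_in, a and σ_E (but not on q), with the following property: for every classical stationary solution p of the voltage–conductance equation with p > 0 on (0,V_F)×[0,∞), and every q ≥ 4/3 such that d_q := ∫_Ω (g + g_L)²·p(v,g)^q dv dg < ∞ and such that p^q, g²·p^q and ∂_g(p^q) decay to 0 as g → ∞ uniformly in v, one has q·∫_0^{V_F} p(v,0)^q dv + ∫_Ω |∂_g (p(v,g)^{q/2})|² dv dg ≤ C·q·d_q. -/

import Mathlib

open Real MeasureTheory Set Filter

noncomputable section

/-- The voltage flux `J(v,g) = -g_L v + g (V_E - v)`. -/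
def Jflux (VE gL v g : ℝ) : ℝ := -gL * v + g * (VE - v)

/-- The Maxwellian `M(g) = exp(-(g - g_in)^2 / (2a))`. -/
def Mw (gin a g : ℝ) : ℝ := Real.exp (-(g - gin) ^ 2 / (2 * a))

/-- A classical stationary solution of the voltage-conductance equation:
`p : (0,V_F) × [0,∞) → [0,∞)`, C¹ in `v` (with continuous boundary extension) and
C² in `g` up to `g = 0`, satisfying the stationary equation, the no-flux boundary
condition at `g = 0`, the `v`-boundary conditions changing type at `g_F = g_L V_F/(V_E - V_F)`,
the normalization, and decay (uniform in `v`) of `p`, `g² p`, `∂_g p` as `g → ∞`. -/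
structure StatSol (VF VE gL gin a σE : ℝ) (p : ℝ → ℝ → ℝ) : Prop where
  nonneg : ∀ v ∈ Ioo 0 VF, ∀ g ∈ Ici (0:ℝ), 0 ≤ p v g
  cont_v : ∀ g ∈ Ici (0:ℝ), ContinuousOn (fun v => p v g) (Icc 0 VF)
  diff_v : ∀ v ∈ Ioo 0 VF, ∀ g ∈ Ioi (0:ℝ), DifferentiableAt ℝ (fun v' => p v' g) v
  smooth_g : ∀ v ∈ Ioo 0 VF, ContDiffOn ℝ 2 (fun g => p v g) (Ici 0)
  pde : ∀ v ∈ Ioo 0 VF, ∀ g ∈ Ioi (0:ℝ),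
    deriv (fun v' => Jflux VE gL v' g * p v' g) v
      + deriv (fun g' => ((gin - g') / σE) * p v g') g
      - (a / σE) * deriv (deriv (fun g' => p v g')) g = 0
  bc_g : ∀ v ∈ Ioo 0 VF, (0 - gin) * p v 0 + a * deriv (fun g' => p v g') 0 = 0
  bc_v_low : ∀ g ∈ Ioo 0 (gL * VF / (VE - VF)),
    Jflux VE gL 0 g * p 0 g = 0 ∧ Jflux VE gL VF g * p VF g = 0
  bc_v_high : ∀ g ∈ Ici (gL * VF / (VE - VF)),
    Jflux VE gL 0 g * p 0 g = Jflux VE gL VF g * p VF g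
  normalized : ∫ v in Ioo 0 VF, ∫ g in Ioi (0:ℝ), p v g = 1
  decay : ∀ ε > 0, ∃ G : ℝ, ∀ g ∈ Ici G, ∀ v ∈ Ioo 0 VF,
    p v g < ε ∧ g ^ 2 * p v g < ε ∧ |deriv (fun g' => p v g') g| < ε


/-! ### One-dimensional crossing lemma -/

def lpt (F : Set ℝ) (v : ℝ) : ℝ := sSup (F ∩ Iic v)
def rpt (F : Set ℝ) (v : ℝ) : ℝ := sInf (F ∩ Ioi v)

/-- closed set, unbounded in both directions -/
structure CS (F : Set ℝ) : Prop where
  cl : IsClosed F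
  hl : ∀ x, (F ∩ Iic x).Nonempty
  hr : ∀ x, (F ∩ Ioi x).Nonempty

namespace CS
variable {F : Set ℝ} (h : CS F)
include h

lemma bddA (v : ℝ) : BddAbove (F ∩ Iic v) := ⟨v, fun _ hx => hx.2⟩
lemma bddB (v : ℝ) : BddBelow (F ∩ Ioi v) := ⟨v, fun _ hx => le_of_lt hx.2⟩

lemma lpt_mem' (v : ℝ) : lpt F v ∈ F ∩ Iic v :=
  (h.cl.inter isClosed_Iic).csSup_mem (h.hl v) (h.bddA v)
lemma lpt_mem (v : ℝ) : lpt F v ∈ F := (h.lpt_mem' v).1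
lemma lpt_le (v : ℝ) : lpt F v ≤ v := (h.lpt_mem' v).2
lemma le_lpt {v z : ℝ} (hz : z ∈ F) (hzv : z ≤ v) : z ≤ lpt F v :=
  le_csSup (h.bddA v) ⟨hz, hzv⟩
lemma le_rpt (v : ℝ) : v ≤ rpt F v := le_csInf (h.hr v) fun _ hx => le_of_lt hx.2
lemma rpt_mem (v : ℝ) : rpt F v ∈ F := by
  have := csInf_mem_closure (h.hr v) (h.bddB v)
  exact h.cl.closure_subset_iff.2 inter_subset_left this
lemma rpt_le {v z : ℝ} (hz : z ∈ F) (hzv : v < z) : rpt F v ≤ z :=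
  csInf_le (h.bddB v) ⟨hz, hzv⟩
lemma lpt_mono : Monotone (lpt F) := fun _ _ hab =>
  h.le_lpt (h.lpt_mem _) ((h.lpt_le _).trans hab)
lemma rpt_mono : Monotone (rpt F) := fun a b hab => by
  refine le_csInf (h.hr b) fun z hz => h.rpt_le hz.1 (lt_of_le_of_lt hab hz.2)
lemma lpt_eq {v : ℝ} (hv : v ∈ F) : lpt F v = v := le_antisymm (h.lpt_le v) (h.le_lpt hv le_rfl)
lemma gap {v z : ℝ} (hz : z ∈ F) (h1 : lpt F v < z) : rpt F v ≤ z := by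
  apply h.rpt_le hz
  by_contra hc
  exact absurd (h.le_lpt hz (not_lt.1 hc)) (not_le.2 h1)
lemma const_l {v y : ℝ} (h1 : lpt F v ≤ y) (h2 : y < rpt F v) : lpt F y = lpt F v := by
  apply le_antisymm _ (h.le_lpt (h.lpt_mem v) h1)
  by_contra hc
  have := h.gap (h.lpt_mem y) (not_le.1 hc)
  linarith [h.lpt_le y]
lemma const_r {v y : ℝ} (h1 : lpt F v ≤ y) (h2 : y < rpt F v) : rpt F y = rpt F v := by
  apply le_antisymm (h.rpt_le (h.rpt_mem v) h2)
  exact le_csInf (h.hr y) fun z hz => h.gap hz.1 (lt_of_le_of_lt h1 hz.2)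
lemma lpt_lt {v : ℝ} (hv : v ∉ F) : lpt F v < v :=
  lt_of_le_of_ne (h.lpt_le v) fun he => hv (he ▸ h.lpt_mem v)
lemma lt_rpt {v : ℝ} (hv : v ∉ F) : v < rpt F v :=
  lt_of_le_of_ne (h.le_rpt v) fun he => hv (he ▸ h.rpt_mem v)
lemma mem_of_rpt_eq {v : ℝ} (hv : rpt F v = v) : v ∈ F := hv ▸ h.rpt_mem v
lemma exists_mem_of_rpt_eq {v δ : ℝ} (hv : rpt F v = v) (hδ : v < δ) : ∃ z ∈ F, v < z ∧ z < δ := by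
  obtain ⟨z, hz, hzd⟩ := exists_lt_of_csInf_lt (h.hr v) (show rpt F v < δ by rw [hv]; exact hδ)
  exact ⟨z, hz.1, hz.2, hzd⟩

omit h in
/-- slope over the gap -/
def _root_.gsl (F : Set ℝ) (w : ℝ → ℝ) (x : ℝ) : ℝ :=
  (w (rpt F x) - w (lpt F x)) / (rpt F x - lpt F x)
omit h in
def _root_.itp (F : Set ℝ) (w : ℝ → ℝ) (x : ℝ) : ℝ :=
  w (lpt F x) + (x - lpt F x) * gsl F w x

omit h in
lemma itp_aux {a b y wa wb L Ea Eb D x : ℝ} (hay : a ≤ y) (hyb : y ≤ b)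
    (h1 : |wa - L - D * (a - x)| ≤ Ea) (h2 : |wb - L - D * (b - x)| ≤ Eb) (hab : a < b) :
    |wa + (y - a) * ((wb - wa) / (b - a)) - L - D * (y - x)| ≤
      ((b - y) * Ea + (y - a) * Eb) / (b - a) := by
  have hb : 0 < b - a := by linarith
  have e : wa + (y - a) * ((wb - wa) / (b - a)) - L - D * (y - x) =
    ((b - y) * (wa - L - D * (a - x)) + (y - a) * (wb - L - D * (b - x))) / (b - a) := by
    field_simp; ring
  rw [e, abs_div, abs_of_pos hb]
  gcongr
  calc _ ≤ |(b - y) * (wa - L - D * (a - x))| + |(y - a) * (wb - L - D * (b - x))| := abs_add_le _ _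
    _ ≤ _ := by
      rw [abs_mul, abs_mul, abs_of_nonneg (by linarith : 0 ≤ b - y),
        abs_of_nonneg (by linarith : 0 ≤ y - a)]
      gcongr

lemma itp_eq {w : ℝ → ℝ} {x : ℝ} (hx : x ∈ F) : itp F w x = w x := by
  simp [itp, h.lpt_eq hx]

/-- bound of interpolation error by an affine bound with slope `E ≥ 0` plus const -/
lemma itp_bound {w : ℝ → ℝ} {x y L D E E0 : ℝ}
    (h1 : |w (lpt F y) - L - D * (lpt F y - x)| ≤ E0 + E * (lpt F y - x))
    (h2 : |w (rpt F y) - L - D * (rpt F y - x)| ≤ E0 + E * (rpt F y - x)) :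
    |itp F w y - L - D * (y - x)| ≤ E0 + E * (y - x) := by
  by_cases hy : y ∈ F
  · rw [h.itp_eq hy]; rwa [h.lpt_eq hy] at h1
  · have ha := h.lpt_lt hy
    have hb := h.lt_rpt hy
    have := itp_aux ha.le hb.le h1 h2 (ha.trans hb)
    refine this.trans (le_of_eq ?_)
    have : rpt F y - lpt F y ≠ 0 := by linarith
    field_simp; ring

lemma itp_gap {w : ℝ → ℝ} {x y : ℝ} (hx : lpt F x < rpt F x) (h1 : lpt F x ≤ y)
    (h2 : y ≤ rpt F x) : itp F w y = w (lpt F x) + (y - lpt F x) * gsl F w x := by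
  rcases h2.lt_or_eq with h2 | h2
  · simp [itp, gsl, h.const_l h1 h2, h.const_r h1 h2]
  · subst h2
    rw [h.itp_eq (h.rpt_mem x), gsl]
    have : rpt F x - lpt F x ≠ 0 := by linarith
    field_simp; ring

lemma itp_right_acc {w : ℝ → ℝ} {x d : ℝ} (hx : rpt F x = x)
    (hd : HasDerivWithinAt w d (Ioi x) x) : HasDerivWithinAt (itp F w) d (Ioi x) x := by
  have hxF := h.mem_of_rpt_eq hx
  rw [hasDerivWithinAt_iff_isLittleO, Asymptotics.isLittleO_iff] at hd ⊢
  intro c hc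
  have := hd hc
  rw [eventually_nhdsWithin_iff, Metric.eventually_nhds_iff] at this
  obtain ⟨δ, hδ, hw⟩ := this
  obtain ⟨z, hzF, hxz, hzd⟩ := h.exists_mem_of_rpt_eq hx (show x < x + δ by linarith)
  filter_upwards [Ioo_mem_nhdsGT hxz] with y hy
  have key : ∀ t, x ≤ t → t ≤ z → |w t - w x - d * (t - x)| ≤ 0 + c * (t - x) := by
    intro t ht htz
    rcases ht.eq_or_lt with rfl | ht
    · simp
    · have := hw (y := t) (by rw [Real.dist_eq, abs_of_pos] <;> linarith) ht
      simp only [smul_eq_mul, Real.norm_eq_abs] at this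
      rw [abs_of_pos (show 0 < t - x by linarith)] at this
      rw [mul_comm d]; linarith
  have := h.itp_bound (w := w) (x := x) (y := y) (L := w x) (D := d) (E := c) (E0 := 0)
    (key _ (h.le_lpt hxF hy.1.le) ((h.lpt_le y).trans hy.2.le))
    (key _ (hy.1.le.trans (h.le_rpt y)) (h.rpt_le hzF hy.2))
  rw [h.itp_eq hxF]
  simp only [smul_eq_mul, Real.norm_eq_abs]
  rw [abs_of_pos (show 0 < y - x by linarith [hy.1]), mul_comm _ d]; linarith

lemma itp_right_gap {w : ℝ → ℝ} {x : ℝ} (hx : rpt F x ≠ x) :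
    HasDerivWithinAt (itp F w) (gsl F w x) (Ioi x) x := by
  have h1 : x < rpt F x := lt_of_le_of_ne (h.le_rpt x) (Ne.symm hx)
  have hlt : lpt F x < rpt F x := lt_of_le_of_lt (h.lpt_le x) h1
  have : HasDerivWithinAt (fun y => w (lpt F x) + (y - lpt F x) * gsl F w x) (gsl F w x)
      (Ioi x) x := by
    have := (((hasDerivAt_id x).sub_const (lpt F x)).mul_const (gsl F w x)).const_add (w (lpt F x))
    simpa using this.hasDerivWithinAt
  refine this.congr_of_eventuallyEq ?_ (h.itp_gap hlt (h.lpt_le x) h1.le)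
  filter_upwards [Ioo_mem_nhdsGT h1] with y hy
  exact h.itp_gap hlt ((h.lpt_le x).trans hy.1.le) hy.2.le

lemma itp_left {w : ℝ → ℝ} (hw : Continuous w) (x : ℝ) :
    ContinuousWithinAt (itp F w) (Iic x) x := by
  by_cases hacc : ∃ y < x, ∀ z ∈ F, z < x → z ≤ y
  · obtain ⟨y, hyx, hy⟩ := hacc
    set t := (y + x) / 2 with ht
    have ht1 : y < t := by linarith
    have ht2 : t < x := by linarith
    have htF : t ∉ F := fun hh => by linarith [hy t hh ht2]
    have hr : x ≤ rpt F t := le_csInf (h.hr t) fun z hz => by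
      by_contra hc
      have := hy z hz.1 (not_le.1 hc)
      have := hz.2
      simp only [mem_Ioi] at this; linarith
    have hlt := (h.lpt_lt htF).trans (h.lt_rpt htF)
    have : ContinuousWithinAt (fun y => w (lpt F t) + (y - lpt F t) * gsl F w t) (Iic x) x := by
      fun_prop
    refine this.congr_of_eventuallyEq ?_ (h.itp_gap hlt ((h.lpt_le t).trans ht2.le) hr)
    filter_upwards [Ioc_mem_nhdsLE ht2] with y hy
    exact h.itp_gap hlt ((h.lpt_le t).trans hy.1.le) (hy.2.trans hr)
  · push Not at hacc
    have hxF : x ∈ F := by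
      rw [← h.cl.closure_eq, Metric.mem_closure_iff]
      intro ε hε
      obtain ⟨z, hz, hz1, hz2⟩ := hacc (x - ε) (by linarith)
      exact ⟨z, hz, by rw [Real.dist_eq, abs_of_pos] <;> linarith⟩
    rw [Metric.continuousWithinAt_iff]
    intro ε hε
    obtain ⟨δ, hδ, hwδ⟩ := Metric.continuous_iff.1 hw x (ε / 2) (by linarith)
    obtain ⟨z, hz, hz1, hz2⟩ := hacc (x - δ) (by linarith)
    refine ⟨x - z, by linarith, fun {y} hy hyd => ?_⟩
    rw [h.itp_eq hxF, Real.dist_eq]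
    rw [Real.dist_eq] at hyd
    have hyz : z < y := by have := (abs_lt.1 hyd).1; linarith
    have key : ∀ t, z ≤ t → t ≤ x → |w t - w x - 0 * (t - x)| ≤ ε / 2 + 0 * (t - x) := by
      intro t h1 h2
      have := hwδ t (by rw [Real.dist_eq, abs_lt]; constructor <;> linarith)
      rw [Real.dist_eq] at this
      simpa using this.le
    rcases (show y ≤ x from hy).eq_or_lt with rfl | hyx
    · rw [h.itp_eq hxF]; simpa using hε
    have := h.itp_bound (w := w) (x := x) (y := y) (L := w x) (D := 0) (E := 0) (E0 := ε / 2)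
      (key _ (h.le_lpt hz hyz.le) ((h.lpt_le y).trans hy))
      (key _ (hyz.le.trans (h.le_rpt y)) (h.rpt_le hxF hyx))
    simp only [zero_mul, sub_zero, add_zero] at this
    linarith

theorem crossing {w d φ : ℝ → ℝ} {a b : ℝ} (hab : a ≤ b) (ha : a ∈ F) (hb : b ∈ F)
    (hw : Continuous w)
    (hd : ∀ x ∈ Ioo a b, rpt F x = x → HasDerivWithinAt w (d x) (Ioi x) x)
    (hda : ∃ d, HasDerivWithinAt w d (Ioi a) a) 
    (φint : IntegrableOn φ (Icc a b))
    (h1 : ∀ x ∈ Ioo a b, rpt F x = x → d x ≤ φ x)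
    (h2 : ∀ x ∈ Ioo a b, rpt F x ≠ x → gsl F w x ≤ φ x) :
    w b - w a ≤ ∫ y in a..b, φ y := by
  have hder : ∀ x ∈ Ioo a b, HasDerivWithinAt (itp F w)
      ((fun x => if rpt F x = x then d x else gsl F w x) x) (Ioi x) x := by
    intro x hx
    by_cases hr : rpt F x = x
    · simpa [hr] using h.itp_right_acc hr (hd x hx hr)
    · simpa [hr] using h.itp_right_gap hr
  rw [← h.itp_eq (w := w) ha, ← h.itp_eq (w := w) hb]
  refine intervalIntegral.sub_le_integral_of_hasDeriv_right_of_le hab ?_ hder φint ?_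
  · intro x hx
    rcases hx.2.eq_or_lt with rfl | hxb
    · exact (h.itp_left hw x).mono Icc_subset_Iic_self
    have hR : ContinuousWithinAt (itp F w) (Ioi x) x := by
      rcases hx.1.eq_or_lt with rfl | hax
      · by_cases hr : rpt F a = a
        · obtain ⟨d, hd⟩ := hda
          exact (h.itp_right_acc hr hd).continuousWithinAt
        · exact (h.itp_right_gap hr).continuousWithinAt
      · exact (hder x ⟨hax, hxb⟩).continuousWithinAt
    have : ContinuousAt (itp F w) x := by
      rw [← continuousWithinAt_univ, ← Iic_union_Ioi (a := x)]
      exact (h.itp_left hw x).union hR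
    exact this.continuousWithinAt
  · intro x hx
    by_cases hr : rpt F x = x
    · simpa [hr] using h1 x hx hr
    · simpa [hr] using h2 x hx hr

lemma countable_bad : {x ∈ F | rpt F x ≠ x}.Countable := by
  refine (countable_setOfPred_isolated_right_within (s := F)).mono ?_
  rintro x ⟨hx, hr⟩
  refine ⟨hx, ?_⟩
  have h1 : x < rpt F x := lt_of_le_of_ne (h.le_rpt x) (Ne.symm hr)
  rw [← mem_closure_iff_nhdsWithin_neBot.not.trans not_neBot]
  intro hc
  obtain ⟨z, hz1, hz2⟩ := mem_closure_iff_nhds.1 hc (Iio (rpt F x)) (Iio_mem_nhds h1)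
  exact absurd (h.rpt_le hz2.1 hz2.2) (not_le.2 hz1)

end CS


lemma Measurable.uncurry_comp_fst {W : ℝ → ℝ → ℝ} (hW : Measurable (Function.uncurry W))
    {r : ℝ → ℝ} (hr : Measurable r) : Measurable (fun x : ℝ × ℝ => W (r x.1) x.2) :=
  hW.comp ((hr.comp measurable_fst).prodMk measurable_snd)

theorem portion_phi {F : Set ℝ} (hF : CS F) {v1 v2 G C0 C1 C2 : ℝ} (hG : 0 ≤ G) (hC1 : 0 ≤ C1)
    (hC2 : 0 ≤ C2) (hv1 : v1 ∈ F) (hv2 : v2 ∈ F)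
    {W D : ℝ → ℝ → ℝ} (hWm : Measurable (Function.uncurry W))
    (hDm : Measurable (Function.uncurry D))
    (hWc : ∀ g ∈ Ioo 0 G, Continuous fun v => W v g)
    (hWb : ∀ v ∈ Icc v1 v2, ∀ g ∈ Ioo 0 G, |W v g| ≤ C0)
    (hder : ∀ x ∈ Icc v1 v2, ∀ g ∈ Ioo 0 G, HasDerivAt (fun v => W v g) (D x g) x)
    (hDb : ∀ x ∈ F ∩ Ioo v1 v2, ∀ g ∈ Ioo 0 G, |D x g| ≤ C1)
    (hgap : ∀ x ∈ Ioo v1 v2, rpt F x ≠ x →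
      ∫ g in Ioo 0 G, max (W (rpt F x) g - W (lpt F x) g) 0 ≤ C2 * (rpt F x - lpt F x)) :
    ∃ Φ : ℝ → ℝ, IntegrableOn Φ (Ioo v1 v2) ∧
      (∀ x ∈ Ioo v1 v2, rpt F x = x → Φ x = ∫ g in Ioo 0 G, D x g) ∧
      (∀ x ∈ Ioo v1 v2, Φ x ≤ C1 * G + C2) ∧
      ∀ w1 ∈ F ∩ Icc v1 v2, ∀ w2 ∈ F ∩ Icc v1 v2, w1 ≤ w2 →
        (∫ g in Ioo 0 G, W w2 g) - (∫ g in Ioo 0 G, W w1 g) ≤ ∫ x in w1..w2, Φ x := by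
  set φ : ℝ → ℝ → ℝ := fun v g =>
    max (if rpt F v = v then D v g else gsl F (fun v => W v g) v) (-C1) with hφ
  have hrm : Measurable (rpt F) := hF.rpt_mono.measurable
  have hlm : Measurable (lpt F) := hF.lpt_mono.measurable
  have hφm : Measurable (Function.uncurry φ) := by
    have : Measurable fun x : ℝ × ℝ => max (if rpt F x.1 = x.1 then D x.1 x.2 else
        (W (rpt F x.1) x.2 - W (lpt F x.1) x.2) / (rpt F x.1 - lpt F x.1)) (-C1) := by
      refine Measurable.max (Measurable.ite ?_ hDm ?_) measurable_const
      · exact measurableSet_eq_fun (hrm.comp measurable_fst) measurable_fst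
      · exact ((hWm.uncurry_comp_fst hrm).sub (hWm.uncurry_comp_fst hlm)).div
          ((hrm.comp measurable_fst).sub (hlm.comp measurable_fst))
    exact this
  have hμ : (volume.restrict (Ioo (0:ℝ) G)).real univ = G := by
    simp [measureReal_def, hG]
  -- integrability of sections
  have hrI : ∀ x ∈ Ioo v1 v2, rpt F x ∈ Icc v1 v2 := fun x hx =>
    ⟨hx.1.le.trans (hF.le_rpt x), hF.rpt_le hv2 hx.2⟩
  have hlI : ∀ x ∈ Ioo v1 v2, lpt F x ∈ Icc v1 v2 := fun x hx =>
    ⟨hF.le_lpt hv1 hx.1.le, (hF.lpt_le x).trans hx.2.le⟩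
  have hWi : ∀ v ∈ Icc v1 v2, IntegrableOn (fun g => W v g) (Ioo 0 G) := by
    intro v hv
    refine Measure.integrableOn_of_bounded (M := C0) (by simp) 
      (hWm.of_uncurry_left).aestronglyMeasurable ?_
    filter_upwards [ae_restrict_mem measurableSet_Ioo] with g hg using hWb v hv g hg
  have hDi : ∀ x ∈ F ∩ Ioo v1 v2, IntegrableOn (fun g => D x g) (Ioo 0 G) := by
    intro v hv
    refine Measure.integrableOn_of_bounded (M := C1) (by simp) 
      (hDm.of_uncurry_left).aestronglyMeasurable ?_
    filter_upwards [ae_restrict_mem measurableSet_Ioo] with g hg using hDb v hv g hg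
  have hφi : ∀ x ∈ Ioo v1 v2, IntegrableOn (fun g => φ x g) (Ioo 0 G) := by
    intro x hx
    by_cases hr : rpt F x = x
    · simp only [hφ, hr, if_true]
      exact (hDi x ⟨hF.mem_of_rpt_eq hr, hx⟩).sup (integrable_const _)
    · simp only [hφ, hr, if_false]
      exact Integrable.sup (((hWi _ (hrI x hx)).sub (hWi _ (hlI x hx))).div_const _) (integrable_const _)
  have hφabs : ∀ x ∈ Ioo v1 v2, ∫ g in Ioo 0 G, ‖φ x g‖ ≤ C1 * G + C2 := by
    intro x hx
    by_cases hr : rpt F x = x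
    · have hxF := hF.mem_of_rpt_eq hr
      have : ∫ g in Ioo 0 G, ‖φ x g‖ ≤ ∫ g in Ioo 0 G, C1 := by
        refine setIntegral_mono_on (hφi x hx).norm (integrable_const _) measurableSet_Ioo ?_
        intro g hg
        have := abs_le.1 (hDb x ⟨hxF, hx⟩ g hg)
        simp only [hφ, hr, if_true, Real.norm_eq_abs]
        rw [max_eq_left (by linarith)]
        exact abs_le.2 this
      rw [integral_const, smul_eq_mul, hμ] at this
      linarith
    · have hlt : 0 < rpt F x - lpt F x := by
        have := lt_of_le_of_ne (hF.le_rpt x) (Ne.symm hr)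
        have := hF.lpt_le x
        linarith
      have : ∫ g in Ioo 0 G, ‖φ x g‖ ≤ ∫ g in Ioo 0 G,
          (C1 + (max (W (rpt F x) g - W (lpt F x) g) 0) / (rpt F x - lpt F x)) := by
        refine setIntegral_mono_on (hφi x hx).norm ?_ measurableSet_Ioo ?_
        · exact (integrable_const _).add (Integrable.div_const
            (((hWi _ (hrI x hx)).sub (hWi _ (hlI x hx))).sup (integrable_const _)) _)
        intro g hg
        simp only [hφ, hr, if_false, Real.norm_eq_abs, gsl]
        have h1 : 0 ≤ (max (W (rpt F x) g - W (lpt F x) g) 0) / (rpt F x - lpt F x) := by positivity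
        have h2 : (W (rpt F x) g - W (lpt F x) g) / (rpt F x - lpt F x) ≤
          (max (W (rpt F x) g - W (lpt F x) g) 0) / (rpt F x - lpt F x) := by
          gcongr; exact le_max_left _ _
        rw [abs_le]
        refine ⟨?_, max_le (by linarith) (by linarith)⟩
        have := le_max_right ((W (rpt F x) g - W (lpt F x) g) / (rpt F x - lpt F x)) (-C1)
        linarith
      have hmx : IntegrableOn (fun g => (max (W (rpt F x) g - W (lpt F x) g) 0) /
          (rpt F x - lpt F x)) (Ioo 0 G) := Integrable.div_const
            (((hWi _ (hrI x hx)).sub (hWi _ (hlI x hx))).sup (integrable_const _)) _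
      rw [integral_add (integrable_const _) hmx, integral_const, smul_eq_mul, hμ,
            integral_div] at this
      have h3 := hgap x hx hr
      have : (∫ g in Ioo 0 G, max (W (rpt F x) g - W (lpt F x) g) 0) / (rpt F x - lpt F x) ≤ C2 := by
        rw [div_le_iff₀ hlt]; exact h3
      linarith
  have hprod : Integrable (Function.uncurry φ)
      ((volume.restrict (Ioo v1 v2)).prod (volume.restrict (Ioo 0 G))) := by
    rw [integrable_prod_iff hφm.aestronglyMeasurable]
    constructor
    · filter_upwards [ae_restrict_mem measurableSet_Ioo] with x hx using hφi x hx
    · refine Measure.integrableOn_of_bounded (M := C1 * G + C2) (by simp) ?_ ?_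
      · exact (hφm.norm.stronglyMeasurable.integral_prod_right).aestronglyMeasurable
      · filter_upwards [ae_restrict_mem measurableSet_Ioo] with x hx
        rw [Real.norm_of_nonneg (integral_nonneg fun _ => norm_nonneg _)]
        exact hφabs x hx
  refine ⟨fun x => ∫ g in Ioo 0 G, φ x g, hprod.integral_prod_left, ?_, ?_, ?_⟩
  · intro x hx hr
    refine setIntegral_congr_fun measurableSet_Ioo fun g hg => ?_
    have := abs_le.1 (hDb x ⟨hF.mem_of_rpt_eq hr, hx⟩ g hg)
    simp only [hφ, hr, if_true]
    exact max_eq_left (by linarith)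
  · intro x hx
    exact (Real.le_norm_self _).trans ((norm_integral_le_integral_norm _).trans (hφabs x hx))
  · intro w1 hw1 w2 hw2 hw
    have hsub : Ioo w1 w2 ⊆ Ioo v1 v2 := Ioo_subset_Ioo hw1.2.1 hw2.2.2
    have hprod' : Integrable (Function.uncurry φ)
      ((volume.restrict (Ioo w1 w2)).prod (volume.restrict (Ioo 0 G))) :=
      hprod.mono_measure (Measure.prod_mono (Measure.restrict_mono hsub le_rfl) le_rfl)
    rw [intervalIntegral.integral_of_le hw, integral_Ioc_eq_integral_Ioo,
      integral_integral_swap hprod', ← integral_sub (hWi _ hw2.2) (hWi _ hw1.2)]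
    refine integral_mono_ae ((hWi _ hw2.2).sub (hWi _ hw1.2)) hprod'.integral_prod_right ?_
    filter_upwards [ae_restrict_mem measurableSet_Ioo, hprod'.prod_left_ae] with g hg hint
    have := hF.crossing (w := fun v => W v g) (d := fun v => D v g) (φ := fun v => φ v g) hw
      hw1.1 hw2.1 (hWc g hg) (fun x hx _ => (hder x ⟨hw1.2.1.trans hx.1.le,
        hx.2.le.trans hw2.2.2⟩ g hg).hasDerivWithinAt)
      ⟨_, (hder w1 hw1.2 g hg).hasDerivWithinAt⟩
      (by rw [integrableOn_Icc_iff_integrableOn_Ioo]; exact hint)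
      (fun x hx hr => by simp [hφ, hr]) (fun x hx hr => by simp [hφ, hr])
    rw [intervalIntegral.integral_of_le hw, integral_Ioc_eq_integral_Ioo] at this
    exact this


open Topology in
lemma deriv_le_of_freq {A B : ℝ → ℝ} {a' b' x : ℝ} (hA : HasDerivAt A a' x) (hB : HasDerivAt B b' x)
    (hf : ∃ᶠ y in 𝓝[>] x, A y - A x ≤ B y - B x) : a' ≤ b' := by
  have h1 := (hasDerivWithinAt_iff_tendsto_slope' (s := Ioi x) (by simp)).1 hA.hasDerivWithinAt
  have h2 := (hasDerivWithinAt_iff_tendsto_slope' (s := Ioi x) (by simp)).1 hB.hasDerivWithinAt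
  refine le_of_tendsto_of_tendsto_of_frequently h1 h2 ?_
  refine (hf.and_eventually self_mem_nhdsWithin).mono ?_
  rintro y ⟨hy, hxy⟩
  have hxy : x < y := hxy
  rw [slope_def_field, slope_def_field]
  have : 0 < y - x := by linarith
  gcongr

open Topology in
theorem portion_final {F : Set ℝ} (hF : CS F) {v1 v2 C : ℝ} (hv : v1 ≤ v2) {T h Φ : ℝ → ℝ} (hh : IntegrableOn h (Ioo v1 v2))
    (hΦ : IntegrableOn Φ (Ioo v1 v2))
    (hΦh : ∀ x ∈ Ioo v1 v2, rpt F x = x → Φ x ≤ h x)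
    (hΦC : ∀ x ∈ Ioo v1 v2, Φ x ≤ C) (hhC : ∀ x ∈ Ioo v1 v2, h x ≤ C)
    (hTF : ∀ w1 ∈ F ∩ Icc v1 v2, ∀ w2 ∈ F ∩ Icc v1 v2, w1 ≤ w2 →
        T w2 - T w1 ≤ ∫ x in w1..w2, Φ x)
    (hgood : ∀ w1 ∈ Icc v1 v2, ∀ w2 ∈ Icc v1 v2, w1 ≤ w2 → (∀ z ∈ F, z ∉ Ioo w1 w2) →
        T w2 - T w1 ≤ ∫ x in w1..w2, h x) :
    T v2 - T v1 ≤ ∫ x in v1..v2, h x := by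
  have intI : ∀ {u : ℝ → ℝ}, IntegrableOn u (Ioo v1 v2) → ∀ w1 ∈ Icc v1 v2, ∀ w2 ∈ Icc v1 v2,
      w1 ≤ w2 → IntervalIntegrable u volume w1 w2 := by
    intro u hu w1 h1 w2 h2 hw
    rw [intervalIntegrable_iff_integrableOn_Ioo_of_le hw]
    exact hu.mono_set (Ioo_subset_Ioo h1.1 h2.2)
  have intC : ∀ {u : ℝ → ℝ}, IntegrableOn u (Ioo v1 v2) → (∀ x ∈ Ioo v1 v2, u x ≤ C) →
      ∀ w1 ∈ Icc v1 v2, ∀ w2 ∈ Icc v1 v2, w1 ≤ w2 → ∫ x in w1..w2, u x ≤ C * (w2 - w1) := by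
    intro u hu huC w1 h1 w2 h2 hw
    have := intervalIntegral.integral_mono_on_of_le_Ioo hw (intI hu w1 h1 w2 h2 hw)
      (intervalIntegrable_const (c := C)) (fun x hx => huC x ⟨h1.1.trans_lt hx.1, hx.2.trans_le h2.2⟩)
    simp only [intervalIntegral.integral_const, smul_eq_mul] at this
    linarith
  have lip : ∀ w1 ∈ Icc v1 v2, ∀ w2 ∈ Icc v1 v2, w1 ≤ w2 → T w2 - T w1 ≤ C * (w2 - w1) := by
    intro w1 h1 w2 h2 hw
    by_cases hn : ∀ z ∈ F, z ∉ Ioo w1 w2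
    · exact (hgood w1 h1 w2 h2 hw hn).trans (intC hh hhC w1 h1 w2 h2 hw)
    push Not at hn
    obtain ⟨z, hz, hz1, hz2⟩ := hn
    set a := lpt F w2
    have haF : a ∈ F := hF.lpt_mem w2
    have hza : z ≤ a := hF.le_lpt hz hz2.le
    have haw : a ≤ w2 := hF.lpt_le w2
    have haI : a ∈ Icc v1 v2 := ⟨by linarith [h1.1], by linarith [h2.2]⟩
    have e1 : T w2 - T a ≤ C * (w2 - a) := by
      refine (hgood a haI w2 h2 haw ?_).trans (intC hh hhC a haI w2 h2 haw)
      intro y hy hyI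
      linarith [hF.le_lpt hy hyI.2.le, hyI.1]
    obtain ⟨b, hbF, hb1, hb2, hb3⟩ : ∃ b ∈ F, w1 ≤ b ∧ b ≤ z ∧ ∀ y ∈ F, y ∉ Ioo w1 b := by
      refine ⟨rpt F w1, hF.rpt_mem _, hF.le_rpt _, hF.rpt_le hz hz1, fun y hy hyI => ?_⟩
      linarith [hF.rpt_le hy hyI.1, hyI.2]
    have hbI : b ∈ Icc v1 v2 := ⟨by linarith [h1.1], by linarith [h2.2]⟩
    have e2 : T b - T w1 ≤ C * (b - w1) :=
      (hgood w1 h1 b hbI hb1 hb3).trans (intC hh hhC w1 h1 b hbI hb1)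
    have e3 : T a - T b ≤ C * (a - b) :=
      (hTF b ⟨hbF, hbI⟩ a ⟨haF, haI⟩ (hb2.trans hza)).trans (intC hΦ hΦC b hbI a haI (hb2.trans hza))
    linarith
  set M : ℝ → ℝ := fun v => C * v - T v with hM
  have hmono : MonotoneOn M (uIcc v1 v2) := by
    rw [uIcc_of_le hv]
    intro x hx y hy hxy
    have := lip x hx y hy hxy
    simp only [hM]; linarith
  have hI := hmono.intervalIntegral_deriv_mem_uIcc
  have hMI := hmono.intervalIntegrable_deriv
  have hMle : M v1 ≤ M v2 := hmono left_mem_uIcc right_mem_uIcc hv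
  rw [uIcc_of_le (by linarith)] at hI
  have hv1I : v1 ∈ Icc v1 v2 := left_mem_Icc.2 hv
  have hv2I : v2 ∈ Icc v1 v2 := right_mem_Icc.2 hv
  have hih := intI hh v1 hv1I v2 hv2I hv
  have hiΦ := intI hΦ v1 hv1I v2 hv2I hv
  have hae : ∀ᵐ x, x ∈ Ioo v1 v2 → C - h x ≤ deriv M x := by
    have hc : ∀ᵐ x, x ∉ {x ∈ F | rpt F x ≠ x} :=
      measure_eq_zero_iff_ae_notMem.1 (hF.countable_bad.measure_zero volume)
    filter_upwards [hmono.ae_differentiableWithinAt_of_mem, hih.ae_hasDerivAt_integral,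
      hiΦ.ae_hasDerivAt_integral, hc] with x h1 h2 h3 h4 hx
    rw [uIcc_of_le hv] at h1 h2 h3
    have hxI : x ∈ Icc v1 v2 := Ioo_subset_Icc_self hx
    have hd : DifferentiableAt ℝ M x := (h1 hxI).differentiableAt (Icc_mem_nhds hx.1 hx.2)
    have h2 := h2 hxI v1 hv1I
    have h3 := h3 hxI v1 hv1I
    have hT : HasDerivAt T (C - deriv M x) x := by
      have := ((hasDerivAt_id x).const_mul C).sub hd.hasDerivAt
      simp only [mul_one] at this
      exact this.congr_of_eventuallyEq (Eventually.of_forall fun y => by simp [hM])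
    have sub : ∀ {u : ℝ → ℝ}, IntegrableOn u (Ioo v1 v2) → ∀ y ∈ Ioo x v2,
        (∫ t in v1..y, u t) - (∫ t in v1..x, u t) = ∫ t in x..y, u t := by
      intro u hu y hy
      have hyI : y ∈ Icc v1 v2 := ⟨hx.1.le.trans hy.1.le, hy.2.le⟩
      exact intervalIntegral.integral_interval_sub_left (intI hu v1 hv1I y hyI hyI.1)
        (intI hu v1 hv1I x hxI hxI.1)
    by_cases hr : rpt F x = x
    · have hxF := hF.mem_of_rpt_eq hr
      have : C - deriv M x ≤ Φ x := by
        refine deriv_le_of_freq hT h3 ?_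
        have hfr : ∃ᶠ y in 𝓝[>] x, y ∈ F := by
          rw [frequently_iff]
          intro U hU
          obtain ⟨u, hu, hU⟩ := mem_nhdsGT_iff_exists_Ioo_subset.1 hU
          obtain ⟨z, hz, hz1, hz2⟩ := hF.exists_mem_of_rpt_eq hr hu
          exact ⟨z, hU ⟨hz1, hz2⟩, hz⟩
        refine (hfr.and_eventually (Ioo_mem_nhdsGT hx.2)).mono ?_
        rintro y ⟨hyF, hy⟩
        rw [sub hΦ y hy]
        exact hTF x ⟨hxF, hxI⟩ y ⟨hyF, ⟨hx.1.le.trans hy.1.le, hy.2.le⟩⟩ hy.1.le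
      linarith [hΦh x hx hr]
    · have hxF : x ∉ F := fun hh => h4 ⟨hh, hr⟩
      have : C - deriv M x ≤ h x := by
        refine deriv_le_of_freq hT h2 (Eventually.frequently ?_)
        filter_upwards [Ioo_mem_nhdsGT hx.2, Ioo_mem_nhdsGT (hF.lt_rpt hxF)] with y hy hy2
        rw [sub hh y hy]
        refine hgood x hxI y ⟨hx.1.le.trans hy.1.le, hy.2.le⟩ hy.1.le fun z hz hzI => ?_
        linarith [hF.rpt_le hz hzI.1, hzI.2, hy2.2]
      linarith
  have hfin : ∫ x in v1..v2, (C - h x) ≤ ∫ x in v1..v2, deriv M x := by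
    rw [intervalIntegral.integral_of_le hv, intervalIntegral.integral_of_le hv,
      integral_Ioc_eq_integral_Ioo, integral_Ioc_eq_integral_Ioo]
    refine setIntegral_mono_on_ae ?_ ?_ measurableSet_Ioo hae
    · exact (integrable_const _).sub hh
    · exact (intervalIntegrable_iff_integrableOn_Ioo_of_le hv).1 hMI
  rw [intervalIntegral.integral_sub intervalIntegrable_const hih] at hfin
  simp only [intervalIntegral.integral_const, smul_eq_mul] at hfin
  have := hI.2
  simp only [hM] at this hfin
  linarith


structure Core where
  (VF VE gL κ b0 s G : ℝ)
  (P Pg Pgg Pv : ℝ → ℝ → ℝ)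
  (ψ ψ1 ψ2 : ℝ → ℝ)
  hVF : 0 < VF
  hVE : VF < VE
  hgL : 0 < gL
  hκ : 0 < κ
  hb0 : 0 < b0
  hs : 0 < s
  hG : gL * VF / (VE - VF) < G
  hPc : ∀ g, Continuous fun v => P v g
  hPm : Measurable (Function.uncurry P)
  hP0 : ∀ v g, 0 ≤ P v g
  hPg : ∀ v ∈ Ioo 0 VF, ∀ g ∈ Ici (0:ℝ), HasDerivWithinAt (P v) (Pg v g) (Ici 0) g
  hPgg : ∀ v ∈ Ioo 0 VF, ∀ g ∈ Ici (0:ℝ), HasDerivWithinAt (Pg v) (Pgg v g) (Ici 0) g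
  hPggc : ∀ v ∈ Ioo 0 VF, ContinuousOn (Pgg v) (Ici 0)
  hPv : ∀ v ∈ Ioo 0 VF, ∀ g ∈ Ioi (0:ℝ), HasDerivAt (fun v => P v g) (Pv v g) v
  hpde : ∀ v ∈ Ioo 0 VF, ∀ g ∈ Ioi (0:ℝ), Jflux VE gL v g * Pv v g =
    κ * Pgg v g - (b0 - s * g) * Pg v g + s * P v g + (g + gL) * P v g
  hrobin : ∀ v ∈ Ioo 0 VF, κ * Pg v 0 = b0 * P v 0
  hψ : ∀ g, HasDerivAt ψ (ψ1 g) g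
  hψ1 : ∀ g, HasDerivAt ψ1 (ψ2 g) g
  hψ2 : Continuous ψ2
  ψ_nonneg : ∀ g, 0 ≤ ψ g
  ψ_le : ∀ g, ψ g ≤ 1
  ψ_zero : ψ 0 = 1
  ψ1_zero : ψ1 0 = 0
  ψ_G : ψ G = 0
  ψ1_G : ψ1 G = 0

structure Adm (c : Core) where
  (Θ Θ1 Θ2 k k1 k2 : ℝ → ℝ)
  L : ℝ
  I : Set ℝ
  hI : IsOpen I
  hrange : ∀ v ∈ Ioo 0 c.VF, ∀ g ∈ Icc 0 c.G, k g - c.P v g ∈ I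
  hΘ : ∀ u ∈ I, HasDerivAt Θ (Θ1 u) u
  hΘ1 : ∀ u ∈ I, HasDerivAt Θ1 (Θ2 u) u
  hΘ2c : ContinuousOn Θ2 I
  hΘ2 : ∀ u ∈ I, 0 ≤ Θ2 u
  hL : 0 ≤ L
  hlip : ∀ u u', Θ u' - Θ u ≤ L * max (u' - u) 0
  hb : ∀ v ∈ Ioo 0 c.VF, ∀ g ∈ Icc 0 c.G, |Θ (k g - c.P v g)| ≤ L
  hb1 : ∀ v ∈ Ioo 0 c.VF, ∀ g ∈ Icc 0 c.G, |Θ1 (k g - c.P v g)| ≤ L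
  hb2 : ∀ v ∈ Ioo 0 c.VF, ∀ g ∈ Icc 0 c.G,
    |Θ1 (k g - c.P v g) * (k g - c.P v g)| ≤ L
  hk : ∀ g ∈ Ici (0:ℝ), HasDerivWithinAt k (k1 g) (Ici 0) g
  hk1 : ∀ g ∈ Ici (0:ℝ), HasDerivWithinAt k1 (k2 g) (Ici 0) g
  hk2c : ContinuousOn k2 (Ici 0)
  hkm : Measurable k
  hrob : c.κ * k1 0 = c.b0 * k 0

namespace Core
variable (c : Core)
lemma G_pos : 0 < c.G := lt_of_le_of_lt (by
  have := c.hVF; have := c.hVE; have := c.hgL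
  have : 0 < c.VE - c.VF := by linarith
  positivity) c.hG
lemma ψ_cont : Continuous c.ψ := continuous_iff_continuousAt.2 fun g => (c.hψ g).continuousAt
lemma ψ1_cont : Continuous c.ψ1 := continuous_iff_continuousAt.2 fun g => (c.hψ1 g).continuousAt
def J (v g : ℝ) : ℝ := Jflux c.VE c.gL v g
lemma P_contOn {v : ℝ} (hv : v ∈ Ioo 0 c.VF) : ContinuousOn (c.P v) (Ici 0) :=
  fun g hg => (c.hPg v hv g hg).continuousWithinAt
lemma Pg_contOn {v : ℝ} (hv : v ∈ Ioo 0 c.VF) : ContinuousOn (c.Pg v) (Ici 0) :=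
  fun g hg => (c.hPgg v hv g hg).continuousWithinAt
/-- right-hand side of the PDE -/
def S (v g : ℝ) : ℝ :=
  c.κ * c.Pgg v g - (c.b0 - c.s * g) * c.Pg v g + c.s * c.P v g + (g + c.gL) * c.P v g
lemma S_contOn {v : ℝ} (hv : v ∈ Ioo 0 c.VF) : ContinuousOn (c.S v) (Ici 0) := by
  have h1 := c.P_contOn hv
  have h2 := c.Pg_contOn hv
  have h3 := c.hPggc v hv
  unfold S
  fun_prop
end Core

namespace Adm
variable {c : Core} (A : Adm c)

def u (v g : ℝ) : ℝ := A.k g - c.P v g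
def u1 (v g : ℝ) : ℝ := A.k1 g - c.Pg v g
def u2 (v g : ℝ) : ℝ := A.k2 g - c.Pgg v g
def R (g : ℝ) : ℝ :=
  c.κ * A.k2 g - (c.b0 - c.s * g) * A.k1 g + c.s * A.k g + (g + c.gL) * A.k g
def W (v g : ℝ) : ℝ := c.J v g * c.ψ g * A.Θ (A.u v g)
def D0 (v g : ℝ) : ℝ := -(g + c.gL) * c.ψ g * A.Θ (A.u v g) - c.ψ g * A.Θ1 (A.u v g) * c.S v g
open Classical in
def D (v g : ℝ) : ℝ := if v ∈ Ioo 0 c.VF ∧ g ∈ Ioo 0 c.G then A.D0 v g else 0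
def T (v : ℝ) : ℝ := ∫ g in Ioo 0 c.G, A.W v g
def f (v : ℝ) : ℝ := ∫ g in Ioo 0 c.G, A.D v g
def e1 (v g : ℝ) : ℝ := (c.κ * c.ψ2 g + (c.b0 - c.s * g) * c.ψ1 g) * A.Θ (A.u v g) +
  c.ψ g * (g + c.gL + c.s) * (A.Θ1 (A.u v g) * A.u v g - A.Θ (A.u v g)) -
  c.ψ g * A.Θ1 (A.u v g) * A.R g
def dis (v g : ℝ) : ℝ := c.κ * c.ψ g * A.Θ2 (A.u v g) * (A.u1 v g) ^ 2

lemma k_contOn : ContinuousOn A.k (Ici 0) := fun g hg => (A.hk g hg).continuousWithinAt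
lemma k1_contOn : ContinuousOn A.k1 (Ici 0) := fun g hg => (A.hk1 g hg).continuousWithinAt
lemma R_contOn : ContinuousOn A.R (Ici 0) := by
  have h1 := A.k_contOn
  have h2 := A.k1_contOn
  have h3 := A.hk2c
  unfold R
  fun_prop
lemma Icc_sub : Icc 0 c.G ⊆ Ici (0:ℝ) := Icc_subset_Ici_self

section fixedv
variable {v : ℝ} (hv : v ∈ Ioo 0 c.VF)
include hv
lemma hu {g : ℝ} (hg : g ∈ Ici (0:ℝ)) : HasDerivWithinAt (A.u v) (A.u1 v g) (Ici 0) g :=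
  (A.hk g hg).sub (c.hPg v hv g hg)
lemma hu1 {g : ℝ} (hg : g ∈ Ici (0:ℝ)) : HasDerivWithinAt (A.u1 v) (A.u2 v g) (Ici 0) g :=
  (A.hk1 g hg).sub (c.hPgg v hv g hg)
lemma u_contOn : ContinuousOn (A.u v) (Icc 0 c.G) := fun g hg =>
  ((A.hu hv (Icc_sub hg)).continuousWithinAt).mono Icc_sub
lemma u1_contOn : ContinuousOn (A.u1 v) (Icc 0 c.G) := fun g hg =>
  ((A.hu1 hv (Icc_sub hg)).continuousWithinAt).mono Icc_sub
lemma u2_contOn : ContinuousOn (A.u2 v) (Icc 0 c.G) :=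
  (A.hk2c.sub (c.hPggc v hv)).mono Icc_sub
lemma maps : MapsTo (A.u v) (Icc 0 c.G) A.I := fun g hg => A.hrange v hv g hg
lemma Θu_contOn : ContinuousOn (fun g => A.Θ (A.u v g)) (Icc 0 c.G) :=
  ContinuousOn.comp (t := A.I) (fun u hu => (A.hΘ u hu).continuousAt.continuousWithinAt)
    (A.u_contOn hv) (A.maps hv)
lemma Θ1u_contOn : ContinuousOn (fun g => A.Θ1 (A.u v g)) (Icc 0 c.G) :=
  ContinuousOn.comp (t := A.I) (fun u hu => (A.hΘ1 u hu).continuousAt.continuousWithinAt)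
    (A.u_contOn hv) (A.maps hv)
lemma Θ2u_contOn : ContinuousOn (fun g => A.Θ2 (A.u v g)) (Icc 0 c.G) :=
  ContinuousOn.comp (t := A.I) A.hΘ2c (A.u_contOn hv) (A.maps hv)
lemma D0_contOn : ContinuousOn (A.D0 v) (Icc 0 c.G) := by
  have h1 := A.Θu_contOn hv
  have h2 := A.Θ1u_contOn hv
  have h3 := (c.S_contOn hv).mono (Icc_sub (c := c))
  have h4 := c.ψ_cont
  unfold D0
  fun_prop
lemma e1_contOn : ContinuousOn (A.e1 v) (Icc 0 c.G) := by
  have h0 := A.u_contOn hv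
  have h1 := A.Θu_contOn hv
  have h2 := A.Θ1u_contOn hv
  have h3 := (A.R_contOn).mono (Icc_sub (c := c))
  have h4 := c.ψ_cont
  have h5 := c.ψ1_cont
  have h6 := c.hψ2
  unfold e1
  fun_prop
lemma dis_contOn : ContinuousOn (A.dis v) (Icc 0 c.G) := by
  have h1 := A.Θ2u_contOn hv
  have h2 := A.u1_contOn hv
  have h4 := c.ψ_cont
  unfold dis
  fun_prop

lemma f_eq : A.f v = ∫ g in Ioo 0 c.G, A.D0 v g := by
  refine setIntegral_congr_fun measurableSet_Ioo fun g hg => ?_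
  have : v ∈ Ioo 0 c.VF ∧ g ∈ Ioo 0 c.G := ⟨hv, hg⟩
  simp only [D, if_pos this]

omit hv in
lemma intOn {h : ℝ → ℝ} (hh : ContinuousOn h (Icc 0 c.G)) : IntegrableOn h (Ioo 0 c.G) :=
  (hh.integrableOn_Icc).mono_set Ioo_subset_Icc_self

theorem ibp : A.f v = -(c.b0 * (A.Θ1 (A.u v 0) * A.u v 0 - A.Θ (A.u v 0))) +
    ((∫ g in Ioo 0 c.G, A.e1 v g) - ∫ g in Ioo 0 c.G, A.dis v g) := by
  set Q : ℝ → ℝ := fun g => c.κ * (c.ψ g * A.Θ1 (A.u v g) * A.u1 v g - c.ψ1 g * A.Θ (A.u v g)) -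
    (c.b0 - c.s * g) * c.ψ g * A.Θ (A.u v g) with hQ
  set Q' : ℝ → ℝ := fun g => A.D0 v g - (A.e1 v g - A.dis v g) with hQ'
  have hQc : ContinuousOn Q (Icc 0 c.G) := by
    have h1 := A.Θu_contOn hv
    have h2 := A.Θ1u_contOn hv
    have h3 := A.u1_contOn hv
    have h4 := c.ψ_cont
    have h5 := c.ψ1_cont
    simp only [hQ]
    fun_prop
  have hQ'c : ContinuousOn Q' (Icc 0 c.G) :=
    (A.D0_contOn hv).sub ((A.e1_contOn hv).sub (A.dis_contOn hv))
  have hder : ∀ g ∈ Ioo 0 c.G, HasDerivAt Q (Q' g) g := by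
    intro g hg
    have hg0 : Ici (0:ℝ) ∈ nhds g := Ici_mem_nhds hg.1
    have du := (A.hu hv (mem_Ici.2 hg.1.le)).hasDerivAt hg0
    have du1 := (A.hu1 hv (mem_Ici.2 hg.1.le)).hasDerivAt hg0
    have hm := A.maps hv (Ioo_subset_Icc_self hg)
    have dΘ := (A.hΘ _ hm).comp g du
    have dΘ1 := (A.hΘ1 _ hm).comp g du
    have dψ := c.hψ g
    have dψ1 := c.hψ1 g
    have db : HasDerivAt (fun g => c.b0 - c.s * g) (-c.s) g := by
      simpa using ((hasDerivAt_id g).const_mul c.s).const_sub c.b0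
    have := ((((dψ.mul dΘ1).mul du1).sub (dψ1.mul dΘ)).const_mul c.κ).sub ((db.mul dψ).mul dΘ)
    refine this.congr_deriv ?_
    simp only [hQ', D0, e1, dis, Core.S, R, Function.comp, u, u1, u2]
    simp only [Pi.mul_apply, Function.comp, u]
    ring
  have hint := intervalIntegral.integral_eq_sub_of_hasDerivAt_of_le c.G_pos.le hQc hder
    (hQ'c.intervalIntegrable_of_Icc c.G_pos.le)
  rw [intervalIntegral.integral_of_le c.G_pos.le, integral_Ioc_eq_integral_Ioo] at hint
  have i1 := intOn (c := c) (A.D0_contOn hv)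
  have i2 := intOn (c := c) (A.e1_contOn hv)
  have i3 := intOn (c := c) (A.dis_contOn hv)
  rw [A.f_eq hv]
  simp only [hQ'] at hint
  have i4 : IntegrableOn (fun g => A.e1 v g - A.dis v g) (Ioo 0 c.G) := i2.sub i3
  rw [integral_sub i1 i4, integral_sub i2 i3] at hint
  have r1 := A.hrob
  have r2 := c.hrobin v hv
  have hQ0 : Q c.G - Q 0 = -(c.b0 * (A.Θ1 (A.u v 0) * A.u v 0 - A.Θ (A.u v 0))) := by
    simp only [hQ, c.ψ_zero, c.ψ1_zero, c.ψ_G, c.ψ1_G]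
    have : c.κ * A.u1 v 0 = c.b0 * A.u v 0 := by simp only [u1, u]; linarith
    linear_combination (-A.Θ1 (A.u v 0)) * this
  linarith
end fixedv
end Adm


namespace Core
variable (c : Core)
def Jm : ℝ := c.gL * c.VF + c.G * c.VE
lemma Jm_nonneg : 0 ≤ c.Jm := by
  have := c.hVF; have := c.hVE; have := c.hgL; have := c.G_pos
  have : 0 < c.VE := by linarith
  unfold Jm; positivity
lemma J_bound {v g : ℝ} (hv : v ∈ Icc 0 c.VF) (hg : g ∈ Icc 0 c.G) : |c.J v g| ≤ c.Jm := by
  have := c.hVF; have := c.hVE; have := c.hgL; have := c.G_pos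
  have h1 : c.gL * v ≤ c.gL * c.VF := by have := hv.2; gcongr
  have h2 : 0 ≤ c.gL * v := mul_nonneg c.hgL.le hv.1
  have h3 : 0 ≤ g * (c.VE - v) := mul_nonneg hg.1 (by linarith [hv.2])
  have h4 : g * (c.VE - v) ≤ c.G * c.VE := by
    have := hg.2; have := hv.1; have := hv.2
    have : c.VE - v ≤ c.VE := by linarith
    have : 0 ≤ c.VE - v := by linarith
    gcongr
  have h5 : 0 ≤ c.gL * c.VF := by positivity
  have h6 : 0 ≤ c.G * c.VE := by have : 0 < c.VE := by linarith
                                 positivity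
  unfold J Jflux Jm
  rw [abs_le]; constructor <;> linarith
lemma J_cont_v (g : ℝ) : Continuous fun v => c.J v g := by unfold J Jflux; fun_prop
lemma J_meas : Measurable (Function.uncurry c.J) := by
  unfold J Jflux; simp only [Function.uncurry_def]; fun_prop
lemma J_der (v g : ℝ) : HasDerivAt (fun v => c.J v g) (-(g + c.gL)) v := by
  have := ((hasDerivAt_id v).const_mul (-c.gL)).add (((hasDerivAt_id v).const_sub c.VE).const_mul g)
  refine this.congr_deriv ?_
  ring
def cbI (g : ℝ) : ℝ := c.κ * |c.ψ2 g| + |c.b0 - c.s * g| * |c.ψ1 g| + 2 * (g + c.gL + c.s)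
def Cb : ℝ := 2 * c.b0 + ∫ g in Ioo 0 c.G, c.cbI g
lemma cbI_cont : Continuous c.cbI := by
  have := c.hψ2; have := c.ψ1_cont
  unfold cbI; fun_prop
end Core

namespace Adm
variable {c : Core} (A : Adm c)

lemma Θ_cont : Continuous A.Θ := by
  have : LipschitzWith (Real.toNNReal A.L) A.Θ := by
    refine LipschitzWith.of_dist_le_mul fun x y => ?_
    rw [Real.coe_toNNReal _ A.hL, Real.dist_eq, Real.dist_eq]
    have h1 := A.hlip x y
    have h2 := A.hlip y x
    have e1 : max (y - x) 0 ≤ |x - y| := max_le (by rw [abs_sub_comm]; exact le_abs_self _) (abs_nonneg _)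
    have e2 : max (x - y) 0 ≤ |x - y| := max_le (le_abs_self _) (abs_nonneg _)
    have e3 := mul_le_mul_of_nonneg_left e1 A.hL
    have e4 := mul_le_mul_of_nonneg_left e2 A.hL
    rw [abs_le]; constructor <;> linarith
  exact this.continuous

lemma W_cont_v (g : ℝ) : Continuous fun v => A.W v g := by
  have h1 := c.J_cont_v g
  have h2 := A.Θ_cont
  have h3 := c.hPc g
  unfold W u
  fun_prop

lemma u_meas : Measurable (Function.uncurry A.u) := by
  have h1 : Measurable fun x : ℝ × ℝ => A.k x.2 := A.hkm.comp measurable_snd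
  exact h1.sub c.hPm

lemma W_meas : Measurable (Function.uncurry A.W) := by
  have h1 := c.J_meas
  have h2 : Measurable fun x : ℝ × ℝ => c.ψ x.2 := c.ψ_cont.measurable.comp measurable_snd
  have h3 : Measurable fun x : ℝ × ℝ => A.Θ (A.u x.1 x.2) := A.Θ_cont.measurable.comp A.u_meas
  exact (h1.mul h2).mul h3

lemma Θ_bound {v g : ℝ} (hv : v ∈ Icc 0 c.VF) (hg : g ∈ Icc 0 c.G) : |A.Θ (A.u v g)| ≤ A.L := by
  have hc : Continuous fun v => |A.Θ (A.u v g)| := by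
    have h2 := A.Θ_cont
    have h3 := c.hPc g
    unfold u
    fun_prop
  have : closure (Ioo 0 c.VF) ⊆ {v | |A.Θ (A.u v g)| ≤ A.L} := by
    refine closure_minimal (fun v hv => A.hb v hv g hg) (isClosed_le hc continuous_const)
  rw [closure_Ioo c.hVF.ne] at this
  exact this hv

lemma W_bound {v g : ℝ} (hv : v ∈ Icc 0 c.VF) (hg : g ∈ Icc 0 c.G) : |A.W v g| ≤ c.Jm * A.L := by
  unfold W
  rw [abs_mul, abs_mul, abs_of_nonneg (c.ψ_nonneg g)]
  have h1 := c.J_bound hv hg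
  have h2 := A.Θ_bound hv hg
  have h3 := c.ψ_le g
  have h4 := c.ψ_nonneg g
  have h5 : |c.J v g| * c.ψ g ≤ c.Jm * 1 := by gcongr; exact c.Jm_nonneg
  calc _ ≤ c.Jm * 1 * A.L := by gcongr; have := c.Jm_nonneg; linarith
    _ = _ := by ring

lemma W_int {v : ℝ} (hv : v ∈ Icc 0 c.VF) : IntegrableOn (A.W v) (Ioo 0 c.G) := by
  refine Measure.integrableOn_of_bounded (M := c.Jm * A.L) (by simp)
      (A.W_meas.of_uncurry_left).aestronglyMeasurable ?_
  filter_upwards [ae_restrict_mem measurableSet_Ioo] with g hg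
    using A.W_bound hv (Ioo_subset_Icc_self hg)

lemma T_cont : ContinuousOn A.T (Icc 0 c.VF) := by
  refine continuousOn_of_dominated (bound := fun _ => c.Jm * A.L) ?_ ?_ ?_ ?_
  · intro v _
    exact (A.W_meas.of_uncurry_left).aestronglyMeasurable
  · intro v hv
    filter_upwards [ae_restrict_mem measurableSet_Ioo] with g hg
      using A.W_bound hv (Ioo_subset_Icc_self hg)
  · exact integrable_const _
  · exact Eventually.of_forall fun g => (A.W_cont_v g).continuousOn

lemma W_der {v g : ℝ} (hv : v ∈ Ioo 0 c.VF) (hg : g ∈ Ioo 0 c.G) :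
    HasDerivAt (fun v => A.W v g) (A.D v g) v := by
  have hc : v ∈ Ioo 0 c.VF ∧ g ∈ Ioo 0 c.G := ⟨hv, hg⟩
  have hP := c.hPv v hv g hg.1
  have hu : HasDerivAt (fun v => A.u v g) (-c.Pv v g) v := hP.const_sub (A.k g)
  have hΘ := (A.hΘ _ (A.hrange v hv g (Ioo_subset_Icc_self hg))).comp v hu
  have := ((c.J_der v g).mul_const (c.ψ g)).mul hΘ
  refine this.congr_deriv ?_
  have hpde := c.hpde v hv g hg.1
  have hS : c.J v g * c.Pv v g = c.S v g := hpde
  simp only [D, if_pos hc, D0, ← hS, Function.comp, u]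
  ring

lemma D_meas : Measurable (Function.uncurry A.D) := by
  classical
  set E : Set (ℝ × ℝ) := Ioo 0 c.VF ×ˢ Ioo 0 c.G
  have hE : MeasurableSet E := measurableSet_Ioo.prod measurableSet_Ioo
  have hq : ∀ n : ℕ, Measurable (E.indicator fun x : ℝ × ℝ =>
      ((n:ℝ) + 1) * (A.W (x.1 + 1 / ((n:ℝ) + 1)) x.2 - A.W x.1 x.2)) := by
    intro n
    refine Measurable.indicator ?_ hE
    refine measurable_const.mul (Measurable.sub ?_ A.W_meas)
    exact A.W_meas.comp ((measurable_fst.add_const _).prodMk measurable_snd)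
  refine measurable_of_tendsto_metrizable hq ?_
  rw [tendsto_pi_nhds]
  rintro ⟨v, g⟩
  by_cases hx : (v, g) ∈ E
  · simp only [indicator_of_mem hx, Function.uncurry]
    have := (A.W_der (mem_prod.1 hx).1 (mem_prod.1 hx).2).tendsto_slope
    have ht : Tendsto (fun n : ℕ => v + 1 / ((n:ℝ) + 1)) atTop (nhdsWithin v {v}ᶜ) := by
      refine tendsto_nhdsWithin_iff.2 ⟨?_, Eventually.of_forall fun n => ?_⟩
      · simpa using (tendsto_const_nhds (x := v)).add tendsto_one_div_add_atTop_nhds_zero_nat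
      · have : (0:ℝ) < 1 / ((n:ℝ) + 1) := by positivity
        simp only [mem_compl_iff, mem_singleton_iff]; linarith
    refine (this.comp ht).congr fun n => ?_
    simp only [Function.comp, slope_def_field]
    field_simp
    ring
  · have hx' : ¬ (v ∈ Ioo 0 c.VF ∧ g ∈ Ioo 0 c.G) := fun h => hx (mem_prod.2 h)
    simp only [indicator_of_notMem hx, Function.uncurry, D, if_neg hx']
    exact tendsto_const_nhds

lemma f_meas : Measurable A.f :=
  (A.D_meas.stronglyMeasurable.integral_prod_right).measurable

theorem f_le {v : ℝ} (hv : v ∈ Ioo 0 c.VF) :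
    A.f v ≤ A.L * (c.Cb + ∫ g in Ioo 0 c.G, |A.R g|) := by
  rw [A.ibp hv]
  have h0 : (0:ℝ) ∈ Icc 0 c.G := ⟨le_rfl, c.G_pos.le⟩
  have b0 := abs_le.1 (A.hb v hv 0 h0)
  have b1 := abs_le.1 (A.hb2 v hv 0 h0)
  have hd : 0 ≤ ∫ g in Ioo 0 c.G, A.dis v g := by
    refine setIntegral_nonneg measurableSet_Ioo fun g hg => ?_
    have h1 := A.hΘ2 _ (A.hrange v hv g (Ioo_subset_Icc_self hg))
    have h2 := c.ψ_nonneg g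
    have h3 := c.hκ
    have h1 : 0 ≤ A.Θ2 (A.u v g) := h1
    unfold dis; positivity
  have iR : IntegrableOn (fun g => |A.R g|) (Ioo 0 c.G) :=
    intOn ((A.R_contOn.mono Icc_sub).abs)
  have ic : IntegrableOn c.cbI (Ioo 0 c.G) := intOn c.cbI_cont.continuousOn
  have he : ∫ g in Ioo 0 c.G, A.e1 v g ≤ ∫ g in Ioo 0 c.G, A.L * (c.cbI g + |A.R g|) := by
    refine setIntegral_mono_on (intOn (A.e1_contOn hv)) ((ic.add iR).const_mul _)
      measurableSet_Ioo fun g hg => ?_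
    have hg' := Ioo_subset_Icc_self hg
    have hΘ : |A.Θ (A.u v g)| ≤ A.L := A.hb v hv g hg'
    have hΘ1 : |A.Θ1 (A.u v g)| ≤ A.L := A.hb1 v hv g hg'
    have hΘ2 : |A.Θ1 (A.u v g) * A.u v g| ≤ A.L := A.hb2 v hv g hg'
    have hL := A.hL
    have hψ := c.ψ_nonneg g
    have hψ' := c.ψ_le g
    have hκ := c.hκ
    have hg0 : 0 < g + c.gL + c.s := by have := hg.1; have := c.hgL; have := c.hs; linarith
    have t1 : (c.κ * c.ψ2 g + (c.b0 - c.s * g) * c.ψ1 g) * A.Θ (A.u v g) ≤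
        (c.κ * |c.ψ2 g| + |c.b0 - c.s * g| * |c.ψ1 g|) * A.L := by
      refine (le_abs_self _).trans ?_
      rw [abs_mul]
      gcongr
      refine (abs_add_le _ _).trans ?_
      rw [abs_mul, abs_mul, abs_of_pos hκ]
    have t2 : c.ψ g * (g + c.gL + c.s) * (A.Θ1 (A.u v g) * A.u v g - A.Θ (A.u v g)) ≤
        1 * (g + c.gL + c.s) * (A.L + A.L) := by
      have : A.Θ1 (A.u v g) * A.u v g - A.Θ (A.u v g) ≤ A.L + A.L := by
        linarith [(abs_le.1 hΘ).1, (abs_le.1 hΘ2).2]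
      calc _ ≤ c.ψ g * (g + c.gL + c.s) * (A.L + A.L) := by gcongr
        _ ≤ _ := by gcongr
    have t3 : -(c.ψ g * A.Θ1 (A.u v g) * A.R g) ≤ 1 * A.L * |A.R g| := by
      refine (neg_le_abs _).trans ?_
      rw [abs_mul, abs_mul, abs_of_nonneg hψ]
      gcongr
    simp only [e1, Core.cbI]
    linarith
  rw [integral_const_mul, integral_add ic iR] at he
  have hb := c.hb0
  have hneg : -(c.b0 * (A.Θ1 (A.u v 0) * A.u v 0 - A.Θ (A.u v 0))) ≤ c.b0 * (A.L + A.L) := by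
    rw [← mul_neg]
    have b0 : -A.L ≤ A.Θ (A.u v 0) ∧ A.Θ (A.u v 0) ≤ A.L := b0
    have b1 : -A.L ≤ A.Θ1 (A.u v 0) * A.u v 0 ∧ A.Θ1 (A.u v 0) * A.u v 0 ≤ A.L := b1
    gcongr
    linarith [b0.2, b1.1]
  unfold Core.Cb
  linarith

def h (N v : ℝ) : ℝ := max (A.f v) (-N)
lemma h_int (N : ℝ) {a b : ℝ} (ha : 0 ≤ a) (hb : b ≤ c.VF) : IntegrableOn (A.h N) (Ioo a b) := by
  set M := max (|A.L * (c.Cb + ∫ g in Ioo 0 c.G, |A.R g|)|) |N|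
  refine Measure.integrableOn_of_bounded (M := M) (by simp)
      ((A.f_meas.max measurable_const).aestronglyMeasurable) ?_
  filter_upwards [ae_restrict_mem measurableSet_Ioo] with v hv
  have := A.f_le (v := v) ⟨ha.trans_lt hv.1, hv.2.trans_le hb⟩
  have h1 : |A.L * (c.Cb + ∫ g in Ioo 0 c.G, |A.R g|)| ≤ M := le_max_left _ _
  have h2 : |N| ≤ M := le_max_right _ _
  have h3 := le_abs_self (A.L * (c.Cb + ∫ g in Ioo 0 c.G, |A.R g|))
  have h4 := neg_abs_le N
  have h5 := le_abs_self N
  rw [Real.norm_eq_abs, abs_le]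
  refine ⟨le_max_of_le_right ?_, max_le ?_ ?_⟩ <;> linarith
end Adm


/-! ### smooth step -/
def eta : ℝ → ℝ := Real.smoothTransition
def eta1 : ℝ → ℝ := deriv eta
def eta2 : ℝ → ℝ := deriv eta1

lemma eta_smooth : ContDiff ℝ 3 eta := Real.smoothTransition.contDiff
lemma eta_der (x : ℝ) : HasDerivAt eta (eta1 x) x :=
  ((eta_smooth.differentiable (by norm_num)) x).hasDerivAt
lemma eta1_smooth : ContDiff ℝ 2 eta1 := by
  have := eta_smooth
  rw [show (3 : WithTop ℕ∞) = 2 + 1 by norm_num, contDiff_succ_iff_deriv] at this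
  exact this.2.2
lemma eta1_der (x : ℝ) : HasDerivAt eta1 (eta2 x) x :=
  ((eta1_smooth.differentiable (by norm_num)) x).hasDerivAt
lemma eta2_smooth : ContDiff ℝ 1 eta2 := by
  have := eta1_smooth
  rw [show (2 : WithTop ℕ∞) = 1 + 1 by norm_num, contDiff_succ_iff_deriv] at this
  exact this.2.2
lemma eta_cont : Continuous eta := eta_smooth.continuous
lemma eta1_cont : Continuous eta1 := eta1_smooth.continuous
lemma eta2_cont : Continuous eta2 := eta2_smooth.continuous
lemma eta_nonneg (x : ℝ) : 0 ≤ eta x := Real.smoothTransition.nonneg x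
lemma eta_le (x : ℝ) : eta x ≤ 1 := Real.smoothTransition.le_one x
lemma eta_of_nonpos {x : ℝ} (h : x ≤ 0) : eta x = 0 := Real.smoothTransition.zero_of_nonpos h
lemma eta_of_ge {x : ℝ} (h : 1 ≤ x) : eta x = 1 := Real.smoothTransition.one_of_one_le h
lemma eta_mono : Monotone eta := Real.smoothTransition.monotone
lemma eta1_nonneg (x : ℝ) : 0 ≤ eta1 x := eta_mono.deriv_nonneg

lemma deriv_zero_of_const {f f' : ℝ → ℝ} {a : ℝ} (hf : ∀ x, HasDerivAt f (f' x) x) (hc : Continuous f')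
    {s : Set ℝ} (hs : IsOpen s) (hcs : ∀ x ∈ s, f x = a) {x : ℝ} (hx : x ∈ closure s) : f' x = 0 := by
  have : closure s ⊆ {x | f' x = 0} := by
    refine closure_minimal (fun y hy => ?_) (isClosed_eq hc continuous_const)
    have h1 : HasDerivAt f 0 y := (hasDerivAt_const y a).congr_of_eventuallyEq
      (by filter_upwards [hs.mem_nhds hy] with z hz using hcs z hz)
    exact (hf y).unique h1
  exact this hx
lemma eta1_of_nonpos {x : ℝ} (h : x ≤ 0) : eta1 x = 0 :=
  deriv_zero_of_const eta_der eta1_cont isOpen_Iio (s := Iio 0) (a := 0)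
    (fun x hx => eta_of_nonpos (le_of_lt hx)) (by simpa using h)
lemma eta1_of_ge {x : ℝ} (h : 1 ≤ x) : eta1 x = 0 :=
  deriv_zero_of_const eta_der eta1_cont isOpen_Ioi (s := Ioi 1) (a := 1)
    (fun x hx => eta_of_ge (le_of_lt hx)) (by simpa using h)
lemma eta2_of_nonpos {x : ℝ} (h : x ≤ 0) : eta2 x = 0 :=
  deriv_zero_of_const eta1_der eta2_cont isOpen_Iio (s := Iio 0) (a := 0)
    (fun x hx => eta1_of_nonpos (le_of_lt hx)) (by simpa using h)
lemma eta2_of_ge {x : ℝ} (h : 1 ≤ x) : eta2 x = 0 :=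
  deriv_zero_of_const eta1_der eta2_cont isOpen_Ioi (s := Ioi 1) (a := 0)
    (fun x hx => eta1_of_ge (le_of_lt hx)) (by simpa using h)

lemma eta_bounds : ∃ K : ℝ, 0 ≤ K ∧ (∀ x, |eta1 x| ≤ K) ∧ ∀ x, |eta2 x| ≤ K := by
  obtain ⟨K1, h1⟩ := isCompact_Icc.exists_bound_of_continuousOn (s := Icc (0:ℝ) 1) eta1_cont.continuousOn
  obtain ⟨K2, h2⟩ := isCompact_Icc.exists_bound_of_continuousOn (s := Icc (0:ℝ) 1) eta2_cont.continuousOn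
  have p1 : 0 ≤ K1 := (norm_nonneg _).trans (h1 0 (by simp))
  refine ⟨max K1 K2, le_max_of_le_left p1, fun x => ?_, fun x => ?_⟩
  · by_cases hx : x ∈ Icc (0:ℝ) 1
    · exact (h1 x hx).trans (le_max_left _ _)
    · have : eta1 x = 0 := by
        rw [mem_Icc, not_and_or, not_le, not_le] at hx
        rcases hx with hx | hx
        exacts [eta1_of_nonpos hx.le, eta1_of_ge hx.le]
      rw [this, abs_zero]; exact le_max_of_le_left p1
  · by_cases hx : x ∈ Icc (0:ℝ) 1
    · exact (h2 x hx).trans (le_max_right _ _)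
    · have : eta2 x = 0 := by
        rw [mem_Icc, not_and_or, not_le, not_le] at hx
        rcases hx with hx | hx
        exacts [eta2_of_nonpos hx.le, eta2_of_ge hx.le]
      rw [this, abs_zero]; exact le_max_of_le_left p1

/-- smoothed positive part -/
def tht (ε u : ℝ) : ℝ := ∫ t in (0:ℝ)..u, eta (t / ε)
section
variable {ε : ℝ} 
lemma eta_div_cont : Continuous fun t => eta (t / ε) := eta_cont.comp (by fun_prop)
lemma tht_der (u : ℝ) : HasDerivAt (tht ε) (eta (u / ε)) u :=
  intervalIntegral.integral_hasDerivAt_right (eta_div_cont.intervalIntegrable _ _)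
    (eta_div_cont.stronglyMeasurableAtFilter _ _) eta_div_cont.continuousAt
lemma tht_der2 (u : ℝ) : HasDerivAt (fun u => eta (u / ε)) (eta1 (u / ε) / ε) u := by
  have := (eta_der (u / ε)).comp u ((hasDerivAt_id u).div_const ε)
  refine this.congr_deriv ?_
  simp [div_eq_mul_inv]
lemma tht_sub (a b : ℝ) : tht ε b - tht ε a = ∫ t in a..b, eta (t / ε) :=
  intervalIntegral.integral_interval_sub_left (eta_div_cont.intervalIntegrable _ _)
    (eta_div_cont.intervalIntegrable _ _)
lemma tht_lip (a b : ℝ) : tht ε b - tht ε a ≤ max (b - a) 0 := by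
  rw [tht_sub]
  rcases le_total a b with h | h
  · have := intervalIntegral.integral_mono_on h (eta_div_cont.intervalIntegrable (μ := volume) _ _)
      (intervalIntegrable_const (c := (1:ℝ))) (fun t _ => eta_le (t / ε))
    refine le_max_of_le_left (this.trans ?_)
    simp
  · rw [intervalIntegral.integral_symm]
    have : 0 ≤ ∫ t in b..a, eta (t / ε) := intervalIntegral.integral_nonneg h fun t _ => eta_nonneg _
    exact le_max_of_le_right (by linarith)
lemma tht_zero : tht ε 0 = 0 := by simp [tht]
lemma tht_nonpos (hε : 0 < ε) {u : ℝ} (h : u ≤ 0) : tht ε u = 0 := by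
  have : ∫ t in (0:ℝ)..u, eta (t / ε) = ∫ t in (0:ℝ)..u, (0:ℝ) := by
    refine intervalIntegral.integral_congr fun t ht => ?_
    rw [uIcc_of_ge h] at ht
    exact eta_of_nonpos (div_nonpos_of_nonpos_of_nonneg ht.2 hε.le)
  rw [tht, this]; simp
lemma tht_nonneg (hε : 0 < ε) (u : ℝ) : 0 ≤ tht ε u := by
  rcases le_total u 0 with h | h
  · rw [tht_nonpos hε h]
  · exact intervalIntegral.integral_nonneg h fun t _ => eta_nonneg _
lemma tht_ge (hε : 0 < ε) (u : ℝ) : max u 0 ≤ tht ε u + ε := by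
  have h0 := tht_nonneg hε u
  refine max_le ?_ (by linarith)
  rcases le_total u ε with h | h
  · linarith
  · have h1 := tht_nonneg hε ε
    have h2 := tht_sub (ε := ε) ε u
    have : ∫ t in ε..u, eta (t / ε) = ∫ t in ε..u, (1:ℝ) := by
      refine intervalIntegral.integral_congr fun t ht => ?_
      rw [uIcc_of_le h] at ht
      exact eta_of_ge ((one_le_div hε).2 ht.1)
    rw [this] at h2
    simp at h2
    linarith
end


namespace Core
variable (c : Core)
def gam (v : ℝ) : ℝ := c.gL * v / (c.VE - v)
structure An (n v : ℝ) : Prop where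
  b0 : ∀ x ∈ Icc 0 c.G, |c.P v x| ≤ n
  b1 : ∀ x ∈ Icc 0 c.G, ∀ y ∈ Icc 0 c.G, |c.P v x - c.P v y| ≤ n * |x - y|
  b2 : ∀ x ∈ Icc 0 c.G, ∀ y ∈ Icc 0 c.G, ∀ h, x + h ∈ Icc 0 c.G → y + h ∈ Icc 0 c.G →
    |c.P v (x + h) - c.P v x - (c.P v (y + h) - c.P v y)| ≤ n * |h| * |x - y|
def En (n v : ℝ) : Prop := ∀ v' ∈ Ioo 0 c.VF, |v' - v| < 1 / (n + 1) →
  |c.P v' (c.gam v) - c.P v (c.gam v)| ≤ n * |v' - v|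

variable {c}
lemma VE_sub {v : ℝ} (hv : v ∈ Icc 0 c.VF) : 0 < c.VE - v := by linarith [c.hVE, hv.2]
lemma J_eq {v : ℝ} (hv : v ∈ Icc 0 c.VF) (g : ℝ) : c.J v g = (c.VE - v) * (g - c.gam v) := by
  have := VE_sub hv
  unfold J Jflux gam
  field_simp
  ring
lemma gam_pos {v : ℝ} (hv : v ∈ Ioo 0 c.VF) : 0 < c.gam v := by
  have := VE_sub (Ioo_subset_Icc_self hv)
  have := c.hgL; have := hv.1
  unfold gam; positivity
lemma gam_sub {v w : ℝ} (hv : v ∈ Icc 0 c.VF) (hw : w ∈ Icc 0 c.VF) :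
    c.gam w - c.gam v = c.gL * c.VE * (w - v) / ((c.VE - v) * (c.VE - w)) := by
  have := VE_sub hv; have := VE_sub hw
  unfold gam
  field_simp
  ring
lemma gam_lt {v : ℝ} (hv : v ∈ Icc 0 c.VF) : c.gam v < c.G := by
  refine lt_of_le_of_lt ?_ c.hG
  have h1 := VE_sub hv; have h2 := c.hVE; have := hv.1; have := hv.2; have := c.hgL
  have h3 : 0 < c.VE - c.VF := by linarith
  unfold gam
  have h4 : 0 ≤ c.gL * c.VF := mul_nonneg c.hgL.le c.hVF.le
  gcongr
lemma gam_mem {v : ℝ} (hv : v ∈ Ioo 0 c.VF) : c.gam v ∈ Ioo 0 c.G :=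
  ⟨gam_pos hv, gam_lt (Ioo_subset_Icc_self hv)⟩
lemma gam_cont {v : ℝ} (hv : v ∈ Icc 0 c.VF) : ContinuousAt c.gam v := by
  have := VE_sub hv
  unfold gam
  exact ContinuousAt.div (by fun_prop) (by fun_prop) this.ne'
def mm (c : Core) : ℝ := c.gL / c.VE
def MM (c : Core) : ℝ := c.gL * c.VE / (c.VE - c.VF) ^ 2
lemma VE_pos (c : Core) : 0 < c.VE := c.hVF.trans c.hVE
lemma mm_pos (c : Core) : 0 < c.mm := div_pos c.hgL c.VE_pos
lemma MM_pos (c : Core) : 0 < c.MM := div_pos (mul_pos c.hgL c.VE_pos) (pow_pos (by linarith [c.hVE]) _)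
lemma gam_lower {v w : ℝ} (hv : v ∈ Icc 0 c.VF) (hw : w ∈ Icc 0 c.VF) (h : v ≤ w) :
    c.mm * (w - v) ≤ c.gam w - c.gam v := by
  rw [gam_sub hv hw]
  have h1 := VE_sub hv; have h2 := VE_sub hw
  have h3 := c.VE_pos; have h4 := c.hgL
  have h5 : c.mm * (w - v) = c.gL * c.VE * (w - v) / (c.VE * c.VE) := by
    unfold mm; field_simp
  rw [h5]
  have h6 : 0 ≤ c.gL * c.VE * (w - v) := mul_nonneg (by positivity) (by linarith)
  have := hv.1; have := hw.1
  gcongr <;> linarith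
lemma gam_upper {v w : ℝ} (hv : v ∈ Icc 0 c.VF) (hw : w ∈ Icc 0 c.VF) (h : v ≤ w) :
    c.gam w - c.gam v ≤ c.MM * (w - v) := by
  rw [gam_sub hv hw]
  have h1 := VE_sub hv; have h2 := VE_sub hw
  have h3 := c.VE_pos; have h4 := c.hgL
  have h7 : 0 < c.VE - c.VF := by linarith [c.hVE]
  have h5 : c.MM * (w - v) = c.gL * c.VE * (w - v) / ((c.VE - c.VF) * (c.VE - c.VF)) := by
    unfold MM; field_simp
  rw [h5]
  have h6 : 0 ≤ c.gL * c.VE * (w - v) := mul_nonneg (by positivity) (by linarith)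
  have := hv.2; have := hw.2
  gcongr

section
variable {n v : ℝ} (hn : 0 ≤ n) (hv : v ∈ Ioo 0 c.VF) (hA : c.An n v)
include hn hv hA
lemma Pg_at {g : ℝ} (hg : g ∈ Ioo 0 c.G) : HasDerivAt (c.P v) (c.Pg v g) g :=
  (c.hPg v hv g hg.1.le).hasDerivAt (Ici_mem_nhds hg.1)
lemma Pgg_at {g : ℝ} (hg : g ∈ Ioo 0 c.G) : HasDerivAt (c.Pg v) (c.Pgg v g) g :=
  (c.hPgg v hv g hg.1.le).hasDerivAt (Ici_mem_nhds hg.1)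
lemma An.Pg_le {g : ℝ} (hg : g ∈ Ioo 0 c.G) : |c.Pg v g| ≤ n := by
  refine (Pg_at hn hv hA hg).le_of_lip' hn ?_
  filter_upwards [Icc_mem_nhds hg.1 hg.2] with x hx
  exact hA.b1 x hx g (Ioo_subset_Icc_self hg)
lemma An.Pg_lip {x y : ℝ} (hx : x ∈ Ioo 0 c.G) (hy : y ∈ Ioo 0 c.G) :
    |c.Pg v x - c.Pg v y| ≤ n * |x - y| := by
  have d1 : HasDerivAt (fun t => c.P v (x + t)) (c.Pg v x) 0 := by
    have := Pg_at hn hv hA hx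
    rw [← add_zero x] at this
    simpa using this.comp_const_add x 0
  have d2 : HasDerivAt (fun t => c.P v (y + t)) (c.Pg v y) 0 := by
    have := Pg_at hn hv hA hy
    rw [← add_zero y] at this
    simpa using this.comp_const_add y 0
  refine (d1.sub d2).le_of_lip' (by positivity) ?_
  have e1 : ∀ᶠ t in nhds (0:ℝ), x + t ∈ Icc 0 c.G := by
    have : ContinuousAt (fun t : ℝ => x + t) 0 := by fun_prop
    exact this (by simpa using Icc_mem_nhds hx.1 hx.2)
  have e2 : ∀ᶠ t in nhds (0:ℝ), y + t ∈ Icc 0 c.G := by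
    have : ContinuousAt (fun t : ℝ => y + t) 0 := by fun_prop
    exact this (by simpa using Icc_mem_nhds hy.1 hy.2)
  filter_upwards [e1, e2] with t h1 h2
  have := hA.b2 x (Ioo_subset_Icc_self hx) y (Ioo_subset_Icc_self hy) t h1 h2
  simp only [Pi.sub_apply, add_zero, sub_zero, Real.norm_eq_abs]
  calc _ = |c.P v (x + t) - c.P v x - (c.P v (y + t) - c.P v y)| := by congr 1; ring
    _ ≤ _ := this
    _ = _ := by ring
lemma An.Pgg_le {g : ℝ} (hg : g ∈ Ioo 0 c.G) : |c.Pgg v g| ≤ n := by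
  refine (Pgg_at hn hv hA hg).le_of_lip' hn ?_
  filter_upwards [Ioo_mem_nhds hg.1 hg.2] with x hx
  exact hA.Pg_lip hn hv hx hg
end

lemma An.mono {n n' v : ℝ} (hA : c.An n v) (h : n ≤ n') : c.An n' v where
  b0 x hx := (hA.b0 x hx).trans h
  b1 x hx y hy := (hA.b1 x hx y hy).trans (by gcongr)
  b2 x hx y hy t h1 h2 := (hA.b2 x hx y hy t h1 h2).trans (by gcongr)
lemma En.mono {n n' v : ℝ} (hA : c.En n v) (hn : 0 ≤ n) (h : n ≤ n') : c.En n' v := fun v' hv' hd =>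
  (hA v' hv' (hd.trans_le (by gcongr))).trans (by gcongr)

lemma An_exists {v : ℝ} (hv : v ∈ Ioo 0 c.VF) : ∃ n : ℝ, c.An n v := by
  have hs : Icc 0 c.G ⊆ Ici (0:ℝ) := Icc_subset_Ici_self
  obtain ⟨K0, h0⟩ := isCompact_Icc.exists_bound_of_continuousOn ((c.P_contOn hv).mono hs)
  obtain ⟨K1, h1⟩ := isCompact_Icc.exists_bound_of_continuousOn ((c.Pg_contOn hv).mono hs)
  obtain ⟨K2, h2⟩ := isCompact_Icc.exists_bound_of_continuousOn ((c.hPggc v hv).mono hs)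
  have l1 : ∀ x ∈ Icc 0 c.G, ∀ y ∈ Icc 0 c.G, |c.P v x - c.P v y| ≤ K1 * |x - y| := by
    intro x hx y hy
    exact (convex_Icc 0 c.G).norm_image_sub_le_of_norm_hasDerivWithin_le
      (fun z hz => (c.hPg v hv z (hs hz)).mono hs) h1 hy hx
  have l2 : ∀ x ∈ Icc 0 c.G, ∀ y ∈ Icc 0 c.G, |c.Pg v x - c.Pg v y| ≤ K2 * |x - y| := by
    intro x hx y hy
    exact (convex_Icc 0 c.G).norm_image_sub_le_of_norm_hasDerivWithin_le
      (fun z hz => (c.hPgg v hv z (hs hz)).mono hs) h2 hy hx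
  refine ⟨max K0 (max K1 K2), fun x hx => (h0 x hx).trans (le_max_left _ _),
    fun x hx y hy => (l1 x hx y hy).trans (by gcongr; exact le_max_of_le_right (le_max_left _ _)), ?_⟩
  intro x hx y hy t hxt hyt
  have hcv : Convex ℝ {x | x ∈ Icc 0 c.G ∧ x + t ∈ Icc 0 c.G} := by
    have : {x | x ∈ Icc 0 c.G ∧ x + t ∈ Icc 0 c.G} = Icc 0 c.G ∩ Icc (0 - t) (c.G - t) := by
      ext z; simp only [mem_ofPred_eq, mem_inter_iff, mem_Icc, sub_le_iff_le_add, le_sub_iff_add_le]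
    rw [this]; exact (convex_Icc _ _).inter (convex_Icc _ _)
  have := hcv.norm_image_sub_le_of_norm_hasDerivWithin_le (f := fun z => c.P v (z + t) - c.P v z)
    (f' := fun z => c.Pg v (z + t) - c.Pg v z) (C := K2 * |t|) (x := y) (y := x) ?_ ?_ ⟨hy, hyt⟩ ⟨hx, hxt⟩
  · refine (this : |_| ≤ _).trans ?_
    rw [Real.norm_eq_abs]
    gcongr
    exact le_max_of_le_right (le_max_right _ _)
  · intro z hz
    have d1 := (c.hPg v hv (z + t) (hs hz.2)).mono hs
    have d2 := (c.hPg v hv z (hs hz.1)).mono hs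
    have d3 : HasDerivWithinAt (fun z => z + t) 1 {x | x ∈ Icc 0 c.G ∧ x + t ∈ Icc 0 c.G} z :=
      ((hasDerivAt_id z).add_const t).hasDerivWithinAt
    have d4 := d1.comp z d3 (fun w hw => hw.2)
    rw [mul_one] at d4
    exact d4.sub (d2.mono fun w hw => hw.1)
  · intro z hz
    refine (l2 (z + t) hz.2 z hz.1).trans ?_
    simp

lemma En_exists {v : ℝ} (hv : v ∈ Ioo 0 c.VF) : ∃ n : ℝ, 0 ≤ n ∧ c.En n v := by
  have hd := (c.hPv v hv (c.gam v) (gam_pos hv))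
  have := hd.hasFDerivAt.isBigO_sub
  obtain ⟨C, hC⟩ := this.bound
  obtain ⟨δ, hδ, hb⟩ := Metric.eventually_nhds_iff.1 hC
  refine ⟨max C (max 0 (1 / δ)), le_max_of_le_right (le_max_left _ _), fun v' hv' h => ?_⟩
  have h1 : 1 / δ ≤ max C (max 0 (1 / δ)) := le_max_of_le_right (le_max_right _ _)
  have h2 : C ≤ max C (max 0 (1 / δ)) := le_max_left _ _
  set n := max C (max 0 (1 / δ))
  have h3 : 1 / (n + 1) ≤ δ := by
    have : 0 < 1 / δ := by positivity
    rw [div_le_iff₀ (by linarith)]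
    rw [div_le_iff₀ hδ] at h1
    nlinarith
  have := hb (y := v') (by rw [Real.dist_eq]; linarith)
  exact (this : |_| ≤ _).trans (by rw [Real.norm_eq_abs]; gcongr)

lemma AE_exists {v : ℝ} (hv : v ∈ Ioo 0 c.VF) : ∃ n : ℕ, c.An n v ∧ c.En n v := by
  obtain ⟨n1, h1⟩ := An_exists hv
  obtain ⟨n2, h0, h2⟩ := En_exists hv
  obtain ⟨n, hn⟩ := exists_nat_ge (max n1 n2)
  exact ⟨n, h1.mono ((le_max_left _ _).trans hn), h2.mono h0 ((le_max_right _ _).trans hn)⟩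

lemma AE_closed {n : ℝ} {v : ℝ} (hv : v ∈ Ioo 0 c.VF) {s : Set ℝ} (hs : v ∈ closure s)
    (hs' : ∀ w ∈ s, w ∈ Ioo 0 c.VF ∧ c.An n w ∧ c.En n w) : c.An n v ∧ c.En n v := by
  have hne : (nhdsWithin v s).NeBot := mem_closure_iff_nhdsWithin_neBot.1 hs
  have tP : ∀ x, Tendsto (fun w => c.P w x) (nhdsWithin v s) (nhds (c.P v x)) := fun x =>
    ((c.hPc x).tendsto v).mono_left nhdsWithin_le_nhds
  have hA : c.An n v := by
    constructor
    · intro x hx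
      refine le_of_tendsto ((tP x).abs) ?_
      filter_upwards [self_mem_nhdsWithin] with w hw using (hs' w hw).2.1.b0 x hx
    · intro x hx y hy
      refine le_of_tendsto (((tP x).sub (tP y)).abs) ?_
      filter_upwards [self_mem_nhdsWithin] with w hw using (hs' w hw).2.1.b1 x hx y hy
    · intro x hx y hy h h1 h2
      refine le_of_tendsto ((((tP _).sub (tP _)).sub ((tP _).sub (tP _))).abs) ?_
      filter_upwards [self_mem_nhdsWithin] with w hw using (hs' w hw).2.1.b2 x hx y hy h h1 h2
  refine ⟨hA, fun v' hv' hd => ?_⟩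
  have tg : Tendsto c.gam (nhdsWithin v s) (nhds (c.gam v)) :=
    (gam_cont (Ioo_subset_Icc_self hv)).tendsto.mono_left nhdsWithin_le_nhds
  have ti : Tendsto (fun w : ℝ => w) (nhdsWithin v s) (nhds v) := tendsto_id.mono_left nhdsWithin_le_nhds
  have t1 : Tendsto (fun w => c.P v' (c.gam w)) (nhdsWithin v s) (nhds (c.P v' (c.gam v))) :=
    (((c.P_contOn hv').continuousAt (Ici_mem_nhds (gam_pos hv))).tendsto).comp tg
  have t2 : Tendsto (fun w => c.P w (c.gam w)) (nhdsWithin v s) (nhds (c.P v (c.gam v))) := by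
    have h1 : Tendsto (fun w => c.P w (c.gam w) - c.P w (c.gam v)) (nhdsWithin v s) (nhds 0) := by
      refine squeeze_zero_norm' (a := fun w => n * |c.gam w - c.gam v|) ?_ ?_
      · filter_upwards [self_mem_nhdsWithin] with w hw
        exact (hs' w hw).2.1.b1 _ (Ioo_subset_Icc_self (gam_mem (hs' w hw).1)) _
          (Ioo_subset_Icc_self (gam_mem hv))
      · have := ((tg.sub_const (c.gam v)).abs).const_mul n
        simpa using this
    simpa using h1.add (tP (c.gam v))
  have td : Tendsto (fun w => |v' - w|) (nhdsWithin v s) (nhds |v' - v|) := (ti.const_sub v').abs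
  refine le_of_tendsto_of_tendsto ((t1.sub t2).abs) (td.const_mul n) ?_
  filter_upwards [self_mem_nhdsWithin, td.eventually_lt_const hd] with w hw hwd
  exact (hs' w hw).2.2 v' hv' hwd
end Core


namespace Core
variable {c : Core}
def SB (c : Core) (n : ℝ) : ℝ := c.κ * n + (c.b0 + c.s * c.G) * n + c.s * n + (c.G + c.gL) * n
lemma op_bound {n x0 x1 x2 g : ℝ} {n1 n2 : ℝ} (hg : g ∈ Icc 0 c.G) (h0 : |x0| ≤ n) (h1 : |x1| ≤ n1) (h2 : |x2| ≤ n2) :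
    |c.κ * x2 - (c.b0 - c.s * g) * x1 + c.s * x0 + (g + c.gL) * x0| ≤
      c.κ * n2 + (c.b0 + c.s * c.G) * n1 + c.s * n + (c.G + c.gL) * n := by
  have := c.hκ; have := c.hb0; have := c.hs; have := c.hgL; have := hg.1; have hg2 := hg.2
  have e0 : |c.κ * x2| ≤ c.κ * n2 := by rw [abs_mul, abs_of_pos c.hκ]; gcongr
  have hb : |c.b0 - c.s * g| ≤ c.b0 + c.s * c.G := by
    have : 0 ≤ c.s * g := by positivity
    have : c.s * g ≤ c.s * c.G := by gcongr
    rw [abs_le]; constructor <;> linarith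
  have e1 : |(c.b0 - c.s * g) * x1| ≤ (c.b0 + c.s * c.G) * n1 := by
    rw [abs_mul]
    exact mul_le_mul hb h1 (abs_nonneg _) ((abs_nonneg _).trans hb)
  have e2 : |c.s * x0| ≤ c.s * n := by rw [abs_mul, abs_of_pos c.hs]; gcongr
  have e3 : |(g + c.gL) * x0| ≤ (c.G + c.gL) * n := by
    rw [abs_mul, abs_of_nonneg (by positivity : 0 ≤ g + c.gL)]
    have hn : 0 ≤ n := (abs_nonneg _).trans h0
    exact mul_le_mul (by linarith) h0 (abs_nonneg _) (by linarith [c.G_pos])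
  rw [abs_le] at *
  constructor <;> linarith [e0.1, e0.2, e1.1, e1.2, e2.1, e2.2, e3.1, e3.2]
lemma An.S_le {n v g : ℝ} (hn : 0 ≤ n) (hv : v ∈ Ioo 0 c.VF) (hA : c.An n v) (hg : g ∈ Ioo 0 c.G) :
    |c.S v g| ≤ c.SB n :=
  op_bound (Ioo_subset_Icc_self hg) (hA.b0 g (Ioo_subset_Icc_self hg)) (hA.Pg_le hn hv hg) (hA.Pgg_le hn hv hg)
end Core

lemma Adm.D_bound {c : Core} (A : Adm c) {n v g : ℝ} (hn : 0 ≤ n) (hv : v ∈ Ioo 0 c.VF) (hA : c.An n v)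
    (hg : g ∈ Ioo 0 c.G) : |A.D v g| ≤ (c.G + c.gL) * A.L + A.L * c.SB n := by
  have hc : v ∈ Ioo 0 c.VF ∧ g ∈ Ioo 0 c.G := ⟨hv, hg⟩
  simp only [Adm.D, if_pos hc, Adm.D0]
  have hg' := Ioo_subset_Icc_self hg
  have h1 := A.hb v hv g hg'
  have h2 := A.hb1 v hv g hg'
  have h3 := hA.S_le hn hv hg
  have p0 := c.ψ_nonneg g
  have p1 := c.ψ_le g
  have hL := A.hL
  have hgL := c.hgL
  have e1 : |-(g + c.gL) * c.ψ g * A.Θ (A.u v g)| ≤ (c.G + c.gL) * A.L := by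
    rw [abs_mul, abs_mul, abs_neg, abs_of_nonneg p0, abs_of_nonneg (by linarith [hg.1] : 0 ≤ g + c.gL)]
    have : (g + c.gL) * c.ψ g ≤ (c.G + c.gL) := by nlinarith [hg.1, hg.2]
    exact mul_le_mul this h1 (abs_nonneg _) (by linarith [c.G_pos])
  have e2 : |c.ψ g * A.Θ1 (A.u v g) * c.S v g| ≤ A.L * c.SB n := by
    rw [abs_mul, abs_mul, abs_of_nonneg p0]
    have : c.ψ g * |A.Θ1 (A.u v g)| ≤ A.L := by
      have : |A.Θ1 (A.u v g)| ≤ A.L := h2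
      nlinarith [abs_nonneg (A.Θ1 (A.u v g))]
    exact mul_le_mul this h3 (abs_nonneg _) hL
  exact (abs_sub _ _).trans (add_le_add e1 e2)

/-! ### Kato datum on a gap -/
structure Gap (c : Core) where
  (n α β : ℝ)
  hn : 0 ≤ n
  hα : α ∈ Ioo 0 c.VF
  hβ : β ∈ Ioo 0 c.VF
  hlt : α < β
  hsm : β - α < 1 / (n + 1)
  hAα : c.An n α
  hAβ : c.An n β
  hE : c.En n α

namespace Gap
variable {c : Core} (q : Gap c)
def τ : ℝ := q.β - q.α
def ℓ : ℝ := c.gam q.β - c.gam q.α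
lemma τ_pos : 0 < q.τ := by have := q.hlt; unfold τ; linarith
lemma ℓ_ge : c.mm * q.τ ≤ q.ℓ :=
  Core.gam_lower (Ioo_subset_Icc_self q.hα) (Ioo_subset_Icc_self q.hβ) q.hlt.le
lemma ℓ_le : q.ℓ ≤ c.MM * q.τ :=
  Core.gam_upper (Ioo_subset_Icc_self q.hα) (Ioo_subset_Icc_self q.hβ) q.hlt.le
lemma ℓ_pos : 0 < q.ℓ := lt_of_lt_of_le (mul_pos c.mm_pos q.τ_pos) q.ℓ_ge
def w (g : ℝ) : ℝ := eta ((g - c.gam q.α) / q.ℓ)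
def w1 (g : ℝ) : ℝ := eta1 ((g - c.gam q.α) / q.ℓ) / q.ℓ
def w2 (g : ℝ) : ℝ := eta2 ((g - c.gam q.α) / q.ℓ) / q.ℓ / q.ℓ
def dl (g : ℝ) : ℝ := c.P q.α g - c.P q.β g
def dl1 (g : ℝ) : ℝ := c.Pg q.α g - c.Pg q.β g
def dl2 (g : ℝ) : ℝ := c.Pgg q.α g - c.Pgg q.β g
def k (g : ℝ) : ℝ := c.P q.β g + q.w g * q.dl g
def k1 (g : ℝ) : ℝ := c.Pg q.β g + (q.w1 g * q.dl g + q.w g * q.dl1 g)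
def k2 (g : ℝ) : ℝ := c.Pgg q.β g + ((q.w2 g * q.dl g + q.w1 g * q.dl1 g) + (q.w1 g * q.dl1 g + q.w g * q.dl2 g))
lemma w_der (g : ℝ) : HasDerivAt q.w (q.w1 g) g := by
  have := (eta_der ((g - c.gam q.α) / q.ℓ)).comp g (((hasDerivAt_id g).sub_const (c.gam q.α)).div_const q.ℓ)
  refine this.congr_deriv ?_
  simp [w1, div_eq_mul_inv]
lemma w1_der (g : ℝ) : HasDerivAt q.w1 (q.w2 g) g := by
  have := ((eta1_der ((g - c.gam q.α) / q.ℓ)).comp g (((hasDerivAt_id g).sub_const (c.gam q.α)).div_const q.ℓ)).div_const q.ℓ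
  refine this.congr_deriv ?_
  simp [w2, div_eq_mul_inv]
lemma w2_cont : Continuous q.w2 := by
  have := eta2_cont
  unfold w2; fun_prop
lemma w1_cont : Continuous q.w1 := by
  have := eta1_cont
  unfold w1; fun_prop
lemma w_cont : Continuous q.w := by
  have := eta_cont
  unfold w; fun_prop
lemma arg_le {g : ℝ} (hg : g ≤ c.gam q.α) : (g - c.gam q.α) / q.ℓ ≤ 0 :=
  div_nonpos_of_nonpos_of_nonneg (by linarith) q.ℓ_pos.le
lemma arg_ge {g : ℝ} (hg : c.gam q.β ≤ g) : 1 ≤ (g - c.gam q.α) / q.ℓ := by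
  rw [one_le_div q.ℓ_pos]; unfold ℓ; linarith
lemma w_le {g : ℝ} (hg : g ≤ c.gam q.α) : q.w g = 0 := eta_of_nonpos (q.arg_le hg)
lemma w_ge {g : ℝ} (hg : c.gam q.β ≤ g) : q.w g = 1 := eta_of_ge (q.arg_ge hg)
lemma w1_out {g : ℝ} (hg : g ∉ Ioo (c.gam q.α) (c.gam q.β)) : q.w1 g = 0 := by
  rw [mem_Ioo, not_and_or, not_lt, not_lt] at hg
  rcases hg with hg | hg
  · simp [w1, eta1_of_nonpos (q.arg_le hg)]
  · simp [w1, eta1_of_ge (q.arg_ge hg)]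
lemma w2_out {g : ℝ} (hg : g ∉ Ioo (c.gam q.α) (c.gam q.β)) : q.w2 g = 0 := by
  rw [mem_Ioo, not_and_or, not_lt, not_lt] at hg
  rcases hg with hg | hg
  · simp [w2, eta2_of_nonpos (q.arg_le hg)]
  · simp [w2, eta2_of_ge (q.arg_ge hg)]
lemma gα_mem : c.gam q.α ∈ Ioo 0 c.G := Core.gam_mem q.hα
lemma gβ_mem : c.gam q.β ∈ Ioo 0 c.G := Core.gam_mem q.hβ
lemma hk {g : ℝ} (hg : g ∈ Ici (0:ℝ)) : HasDerivWithinAt q.k (q.k1 g) (Ici 0) g :=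
  (c.hPg _ q.hβ g hg).add ((q.w_der g).hasDerivWithinAt.mul ((c.hPg _ q.hα g hg).sub (c.hPg _ q.hβ g hg)))
lemma hk1 {g : ℝ} (hg : g ∈ Ici (0:ℝ)) : HasDerivWithinAt q.k1 (q.k2 g) (Ici 0) g :=
  (c.hPgg _ q.hβ g hg).add (((q.w1_der g).hasDerivWithinAt.mul ((c.hPg _ q.hα g hg).sub (c.hPg _ q.hβ g hg))).add
    ((q.w_der g).hasDerivWithinAt.mul ((c.hPgg _ q.hα g hg).sub (c.hPgg _ q.hβ g hg))))
lemma k2c : ContinuousOn q.k2 (Ici 0) := by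
  have h1 := c.P_contOn q.hα
  have h2 := c.P_contOn q.hβ
  have h3 := c.Pg_contOn q.hα
  have h4 := c.Pg_contOn q.hβ
  have h5 := c.hPggc _ q.hα
  have h6 := c.hPggc _ q.hβ
  have := q.w_cont; have := q.w1_cont; have := q.w2_cont
  unfold k2 dl dl1 dl2
  fun_prop
lemma km : Measurable q.k := by
  have h1 : Measurable (c.P q.α) := c.hPm.of_uncurry_left
  have h2 : Measurable (c.P q.β) := c.hPm.of_uncurry_left
  have h3 := q.w_cont.measurable
  unfold k dl
  fun_prop
lemma rob : c.κ * q.k1 0 = c.b0 * q.k 0 := by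
  have h : (0:ℝ) ≤ c.gam q.α := q.gα_mem.1.le
  have h1 : q.w1 0 = 0 := q.w1_out (fun hh => absurd hh.1 (not_lt.2 h))
  simp only [k1, k, q.w_le h, h1, zero_mul, add_zero]
  exact c.hrobin _ q.hβ
lemma k_le {g : ℝ} (hg : g ∈ Icc 0 c.G) : q.k g ≤ q.n := by
  have h1 := (le_abs_self _).trans (q.hAα.b0 g hg)
  have h2 := (le_abs_self _).trans (q.hAβ.b0 g hg)
  have e1 := eta_nonneg ((g - c.gam q.α) / q.ℓ)
  have e2 := eta_le ((g - c.gam q.α) / q.ℓ)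
  unfold k dl w
  nlinarith
lemma k_nonneg {g : ℝ} : 0 ≤ q.k g := by
  have h1 := c.hP0 q.α g
  have h2 := c.hP0 q.β g
  have e1 := eta_nonneg ((g - c.gam q.α) / q.ℓ)
  have e2 := eta_le ((g - c.gam q.α) / q.ℓ)
  unfold k dl w
  nlinarith

lemma tht_le {ε u M : ℝ} (hM : 0 ≤ M) (hu : u ≤ M) : tht ε u ≤ M := by
  have := tht_lip (ε := ε) 0 u
  rw [tht_zero] at this
  simp only [sub_zero] at this
  exact this.trans (max_le hu hM)

def K : Adm c where
  Θ := tht q.τ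
  Θ1 := fun u => eta (u / q.τ)
  Θ2 := fun u => eta1 (u / q.τ) / q.τ
  k := q.k
  k1 := q.k1
  k2 := q.k2
  L := q.n + 1
  I := univ
  hI := isOpen_univ
  hrange := fun _ _ _ _ => mem_univ _
  hΘ := fun u _ => tht_der u
  hΘ1 := fun u _ => tht_der2 u
  hΘ2c := by
    have := eta1_cont
    exact Continuous.continuousOn (by fun_prop)
  hΘ2 := fun u _ => div_nonneg (eta1_nonneg _) q.τ_pos.le
  hL := by linarith [q.hn]
  hlip := fun u u' => (tht_lip u u').trans
    (le_mul_of_one_le_left (le_max_right _ _) (by linarith [q.hn]))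
  hb := fun v hv g hg => by
    rw [abs_of_nonneg (tht_nonneg q.τ_pos _)]
    exact tht_le (by linarith [q.hn]) (by linarith [q.k_le hg, c.hP0 v g])
  hb1 := fun v hv g hg => by
    rw [abs_of_nonneg (eta_nonneg _)]
    linarith [eta_le ((q.k g - c.P v g) / q.τ), q.hn]
  hb2 := fun v hv g hg => by
    rw [abs_mul, abs_of_nonneg (eta_nonneg _)]
    rcases le_total (q.k g - c.P v g) 0 with h | h
    · rw [eta_of_nonpos (div_nonpos_of_nonpos_of_nonneg h q.τ_pos.le)]
      linarith [q.hn]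
    · rw [abs_of_nonneg h]
      have e1 := eta_nonneg ((q.k g - c.P v g) / q.τ)
      have e2 := eta_le ((q.k g - c.P v g) / q.τ)
      have := q.k_le hg
      have := c.hP0 v g
      nlinarith [q.hn]
  hk := fun g hg => q.hk hg
  hk1 := fun g hg => q.hk1 hg
  hk2c := q.k2c
  hkm := q.km
  hrob := q.rob
end Gap


def etaK : ℝ := eta_bounds.choose
lemma etaK_nonneg : 0 ≤ etaK := eta_bounds.choose_spec.1
lemma eta1_le (x : ℝ) : |eta1 x| ≤ etaK := eta_bounds.choose_spec.2.1 x
lemma eta2_le (x : ℝ) : |eta2 x| ≤ etaK := eta_bounds.choose_spec.2.2 x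

namespace Gap
variable {c : Core}
def c1 (c : Core) (n : ℝ) : ℝ := n * (1 / c.mm + 2)
def K2 (c : Core) (n : ℝ) : ℝ := c.κ * (3 * n) + (c.b0 + c.s * c.G) * (3 * n + etaK * c1 c n) + c.s * n + (c.G + c.gL) * n
def K3 (c : Core) (n : ℝ) : ℝ := c.κ * (etaK * c1 c n + 4 * etaK * n)
lemma c1_nonneg {n : ℝ} (hn : 0 ≤ n) : 0 ≤ c1 c n := by
  have := c.mm_pos; unfold c1; positivity
lemma K3_nonneg {n : ℝ} (hn : 0 ≤ n) : 0 ≤ K3 c n := by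
  have := c1_nonneg (c := c) hn; have := etaK_nonneg; have := c.hκ
  unfold K3; positivity

variable (q : Gap c)
lemma dl_le {g : ℝ} (hg : g ∈ Ioo (c.gam q.α) (c.gam q.β)) : |q.dl g| ≤ c1 c q.n * q.ℓ := by
  have ha := Ioo_subset_Icc_self q.gα_mem
  have hb := Ioo_subset_Icc_self q.gβ_mem
  have hg' : g ∈ Icc 0 c.G := ⟨ha.1.trans hg.1.le, hg.2.le.trans hb.2⟩
  have h1 := q.hAα.b1 g hg' _ ha
  have h2 := q.hAβ.b1 _ ha g hg'
  have h3 := q.hE q.β q.hβ (by rw [abs_of_pos (by linarith [q.hlt])]; exact q.hsm)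
  rw [abs_of_pos (by linarith [q.hlt] : 0 < q.β - q.α)] at h3
  rw [abs_sub_comm (c.gam q.α) g] at h2
  have e : |g - c.gam q.α| ≤ q.ℓ := by
    rw [abs_of_pos (by linarith [hg.1])]; unfold ℓ; linarith [hg.2]
  have hn := q.hn
  have e2 : q.n * |g - c.gam q.α| ≤ q.n * q.ℓ := by gcongr
  have e3 : q.n * (q.β - q.α) ≤ q.n * (1 / c.mm * q.ℓ) := by
    gcongr
    have := q.ℓ_ge
    rw [one_div, inv_mul_eq_div, le_div_iff₀ c.mm_pos]
    unfold τ at this; linarith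
  have : c1 c q.n * q.ℓ = q.n * (1 / c.mm * q.ℓ) + 2 * (q.n * q.ℓ) := by unfold c1; ring
  rw [this]
  unfold dl
  rw [abs_le] at *
  constructor <;> linarith [h1.1, h1.2, h2.1, h2.2, h3.1, h3.2]

lemma w1_le (g : ℝ) : |q.w1 g| ≤ etaK / q.ℓ := by
  unfold w1
  rw [abs_div, abs_of_pos q.ℓ_pos]
  have := eta1_le ((g - c.gam q.α) / q.ℓ)
  have := q.ℓ_pos
  gcongr
lemma w2_le (g : ℝ) : |q.w2 g| ≤ etaK / q.ℓ / q.ℓ := by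
  unfold w2
  rw [abs_div, abs_div, abs_of_pos q.ℓ_pos]
  have := eta2_le ((g - c.gam q.α) / q.ℓ)
  have := q.ℓ_pos
  gcongr
lemma w_abs (g : ℝ) : |q.w g| ≤ 1 := by
  unfold w; rw [abs_of_nonneg (eta_nonneg _)]; exact eta_le _
lemma w1dl (g : ℝ) : |q.w1 g * q.dl g| ≤ etaK * c1 c q.n := by
  by_cases hg : g ∈ Ioo (c.gam q.α) (c.gam q.β)
  · rw [abs_mul]
    calc _ ≤ etaK / q.ℓ * (c1 c q.n * q.ℓ) :=
          mul_le_mul (q.w1_le g) (q.dl_le hg) (abs_nonneg _) (div_nonneg etaK_nonneg q.ℓ_pos.le)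
      _ = _ := by have := q.ℓ_pos; field_simp
  · rw [q.w1_out hg]; simp
    exact mul_nonneg etaK_nonneg (c1_nonneg q.hn)
lemma R_le {g : ℝ} (hg : g ∈ Ioo 0 c.G) : |q.K.R g| ≤ K2 c q.n +
    (Ioo (c.gam q.α) (c.gam q.β)).indicator (fun _ => K3 c q.n / q.ℓ) g := by
  have hn := q.hn
  have hg' := Ioo_subset_Icc_self hg
  have a0 := q.hAα.b0 g hg'
  have b0 := q.hAβ.b0 g hg'
  have a1 := q.hAα.Pg_le hn q.hα hg
  have b1 := q.hAβ.Pg_le hn q.hβ hg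
  have a2 := q.hAα.Pgg_le hn q.hα hg
  have b2 := q.hAβ.Pgg_le hn q.hβ hg
  have d1 : |q.dl1 g| ≤ 2 * q.n := (abs_sub _ _).trans (by linarith)
  have d2 : |q.dl2 g| ≤ 2 * q.n := (abs_sub _ _).trans (by linarith)
  have wd1 : |q.w g * q.dl1 g| ≤ 2 * q.n := by
    rw [abs_mul]; nlinarith [q.w_abs g, abs_nonneg (q.dl1 g), abs_nonneg (q.w g)]
  have wd2 : |q.w g * q.dl2 g| ≤ 2 * q.n := by
    rw [abs_mul]; nlinarith [q.w_abs g, abs_nonneg (q.dl2 g), abs_nonneg (q.w g)]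
  have h0 : |q.k g| ≤ q.n := by rw [abs_of_nonneg q.k_nonneg]; exact q.k_le hg'
  have h1 : |q.k1 g| ≤ 3 * q.n + etaK * c1 c q.n := by
    refine (abs_add_le _ _).trans ?_
    have := (abs_add_le (q.w1 g * q.dl g) (q.w g * q.dl1 g))
    linarith [q.w1dl g]
  have hk : |q.k2 g| ≤ 3 * q.n + (|q.w2 g * q.dl g| + 2 * |q.w1 g * q.dl1 g|) := by
    refine (abs_add_le _ _).trans ?_
    have t1 := (abs_add_le (q.w2 g * q.dl g + q.w1 g * q.dl1 g) (q.w1 g * q.dl1 g + q.w g * q.dl2 g))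
    have t2 := (abs_add_le (q.w2 g * q.dl g) (q.w1 g * q.dl1 g))
    have t3 := (abs_add_le (q.w1 g * q.dl1 g) (q.w g * q.dl2 g))
    linarith
  have h2 : |q.w2 g * q.dl g| + 2 * |q.w1 g * q.dl1 g| ≤
      (Ioo (c.gam q.α) (c.gam q.β)).indicator (fun _ => (etaK * c1 c q.n + 4 * etaK * q.n) / q.ℓ) g := by
    by_cases hg : g ∈ Ioo (c.gam q.α) (c.gam q.β)
    · rw [indicator_of_mem hg, abs_mul, abs_mul]
      have hl := q.ℓ_pos
      have e0 := etaK_nonneg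
      have e1 : |q.w2 g| * |q.dl g| ≤ etaK / q.ℓ / q.ℓ * (c1 c q.n * q.ℓ) :=
        mul_le_mul (q.w2_le g) (q.dl_le hg) (abs_nonneg _) (by positivity)
      have e2 : |q.w1 g| * |q.dl1 g| ≤ etaK / q.ℓ * (2 * q.n) :=
        mul_le_mul (q.w1_le g) d1 (abs_nonneg _) (by positivity)
      calc _ ≤ etaK / q.ℓ / q.ℓ * (c1 c q.n * q.ℓ) + 2 * (etaK / q.ℓ * (2 * q.n)) := by linarith
        _ = _ := by field_simp; ring
    · rw [indicator_of_notMem hg, q.w1_out hg, q.w2_out hg]; simp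
  have := Core.op_bound (c := c) hg' h0 h1 (hk.trans (add_le_add le_rfl h2))
  refine (this : |q.K.R g| ≤ _).trans ?_
  unfold K2 K3
  by_cases hg : g ∈ Ioo (c.gam q.α) (c.gam q.β)
  · rw [indicator_of_mem hg, indicator_of_mem hg]
    apply le_of_eq; ring
  · rw [indicator_of_notMem hg, indicator_of_notMem hg]
    apply le_of_eq; ring

lemma R_int : ∫ g in Ioo 0 c.G, |q.K.R g| ≤ c.G * K2 c q.n + K3 c q.n := by
  have hsub : Ioo (c.gam q.α) (c.gam q.β) ⊆ Ioo 0 c.G := fun g hg =>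
    ⟨q.gα_mem.1.trans hg.1, hg.2.trans q.gβ_mem.2⟩
  have i1 : IntegrableOn (fun g => |q.K.R g|) (Ioo 0 c.G) :=
    Adm.intOn (c := c) ((q.K.R_contOn.mono Icc_subset_Ici_self).abs)
  have i3 : IntegrableOn ((Ioo (c.gam q.α) (c.gam q.β)).indicator (fun _ => K3 c q.n / q.ℓ)) (Ioo 0 c.G) :=
    IntegrableOn.indicator (integrableOn_const (by simp)) measurableSet_Ioo
  have i2 : IntegrableOn (fun g => K2 c q.n +
    (Ioo (c.gam q.α) (c.gam q.β)).indicator (fun _ => K3 c q.n / q.ℓ) g) (Ioo 0 c.G) :=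
    (integrableOn_const (by simp)).add i3
  refine (setIntegral_mono_on i1 i2 measurableSet_Ioo (fun g hg => q.R_le hg)).trans ?_
  have ic : IntegrableOn (fun _ : ℝ => K2 c q.n) (Ioo 0 c.G) := integrableOn_const (by simp)
  rw [integral_add ic i3, setIntegral_indicator measurableSet_Ioo,
    inter_eq_self_of_subset_right hsub]
  have hl := q.ℓ_pos
  simp only [setIntegral_const, smul_eq_mul, Real.volume_real_Ioo, sub_zero]
  rw [max_eq_left c.G_pos.le, max_eq_left (show 0 ≤ c.gam q.β - c.gam q.α from hl.le)]
  have : (c.gam q.β - c.gam q.α) * (K3 c q.n / q.ℓ) = K3 c q.n := by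
    change q.ℓ * _ = _; field_simp
  rw [this]

def C2 (c : Core) (n : ℝ) : ℝ := c.Jm + c.G + c.gL + 2 * (c.VE * c.MM) * (n + 2)

lemma J_mid {v g : ℝ} (hv : v ∈ Ioo 0 c.VF) (hl : |g - c.gam v| ≤ q.ℓ) : |c.J v g| ≤ c.VE * c.MM * q.τ := by
  rw [Core.J_eq (Ioo_subset_Icc_self hv), abs_mul,
    abs_of_pos (Core.VE_sub (Ioo_subset_Icc_self hv)), mul_assoc]
  exact mul_le_mul (by linarith [hv.1]) (hl.trans q.ℓ_le) (abs_nonneg _) c.VE_pos.le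

lemma ptw (B : Adm c) {g : ℝ} (hg : g ∈ Ioo 0 c.G) :
    max (B.W q.β g - B.W q.α g) 0 ≤ B.L * (q.K.W q.β g - q.K.W q.α g + C2 c q.n * q.τ) := by
  have hα := Ioo_subset_Icc_self q.hα
  have hβ := Ioo_subset_Icc_self q.hβ
  have hg' := Ioo_subset_Icc_self hg
  have hτ := q.τ_pos
  have hn := q.hn
  have hL := B.hL
  have p0 := c.ψ_nonneg g
  have p1 := c.ψ_le g
  have hM : 0 < c.VE * c.MM := mul_pos c.VE_pos c.MM_pos
  have hJ : c.J q.β g - c.J q.α g = -(g + c.gL) * q.τ := by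
    unfold Core.J Jflux τ; ring
  have bα := abs_le.1 (B.hb _ q.hα g hg')
  have bβ := abs_le.1 (B.hb _ q.hβ g hg')
  have jα := abs_le.1 (c.J_bound hα hg')
  have jβ := abs_le.1 (c.J_bound hβ hg')
  have hgL := c.hgL
  have hJm := c.Jm_nonneg
  have hd : |(c.J q.β g - c.J q.α g)| ≤ (c.G + c.gL) * q.τ := by
    rw [hJ, abs_mul, abs_neg, abs_of_pos (by linarith [hg.1] : 0 < g + c.gL), abs_of_pos hτ]
    have := hg.2
    gcongr
  have hdΘ : ∀ X, |X| ≤ B.L → (c.J q.β g - c.J q.α g) * X ≤ B.L * ((c.G + c.gL) * q.τ) := by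
    intro X hX
    refine (le_abs_self _).trans ?_
    rw [abs_mul, mul_comm]
    exact mul_le_mul hX hd (abs_nonneg _) hL
  have hC2 : C2 c q.n * q.τ = c.Jm * q.τ + (c.G + c.gL) * q.τ + 2 * (c.VE * c.MM * q.τ) * (q.n + 2) := by
    unfold C2; ring
  have hlast : 0 ≤ 2 * (c.VE * c.MM * q.τ) * (q.n + 2) := by positivity
  have hJτ : 0 ≤ c.Jm * q.τ := by positivity
  have hGτ : 0 ≤ (c.G + c.gL) * q.τ := by have := c.G_pos; positivity
  rw [hC2]
  -- main pattern: nonneg coefficient j, x the difference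
  have key : ∀ j x X, 0 ≤ j → j ≤ c.Jm → |X| ≤ B.L → ∀ Y, Y ≤ B.L * max x 0 →
      max (c.ψ g * (j * Y + (c.J q.β g - c.J q.α g) * X)) 0 ≤
        B.L * (c.ψ g * (j * tht q.τ x) + (c.Jm * q.τ + (c.G + c.gL) * q.τ)) := by
    intro j x X hj hj2 hX Y hY
    have t1 := tht_ge hτ x
    have t0 := tht_nonneg hτ x
    have t2 : j * Y ≤ B.L * (j * (tht q.τ x + q.τ)) := by
      calc j * Y ≤ j * (B.L * (tht q.τ x + q.τ)) := by
            apply mul_le_mul_of_nonneg_left _ hj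
            exact hY.trans (by gcongr)
        _ = _ := by ring
    have t3 := hdΘ X hX
    have t4 : j * q.τ ≤ c.Jm * q.τ := by gcongr
    apply max_le
    · calc _ ≤ c.ψ g * (B.L * (j * tht q.τ x) + B.L * (c.Jm * q.τ + (c.G + c.gL) * q.τ)) := by
            apply mul_le_mul_of_nonneg_left _ p0
            have : B.L * (j * q.τ) ≤ B.L * (c.Jm * q.τ) := by gcongr
            nlinarith
        _ ≤ _ := by
            have : c.ψ g * (B.L * (c.Jm * q.τ + (c.G + c.gL) * q.τ)) ≤ 1 * (B.L * (c.Jm * q.τ + (c.G + c.gL) * q.τ)) := by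
              gcongr
            nlinarith
    · apply mul_nonneg hL; positivity
  by_cases h1 : c.gam q.β ≤ g
  · have hj : 0 ≤ c.J q.β g := by
      rw [Core.J_eq hβ]; exact mul_nonneg (Core.VE_sub hβ).le (by linarith)
    have kk : q.k g = c.P q.α g := by unfold k dl; rw [q.w_ge h1]; ring
    have := key (c.J q.β g) (c.P q.α g - c.P q.β g) (B.Θ (B.u q.α g)) hj jβ.2 (B.hb _ q.hα g hg')
      (B.Θ (B.u q.β g) - B.Θ (B.u q.α g)) (by
        refine (B.hlip _ _).trans (le_of_eq ?_)
        congr 2; unfold Adm.u; ring)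
    have e1 : B.W q.β g - B.W q.α g = c.ψ g * (c.J q.β g * (B.Θ (B.u q.β g) - B.Θ (B.u q.α g)) +
      (c.J q.β g - c.J q.α g) * B.Θ (B.u q.α g)) := by unfold Adm.W; ring
    have e2 : q.K.W q.β g - q.K.W q.α g = c.ψ g * (c.J q.β g * tht q.τ (c.P q.α g - c.P q.β g)) := by
      simp only [Adm.W, Adm.u, K, kk, sub_self, tht_zero]; ring
    rw [e1, e2]
    refine this.trans ?_
    exact mul_le_mul_of_nonneg_left (by linarith) hL
  by_cases h2 : g ≤ c.gam q.α
  · have hj : 0 ≤ -c.J q.α g := by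
      rw [Core.J_eq hα, ← mul_neg]; exact mul_nonneg (Core.VE_sub hα).le (by linarith)
    have kk : q.k g = c.P q.β g := by unfold k dl; rw [q.w_le h2]; ring
    have := key (-c.J q.α g) (c.P q.β g - c.P q.α g) (B.Θ (B.u q.β g)) hj (by linarith [jα.1]) (B.hb _ q.hβ g hg')
      (B.Θ (B.u q.α g) - B.Θ (B.u q.β g)) (by
        refine (B.hlip _ _).trans (le_of_eq ?_)
        congr 2; unfold Adm.u; ring)
    have e1 : B.W q.β g - B.W q.α g = c.ψ g * (-c.J q.α g * (B.Θ (B.u q.α g) - B.Θ (B.u q.β g)) +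
      (c.J q.β g - c.J q.α g) * B.Θ (B.u q.β g)) := by unfold Adm.W; ring
    have e2 : q.K.W q.β g - q.K.W q.α g = c.ψ g * (-c.J q.α g * tht q.τ (c.P q.β g - c.P q.α g)) := by
      simp only [Adm.W, Adm.u, K, kk, sub_self, tht_zero]; ring
    rw [e1, e2]
    refine this.trans ?_
    exact mul_le_mul_of_nonneg_left (by linarith) hL
  · push Not at h1 h2
    have m1 := q.J_mid q.hα (g := g) (by rw [abs_of_pos (by linarith)]; unfold ℓ; linarith)
    have m2 := q.J_mid q.hβ (g := g) (by rw [abs_of_neg (by linarith)]; unfold ℓ; linarith)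
    have hw : ∀ A : Adm c, ∀ v ∈ Ioo 0 c.VF, |c.J v g| ≤ c.VE * c.MM * q.τ → |A.W v g| ≤ A.L * (c.VE * c.MM * q.τ) := by
      intro A v hv hj
      unfold Adm.W
      rw [abs_mul, abs_mul, abs_of_nonneg p0, mul_comm A.L]
      refine mul_le_mul ?_ (A.hb v hv g hg') (abs_nonneg _) (by positivity)
      nlinarith [abs_nonneg (c.J v g)]
    have a1 := abs_le.1 (hw B _ q.hα m1)
    have a2 := abs_le.1 (hw B _ q.hβ m2)
    have a3 := abs_le.1 (hw q.K _ q.hα m1)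
    have a4 := abs_le.1 (hw q.K _ q.hβ m2)
    have hKL : q.K.L = q.n + 1 := rfl
    rw [hKL] at a3 a4
    set X := c.VE * c.MM * q.τ
    have : 0 ≤ X := by positivity
    have hb : 2 * X ≤ q.K.W q.β g - q.K.W q.α g + (c.Jm * q.τ + (c.G + c.gL) * q.τ + 2 * X * (q.n + 2)) := by
      have e : 2 * X * (q.n + 2) = 2 * ((q.n + 1) * X) + 2 * X := by ring
      linarith [a3.1, a3.2, a4.1, a4.2]
    have := mul_le_mul_of_nonneg_left hb hL
    refine max_le ?_ ?_
    · have e : B.L * (2 * X) = 2 * (B.L * X) := by ring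
      linarith [a1.1, a2.2]
    · refine le_trans ?_ this; positivity

def CC (c : Core) (n : ℝ) : ℝ := max ((n + 1) * (c.Cb + (c.G * K2 c n + K3 c n))) 0 + c.G * C2 c n

theorem gap_bound (B : Adm c) (hT : q.K.T q.β - q.K.T q.α ≤ ∫ x in q.α..q.β, q.K.h 0 x) :
    ∫ g in Ioo 0 c.G, max (B.W q.β g - B.W q.α g) 0 ≤ B.L * CC c q.n * (q.β - q.α) := by
  have hα := Ioo_subset_Icc_self q.hα
  have hβ := Ioo_subset_Icc_self q.hβ
  have iB : IntegrableOn (fun g => max (B.W q.β g - B.W q.α g) 0) (Ioo 0 c.G) :=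
    ((B.W_int hβ).sub (B.W_int hα)).pos_part
  have iK : IntegrableOn (fun g => q.K.W q.β g - q.K.W q.α g) (Ioo 0 c.G) := (q.K.W_int hβ).sub (q.K.W_int hα)
  have ic : IntegrableOn (fun g => C2 c q.n * q.τ) (Ioo 0 c.G) := integrableOn_const (by simp)
  have h1 := setIntegral_mono_on iB ((iK.add ic).const_mul B.L) measurableSet_Ioo (fun g hg => q.ptw B hg)
  refine h1.trans ?_
  rw [integral_const_mul, mul_assoc]
  refine mul_le_mul_of_nonneg_left ?_ B.hL
  change ∫ g in Ioo 0 c.G, ((q.K.W q.β g - q.K.W q.α g) + C2 c q.n * q.τ) ≤ _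
  rw [integral_add iK ic, integral_sub (q.K.W_int hβ) (q.K.W_int hα)]
  have hh : ∫ x in q.α..q.β, q.K.h 0 x ≤ max ((q.n + 1) * (c.Cb + (c.G * K2 c q.n + K3 c q.n))) 0 * (q.β - q.α) := by
    have hi : IntervalIntegrable (q.K.h 0) volume q.α q.β :=
      (intervalIntegrable_iff_integrableOn_Ioo_of_le q.hlt.le).2 (q.K.h_int 0 hα.1 hβ.2)
    have := intervalIntegral.integral_mono_on_of_le_Ioo q.hlt.le hi
      (intervalIntegrable_const (c := max ((q.n + 1) * (c.Cb + (c.G * K2 c q.n + K3 c q.n))) 0)) ?_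
    · rw [intervalIntegral.integral_const, smul_eq_mul, mul_comm] at this
      exact this
    · intro x hx
      have hx' : x ∈ Ioo 0 c.VF := ⟨q.hα.1.trans hx.1, hx.2.trans q.hβ.2⟩
      have := q.K.f_le hx'
      have h2 : q.K.L * (c.Cb + ∫ g in Ioo 0 c.G, |q.K.R g|) ≤ (q.n + 1) * (c.Cb + (c.G * K2 c q.n + K3 c q.n)) := by
        have hKL : q.K.L = q.n + 1 := rfl
        rw [hKL]
        have := q.hn
        have := q.R_int
        gcongr
      unfold Adm.h
      rw [neg_zero]
      exact max_le_max (this.trans h2) le_rfl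
  have e : (∫ g in Ioo 0 c.G, C2 c q.n * q.τ) = c.G * C2 c q.n * (q.β - q.α) := by
    simp [c.G_pos.le, τ, mul_assoc]
  rw [e]
  change q.K.T q.β - q.K.T q.α + _ ≤ _
  unfold CC
  linarith
end Gap


lemma loc_antitone {H : ℝ → ℝ} {a b : ℝ} (hab : a ≤ b) (hc : ContinuousOn H (Icc a b))
    (hl : ∀ x ∈ Ioo a b, ∃ η > 0, ∀ y ∈ Ioo a b, x ≤ y → y < x + η → H y ≤ H x) : H b ≤ H a := by
  rcases hab.eq_or_lt with h | hab
  · rw [h]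
  have inner : ∀ a' b', a < a' → a' ≤ b' → b' < b → H b' ≤ H a' := by
    intro a' b' h1 h2 h3
    have hsub : Icc a' b' ⊆ Icc a b := Icc_subset_Icc h1.le h3.le
    have hcl : IsClosed ({x | H x ≤ H a'} ∩ Icc a' b') := by
      have : {x | H x ≤ H a'} ∩ Icc a' b' = Icc a' b' ∩ H ⁻¹' Iic (H a') := by
        ext x; exact and_comm
      rw [this]
      exact (hc.mono hsub).preimage_isClosed_of_isClosed isClosed_Icc isClosed_Iic
    have := hcl.Icc_subset_of_forall_exists_gt (by simp) (by
      rintro x ⟨hx, hx'⟩ y hy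
      obtain ⟨η, hη, hh⟩ := hl x ⟨h1.trans_le hx'.1, hx'.2.trans h3⟩
      have hx2 := hx'.2
      have hxy : x < y := hy
      obtain ⟨z, hz1, hz2⟩ := exists_between (show x < min y (min (x + η) b') from
        lt_min hxy (lt_min (by linarith) hx2))
      refine ⟨z, ?_, hz1, hz2.le.trans (min_le_left _ _)⟩
      have hz3 : z < x + η := hz2.trans_le ((min_le_right _ _).trans (min_le_left _ _))
      have hz4 : z < b' := hz2.trans_le ((min_le_right _ _).trans (min_le_right _ _))
      exact (hh z ⟨h1.trans_le (hx'.1.trans hz1.le), hz4.trans h3⟩ hz1.le hz3).trans hx)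
    exact this ⟨h2, le_rfl⟩
  have step : ∀ b', a < b' → b' < b → H b' ≤ H a := by
    intro b' h1 h2
    have t : Tendsto H (nhdsWithin a (Ioo a b)) (nhds (H a)) :=
      ((hc a ⟨le_rfl, hab.le⟩).mono Ioo_subset_Icc_self)
    have : (nhdsWithin a (Ioo a b)).NeBot := by
      rw [← mem_closure_iff_nhdsWithin_neBot, closure_Ioo hab.ne]; exact ⟨le_rfl, hab.le⟩
    refine ge_of_tendsto t ?_
    filter_upwards [self_mem_nhdsWithin, mem_nhdsWithin_of_mem_nhds (Iio_mem_nhds h1)] with x hx hx2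
    exact inner x b' hx.1 (le_of_lt hx2) h2
  have t : Tendsto H (nhdsWithin b (Ioo a b)) (nhds (H b)) :=
    ((hc b ⟨hab.le, le_rfl⟩).mono Ioo_subset_Icc_self)
  have : (nhdsWithin b (Ioo a b)).NeBot := by
    rw [← mem_closure_iff_nhdsWithin_neBot, closure_Ioo hab.ne]; exact ⟨hab.le, le_rfl⟩
  refine le_of_tendsto t ?_
  filter_upwards [self_mem_nhdsWithin] with x hx
  exact step x hx.1 hx.2

namespace Adm
variable {c : Core} (A : Adm c)
def H (N x : ℝ) : ℝ := A.T x - ∫ y in (0:ℝ)..x, A.h N y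
lemma h_ii (N : ℝ) {a b : ℝ} (ha : 0 ≤ a) (hab : a ≤ b) (hb : b ≤ c.VF) :
    IntervalIntegrable (A.h N) volume a b :=
  (intervalIntegrable_iff_integrableOn_Ioo_of_le hab).2 (A.h_int N ha hb)
lemma H_sub (N : ℝ) {a b : ℝ} (ha : 0 ≤ a) (hab : a ≤ b) (hb : b ≤ c.VF) :
    A.H N b - A.H N a = A.T b - A.T a - ∫ y in a..b, A.h N y := by
  have := intervalIntegral.integral_add_adjacent_intervals
    (A.h_ii N le_rfl ha (hab.trans hb)) (A.h_ii N ha hab hb)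
  unfold H; linarith
lemma H_iff (N : ℝ) {a b : ℝ} (ha : 0 ≤ a) (hab : a ≤ b) (hb : b ≤ c.VF) :
    A.H N b ≤ A.H N a ↔ A.T b - A.T a ≤ ∫ y in a..b, A.h N y := by
  rw [← sub_nonpos, A.H_sub N ha hab hb, sub_nonpos]
lemma H_cont (N : ℝ) : ContinuousOn (A.H N) (Icc 0 c.VF) := by
  refine A.T_cont.sub ?_
  have := intervalIntegral.continuousOn_primitive_interval (f := A.h N) (μ := volume) (a := 0) (b := c.VF)
    (by
      rw [uIcc_of_le c.hVF.le, integrableOn_Icc_iff_integrableOn_Ioo]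
      exact A.h_int N le_rfl le_rfl)
  rwa [uIcc_of_le c.hVF.le] at this
end Adm

namespace Core
variable (c : Core)
def LI (a b : ℝ) : Prop := ∀ A : Adm c, ∀ N, A.H N b ≤ A.H N a
def Good (v : ℝ) : Prop := ∃ η > 0, ∀ v1 ∈ Ioo 0 c.VF, ∀ v2 ∈ Ioo 0 c.VF, |v1 - v| < η → |v2 - v| < η →
  v1 ≤ v2 → c.LI v1 v2
def Bad : Set ℝ := {v | v ∈ Ioo 0 c.VF ∧ ¬ c.Good v}
variable {c}
lemma good_open : IsOpen {v | c.Good v} := by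
  rw [Metric.isOpen_iff]
  rintro v ⟨η, hη, h⟩
  refine ⟨η / 2, by linarith, fun w hw => ?_⟩
  rw [Metric.mem_ball, Real.dist_eq] at hw
  refine ⟨η / 2, by linarith, fun v1 h1 v2 h2 d1 d2 hle => h v1 h1 v2 h2 ?_ ?_ hle⟩
  · have := abs_sub_le v1 w v; linarith
  · have := abs_sub_le v2 w v; linarith
lemma LI_of_good {a b : ℝ} (ha : 0 ≤ a) (hab : a ≤ b) (hb : b ≤ c.VF) (hg : ∀ x ∈ Ioo a b, x ∉ c.Bad) :
    c.LI a b := by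
  intro A N
  refine loc_antitone hab ((A.H_cont N).mono (Icc_subset_Icc ha hb)) fun x hx => ?_
  have hx' : x ∈ Ioo 0 c.VF := ⟨ha.trans_lt hx.1, hx.2.trans_le hb⟩
  have hgx : c.Good x := by
    by_contra hc; exact hg x hx ⟨hx', hc⟩
  obtain ⟨η, hη, h⟩ := hgx
  refine ⟨η, hη, fun y hy hxy hyη => h x hx' y ⟨ha.trans_lt hy.1, hy.2.trans_le hb⟩ (by simpa) ?_ hxy A N⟩
  rw [abs_of_nonneg (by linarith)]; linarith

lemma portion {n : ℝ} (hn : 0 ≤ n) {b1 b2 : ℝ} (h1 : b1 ∈ c.Bad) (h2 : b2 ∈ c.Bad) (h12 : b1 ≤ b2)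
    (hs : b2 - b1 < 1 / (n + 1)) (hAE : ∀ x ∈ c.Bad ∩ Icc b1 b2, c.An n x ∧ c.En n x) : c.LI b1 b2 := by
  set F : Set ℝ := (c.Bad ∩ Icc b1 b2) ∪ (Iic b1 ∪ Ici b2) with hFdef
  have hIcc : Icc b1 b2 ⊆ Ioo 0 c.VF := fun x hx => ⟨h1.1.1.trans_le hx.1, hx.2.trans_lt h2.1.2⟩
  have hF : CS F := by
    refine ⟨?_, ?_, ?_⟩
    · have : c.Bad ∩ Icc b1 b2 = {v | c.Good v}ᶜ ∩ Icc b1 b2 := by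
        ext x
        constructor
        · rintro ⟨hx, hx'⟩; exact ⟨hx.2, hx'⟩
        · rintro ⟨hx, hx'⟩; exact ⟨⟨hIcc hx', hx⟩, hx'⟩
      rw [hFdef, this]
      exact ((good_open.isClosed_compl).inter isClosed_Icc).union (isClosed_Iic.union isClosed_Ici)
    · intro x
      exact ⟨min x b1, Or.inr (Or.inl (mem_Iic.2 (min_le_right _ _))), mem_Iic.2 (min_le_left _ _)⟩
    · intro x
      exact ⟨max (x + 1) b2, Or.inr (Or.inr (mem_Ici.2 (le_max_right _ _))),
        mem_Ioi.2 (lt_of_lt_of_le (lt_add_one x) (le_max_left _ _))⟩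
  have F1 : b1 ∈ F := Or.inr (Or.inl (mem_Iic.2 le_rfl))
  have F2 : b2 ∈ F := Or.inr (Or.inr (mem_Ici.2 le_rfl))
  have FB : ∀ x ∈ F, x ∈ Icc b1 b2 → x ∈ c.Bad := by
    rintro x (hx | hx | hx) hx'
    · exact hx.1
    · rwa [le_antisymm hx hx'.1]
    · rwa [le_antisymm hx'.2 hx]
  have BF : ∀ x ∈ c.Bad, x ∈ Icc b1 b2 → x ∈ F := fun x hx hx' => Or.inl ⟨hx, hx'⟩
  have hgoodI : ∀ w1 ∈ Icc b1 b2, ∀ w2 ∈ Icc b1 b2, w1 ≤ w2 → (∀ z ∈ F, z ∉ Ioo w1 w2) → c.LI w1 w2 := by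
    intro w1 hw1 w2 hw2 hw hz
    refine LI_of_good (hIcc hw1).1.le hw (hIcc hw2).2.le fun x hx hB => ?_
    exact hz x (BF x hB ⟨hw1.1.trans hx.1.le, hx.2.le.trans hw2.2⟩) hx
  intro A N
  have hgap : ∀ x ∈ Ioo b1 b2, rpt F x ≠ x →
      ∫ g in Ioo 0 c.G, max (A.W (rpt F x) g - A.W (lpt F x) g) 0 ≤
        (A.L * max (Gap.CC c n) 0) * (rpt F x - lpt F x) := by
    intro x hx hr
    have l1 : b1 ≤ lpt F x := hF.le_lpt F1 hx.1.le
    have r2 : rpt F x ≤ b2 := hF.rpt_le F2 hx.2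
    have lx := hF.lpt_le x
    have rx := lt_of_le_of_ne (hF.le_rpt x) (Ne.symm hr)
    have hl : lpt F x ∈ Icc b1 b2 := ⟨l1, lx.trans hx.2.le⟩
    have hrr : rpt F x ∈ Icc b1 b2 := ⟨hx.1.le.trans rx.le, r2⟩
    have Bl := FB _ (hF.lpt_mem x) hl
    have Br := FB _ (hF.rpt_mem x) hrr
    have hLI := hgoodI _ hl _ hrr (lx.trans rx.le) (fun z hz hz' => by
      have := hF.gap hz hz'.1
      exact absurd hz'.2 (not_lt.2 this))
    let q : Gap c := ⟨n, lpt F x, rpt F x, hn, hIcc hl, hIcc hrr, lt_of_le_of_lt lx rx, by linarith,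
      (hAE _ ⟨Bl, hl⟩).1, (hAE _ ⟨Br, hrr⟩).1, (hAE _ ⟨Bl, hl⟩).2⟩
    have := q.gap_bound A ((q.K.H_iff 0 (hIcc hl).1.le (lx.trans rx.le) (hIcc hrr).2.le).1 (hLI q.K 0))
    refine this.trans ?_
    have hL := A.hL
    have : 0 ≤ q.β - q.α := by have := q.hlt; linarith
    change A.L * Gap.CC c n * (q.β - q.α) ≤ A.L * max (Gap.CC c n) 0 * (q.β - q.α)
    gcongr
    exact le_max_left _ _
  set C1 := |(c.G + c.gL) * A.L + A.L * c.SB n|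
  have hC2 : 0 ≤ A.L * max (Gap.CC c n) 0 := mul_nonneg A.hL (le_max_right _ _)
  obtain ⟨Φ, hΦ, hΦe, hΦC, hΦT⟩ := portion_phi hF c.G_pos.le (abs_nonneg _ : 0 ≤ C1) hC2 F1 F2
    A.W_meas A.D_meas (fun g _ => A.W_cont_v g)
    (fun v hv g hg => A.W_bound (Ioo_subset_Icc_self (hIcc hv)) (Ioo_subset_Icc_self hg))
    (fun x hx g hg => A.W_der (hIcc hx) hg)
    (fun x hx g hg => by
      have hx' := Ioo_subset_Icc_self hx.2
      have hB := FB x hx.1 hx'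
      exact (A.D_bound hn (hIcc hx') (hAE x ⟨hB, hx'⟩).1 hg).trans (le_abs_self _)) hgap
  set C3 := max (A.L * (c.Cb + ∫ g in Ioo 0 c.G, |A.R g|)) (-N)
  rw [A.H_iff N h1.1.1.le h12 h2.1.2.le]
  refine portion_final hF h12 (C := max (C1 * c.G + A.L * max (Gap.CC c n) 0) C3)
    (A.h_int N h1.1.1.le h2.1.2.le) hΦ ?_ (fun x hx => (hΦC x hx).trans (le_max_left _ _)) ?_ hΦT ?_
  · intro x hx hr
    rw [hΦe x hx hr]
    exact le_max_left _ _
  · intro x hx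
    exact (max_le_max (A.f_le (hIcc (Ioo_subset_Icc_self hx))) le_rfl).trans (le_max_right _ _)
  · intro w1 hw1 w2 hw2 hw hz
    exact (A.H_iff N (hIcc hw1).1.le hw (hIcc hw2).2.le).1 (hgoodI w1 hw1 w2 hw2 hw hz A N)

theorem bad_empty : c.Bad = ∅ := by
  by_contra hne
  have hne' : Nonempty c.Bad := (nonempty_iff_ne_empty.2 hne).to_subtype
  have hlc : IsLocallyClosed c.Bad := by
    refine ⟨Ioo 0 c.VF, {v | c.Good v}ᶜ, isOpen_Ioo, good_open.isClosed_compl, ?_⟩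
    rfl
  have := hlc.locallyCompactSpace
  have hf : ∀ n : ℕ, IsClosed {w : c.Bad | c.An n w ∧ c.En n w} := by
    intro n
    refine isClosed_of_closure_subset fun w hw => ?_
    have h1 : (w : ℝ) ∈ closure (Subtype.val '' {w : c.Bad | c.An n w ∧ c.En n w}) :=
      image_closure_subset_closure_image continuous_subtype_val ⟨w, hw, rfl⟩
    refine AE_closed w.2.1 h1 ?_
    rintro _ ⟨x, hx, rfl⟩
    exact ⟨x.2.1, hx⟩
  obtain ⟨n, w0, hw0⟩ := nonempty_interior_of_iUnion_of_closed hf (by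
    refine eq_univ_of_forall fun w => ?_
    obtain ⟨n, hn⟩ := AE_exists w.2.1
    exact mem_iUnion.2 ⟨n, hn⟩)
  rw [mem_interior_iff_mem_nhds, mem_nhds_subtype] at hw0
  obtain ⟨u, hu, hun⟩ := hw0
  obtain ⟨ε, hε, hball⟩ := Metric.mem_nhds_iff.1 hu
  have hn0 : (0:ℝ) ≤ n := Nat.cast_nonneg n
  have hd : 0 < 1 / ((n:ℝ) + 1) := by positivity
  refine w0.2.2 ⟨min ε (1 / ((n:ℝ) + 1) / 2), lt_min hε (by linarith), fun v1 h1 v2 h2 d1 d2 hle => ?_⟩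
  have hB : ∀ x ∈ c.Bad, x ∈ Icc v1 v2 → c.An n x ∧ c.En n x := by
    intro x hx hx'
    refine hun (show (⟨x, hx⟩ : c.Bad) ∈ _ from hball ?_)
    rw [Metric.mem_ball, Real.dist_eq]
    have a1 := abs_lt.1 (d1.trans_le (min_le_left _ _))
    have a2 := abs_lt.1 (d2.trans_le (min_le_left _ _))
    rw [abs_lt]; constructor
    · change -ε < x - w0; linarith [hx'.1]
    · change x - w0 < ε; linarith [hx'.2]
  have hIcc : Icc v1 v2 ⊆ Ioo 0 c.VF := fun x hx => ⟨h1.1.trans_le hx.1, hx.2.trans_lt h2.2⟩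
  by_cases hemp : (c.Bad ∩ Icc v1 v2).Nonempty
  · have hcomp : IsCompact (c.Bad ∩ Icc v1 v2) := by
      have : c.Bad ∩ Icc v1 v2 = Icc v1 v2 ∩ {v | c.Good v}ᶜ := by
        ext x
        constructor
        · rintro ⟨hx, hx'⟩; exact ⟨hx', hx.2⟩
        · rintro ⟨hx', hx⟩; exact ⟨⟨hIcc hx', hx⟩, hx'⟩
      rw [this]
      exact isCompact_Icc.inter_right good_open.isClosed_compl
    obtain ⟨b1, hb1, hm1⟩ := hcomp.exists_isLeast hemp
    obtain ⟨b2, hb2, hm2⟩ := hcomp.exists_isGreatest hemp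
    have h12 : b1 ≤ b2 := hm1 hb2
    have L1 : c.LI v1 b1 := LI_of_good h1.1.le hb1.2.1 (hIcc hb1.2).2.le fun x hx hxB =>
      absurd (hm1 ⟨hxB, hx.1.le, hx.2.le.trans hb1.2.2⟩) (not_le.2 hx.2)
    have L3 : c.LI b2 v2 := LI_of_good (hIcc hb2.2).1.le hb2.2.2 h2.2.le fun x hx hxB =>
      absurd (hm2 ⟨hxB, hb2.2.1.trans hx.1.le, hx.2.le⟩) (not_le.2 hx.1)
    have L2 : c.LI b1 b2 := by
      refine portion hn0 hb1.1 hb2.1 h12 ?_ fun x hx => hB x hx.1 ⟨hb1.2.1.trans hx.2.1, hx.2.2.trans hb2.2.2⟩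
      have a1 := abs_lt.1 (d1.trans_le (min_le_right _ _))
      have a2 := abs_lt.1 (d2.trans_le (min_le_right _ _))
      have := hb1.2.1; have := hb2.2.2
      linarith
    exact fun A N => (L3 A N).trans ((L2 A N).trans (L1 A N))
  · exact LI_of_good h1.1.le hle h2.2.le fun x hx hxB => hemp ⟨x, hxB, hx.1.le, hx.2.le⟩

end Core

theorem Adm.main {c : Core} (A : Adm c) (N : ℝ) : A.T c.VF - A.T 0 ≤ ∫ y in (0:ℝ)..c.VF, A.h N y :=
  (A.H_iff N le_rfl c.hVF.le le_rfl).1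
    (Core.LI_of_good le_rfl c.hVF.le le_rfl (fun x _ => by rw [Core.bad_empty]; exact notMem_empty x) A N)


/-! ### truncated power nonlinearity -/
def om (K t : ℝ) : ℝ := max 0 (min 1 (2 - t / K))
lemma om_cont (K : ℝ) : Continuous (om K) := by unfold om; fun_prop
lemma om_nonneg (K t : ℝ) : 0 ≤ om K t := le_max_left _ _
lemma om_le (K t : ℝ) : om K t ≤ 1 := max_le zero_le_one (min_le_left _ _)
lemma om_one {K t : ℝ} (hK : 0 < K) (ht : t ≤ K) : om K t = 1 := by
  have : t / K ≤ 1 := (div_le_one hK).2 ht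
  unfold om
  rw [min_eq_left (by linarith), max_eq_right zero_le_one]
lemma om_zero {K t : ℝ} (hK : 0 < K) (ht : 2 * K ≤ t) : om K t = 0 := by
  have : 2 ≤ t / K := (le_div_iff₀ hK).2 ht
  unfold om
  rw [min_eq_right (by linarith), max_eq_left (by linarith)]
def Lam (K y : ℝ) : ℝ := ∫ t in y..(2 * K), om K t
lemma om_ii (K a b : ℝ) : IntervalIntegrable (om K) volume a b := (om_cont K).intervalIntegrable _ _
lemma Lam_der (K y : ℝ) : HasDerivAt (Lam K) (-om K y) y :=
  intervalIntegral.integral_hasDerivAt_left (om_ii _ _ _)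
    ((om_cont K).stronglyMeasurableAtFilter _ _) (om_cont K).continuousAt
lemma Lam_cont (K : ℝ) : Continuous (Lam K) := continuous_iff_continuousAt.2 fun y => (Lam_der K y).continuousAt
lemma Lam_anti (K : ℝ) : Antitone (Lam K) :=
  antitone_of_deriv_nonpos (fun y => (Lam_der K y).differentiableAt)
    fun y => by rw [(Lam_der K y).deriv]; linarith [om_nonneg K y]
lemma Lam_zero {K y : ℝ} (hK : 0 < K) (hy : 2 * K ≤ y) : Lam K y = 0 := by
  unfold Lam
  rw [intervalIntegral.integral_congr (g := fun _ => (0:ℝ))]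
  · simp
  · intro t ht
    rw [uIcc_of_ge hy] at ht
    exact om_zero hK ht.1
lemma Lam_nonneg {K : ℝ} (hK : 0 < K) (y : ℝ) : 0 ≤ Lam K y := by
  rcases le_total y (2 * K) with h | h
  · exact intervalIntegral.integral_nonneg h fun t _ => om_nonneg K t
  · rw [Lam_zero hK h]

/-- first derivative of the truncated entropy -/
def cc1 (q K x : ℝ) : ℝ := q * Lam K ((max x 0) ^ (q - 1))
def cc (q K x : ℝ) : ℝ := ∫ t in (0:ℝ)..x, cc1 q K t
def ee (q K x : ℝ) : ℝ := cc q K x - cc1 q K x * x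
section
variable {q K : ℝ} (hq : 1 < q) (hK : 0 < K)
include hq
lemma cc1_cont : Continuous (cc1 q K) := by
  have h1 : Continuous fun x : ℝ => (max x 0) ^ (q - 1) :=
    (continuous_id.max continuous_const).rpow_const fun x => Or.inr (by linarith)
  exact continuous_const.mul ((Lam_cont K).comp h1)
lemma cc1_anti : Antitone (cc1 q K) := fun x y hxy => by
  unfold cc1
  refine mul_le_mul_of_nonneg_left (Lam_anti K ?_) (by linarith)
  exact Real.rpow_le_rpow (le_max_right _ _) (max_le_max hxy le_rfl) (by linarith)
lemma cc_der (x : ℝ) : HasDerivAt (cc q K) (cc1 q K x) x :=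
  intervalIntegral.integral_hasDerivAt_right ((cc1_cont hq).intervalIntegrable _ _)
    ((cc1_cont hq).stronglyMeasurableAtFilter _ _) (cc1_cont hq).continuousAt
omit hq in
lemma cc_zero : cc q K 0 = 0 := by simp [cc]
lemma cc1_le (x : ℝ) : cc1 q K x ≤ cc1 q K 0 := by
  rcases le_total 0 x with h | h
  · exact cc1_anti hq h
  · apply le_of_eq; unfold cc1; rw [max_eq_right h, max_self]
lemma cc1_der {x : ℝ} (hx : 0 < x) :
    HasDerivAt (cc1 q K) (-(q * (q - 1) * x ^ (q - 2) * om K (x ^ (q - 1)))) x := by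
  have h1 : HasDerivAt (fun x : ℝ => x ^ (q - 1)) ((q - 1) * x ^ (q - 1 - 1)) x :=
    Real.hasDerivAt_rpow_const (Or.inl hx.ne')
  have h2 := ((Lam_der K (x ^ (q - 1))).comp x h1).const_mul q
  have h3 : cc1 q K =ᶠ[nhds x] fun y => q * (Lam K ∘ fun x : ℝ => x ^ (q - 1)) y := by
    filter_upwards [Ioi_mem_nhds hx] with y hy
    unfold cc1; rw [max_eq_left (le_of_lt hy)]; rfl
  refine (h2.congr_of_eventuallyEq h3).congr_deriv ?_
  rw [show q - 1 - 1 = q - 2 by ring]; ring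
lemma ee_der {x : ℝ} (hx : 0 < x) :
    HasDerivAt (ee q K) (q * (q - 1) * x ^ (q - 1) * om K (x ^ (q - 1))) x := by
  have := (cc_der (K := K) hq x).sub ((cc1_der (K := K) hq hx).mul (hasDerivAt_id x))
  refine this.congr_deriv ?_
  have e : x ^ (q - 1) = x ^ (q - 2) * x := by
    rw [show q - 1 = q - 2 + 1 by ring, Real.rpow_add_one hx.ne']
  simp only [id]
  linear_combination (-(q * (q - 1) * om K (x ^ (q - 1)))) * e
lemma ee_cont : Continuous (ee q K) := by
  have h1 : Continuous (cc q K) := continuous_iff_continuousAt.2 fun y => (cc_der hq y).continuousAt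
  exact h1.sub ((cc1_cont hq).mul continuous_id)
lemma cc_cont : Continuous (cc q K) := continuous_iff_continuousAt.2 fun y => (cc_der hq y).continuousAt
omit hq in
lemma ee_zero : ee q K 0 = 0 := by simp [ee, cc]
lemma ee_nonneg {x : ℝ} (hx : 0 ≤ x) : 0 ≤ ee q K x := by
  have : MonotoneOn (ee q K) (Ici 0) := by
    refine monotoneOn_of_deriv_nonneg (convex_Ici 0) (ee_cont hq).continuousOn ?_ ?_
    · intro y hy
      rw [interior_Ici] at hy
      exact (ee_der hq hy).differentiableAt.differentiableWithinAt
    · intro y hy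
      rw [interior_Ici] at hy
      rw [(ee_der hq hy).deriv]
      have := om_nonneg K (y ^ (q - 1))
      have h0 : 0 < y := hy
      have h1 : 0 < q - 1 := by linarith
      positivity
  have := this (mem_Ici.2 le_rfl) (mem_Ici.2 hx) hx
  rwa [ee_zero] at this
lemma dd_der {x : ℝ} (hx : 0 < x) :
    HasDerivAt (fun x => (q - 1) * x ^ q - ee q K x) (q * (q - 1) * x ^ (q - 1) * (1 - om K (x ^ (q - 1)))) x := by
  have h1 : HasDerivAt (fun x : ℝ => x ^ q) (q * x ^ (q - 1)) x :=
    Real.hasDerivAt_rpow_const (Or.inl hx.ne')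
  refine ((h1.const_mul (q - 1)).sub (ee_der (K := K) hq hx)).congr_deriv ?_
  ring
lemma dd_cont : Continuous (fun x => (q - 1) * x ^ q - ee q K x) := by
  have h1 : Continuous fun x : ℝ => x ^ q := continuous_id.rpow_const fun x => Or.inr (by linarith)
  exact (continuous_const.mul h1).sub (ee_cont hq)
lemma ee_le {x : ℝ} (hx : 0 ≤ x) : ee q K x ≤ (q - 1) * x ^ q := by
  have : MonotoneOn (fun x => (q - 1) * x ^ q - ee q K x) (Ici 0) := by
    refine monotoneOn_of_deriv_nonneg (convex_Ici 0) (dd_cont hq).continuousOn ?_ ?_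
    · intro y hy
      rw [interior_Ici] at hy
      exact (dd_der hq hy).differentiableAt.differentiableWithinAt
    · intro y hy
      rw [interior_Ici] at hy
      rw [(dd_der hq hy).deriv]
      have : 0 ≤ 1 - om K (y ^ (q - 1)) := by linarith [om_le K (y ^ (q - 1))]
      have h0 : 0 < y := hy
      have h1 : 0 < q - 1 := by linarith
      positivity
  have := this (mem_Ici.2 le_rfl) (mem_Ici.2 hx) hx
  simp only [ee_zero] at this
  rw [Real.zero_rpow (by linarith)] at this
  linarith
include hK
lemma ee_eq {x : ℝ} (hx : 0 ≤ x) (hxK : x ^ (q - 1) ≤ K) : ee q K x = (q - 1) * x ^ q := by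
  have : ∀ y ∈ Icc 0 x, (q - 1) * y ^ q - ee q K y = (q - 1) * (0:ℝ) ^ q - ee q K 0 := by
    refine constant_of_has_deriv_right_zero (dd_cont hq).continuousOn ?_
    intro y hy
    rcases hy.1.eq_or_lt with h | h
    · subst h
      -- derivative at zero from the right: limit of derivative
      refine hasDerivWithinAt_Ici_of_tendsto_deriv (s := Ioo 0 x) (f := fun y => (q - 1) * y ^ q - ee q K y)
        ?_ (dd_cont hq).continuousWithinAt (Ioo_mem_nhdsGT hy.2) ?_
      · intro z hz
        exact (dd_der hq hz.1).differentiableAt.differentiableWithinAt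
      · refine (tendsto_congr' ?_).2 tendsto_const_nhds
        filter_upwards [Ioo_mem_nhdsGT hy.2] with z hz
        rw [(dd_der hq hz.1).deriv, om_one hK, sub_self, mul_zero]
        exact (Real.rpow_le_rpow hz.1.le hz.2.le (by linarith)).trans hxK
    · have := (dd_der (K := K) hq h).hasDerivWithinAt (s := Ici y)
      rwa [om_one hK, sub_self, mul_zero] at this
      exact (Real.rpow_le_rpow h.le hy.2.le (by linarith)).trans hxK
  have := this x ⟨hx, le_rfl⟩
  rw [ee_zero, Real.zero_rpow (by linarith)] at this
  linarith
lemma cc1_nonneg (x : ℝ) : 0 ≤ cc1 q K x := mul_nonneg (by linarith) (Lam_nonneg hK _)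
lemma cc_mono : Monotone (cc q K) :=
  monotone_of_deriv_nonneg (fun x => (cc_der hq x).differentiableAt)
    fun x => by rw [(cc_der hq x).deriv]; exact cc1_nonneg hq hK x
lemma cc_nonneg {x : ℝ} (hx : 0 ≤ x) : 0 ≤ cc q K x := by
  have := cc_mono hq hK hx; rwa [cc_zero] at this
lemma cc_lip {x y : ℝ} : cc q K x - cc q K y ≤ cc1 q K 0 * max (x - y) 0 := by
  rcases le_total x y with h | h
  · rw [max_eq_right (by linarith), mul_zero]; linarith [cc_mono hq hK h]
  · rw [max_eq_left (by linarith)]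
    have := Convex.image_sub_le_mul_sub_of_deriv_le convex_univ (f := cc q K) (C := cc1 q K 0)
      (cc_cont hq).continuousOn (fun x _ => (cc_der hq x).differentiableAt.differentiableWithinAt)
      (fun x _ => by rw [(cc_der hq x).deriv]; exact cc1_le hq x) y (mem_univ _) x (mem_univ _) h
    exact this
lemma cc_le {x : ℝ} (hx : 0 ≤ x) : cc q K x ≤ cc1 q K 0 * x := by
  have := cc_lip hq hK (x := x) (y := 0)
  rwa [cc_zero, sub_zero, sub_zero, max_eq_left hx] at this
def X0 (q K : ℝ) : ℝ := (2 * K) ^ (1 / (q - 1))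
omit hq in
lemma X0_nonneg : 0 ≤ X0 q K := by unfold X0; positivity
lemma cc1_big {x : ℝ} (hx : X0 q K ≤ x) : cc1 q K x = 0 := by
  unfold cc1
  rw [Lam_zero hK, mul_zero]
  have h0 : 0 ≤ x := (X0_nonneg hK).trans hx
  rw [max_eq_left h0]
  have : X0 q K ^ (q - 1) = 2 * K := by
    unfold X0
    rw [← Real.rpow_mul (by linarith), one_div, inv_mul_cancel₀ (by linarith), Real.rpow_one]
  rw [← this]
  exact Real.rpow_le_rpow (X0_nonneg hK) hx (by linarith)
lemma cc1x_le {x : ℝ} (hx : 0 ≤ x) : cc1 q K x * x ≤ cc1 q K 0 * X0 q K := by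
  have h0 := cc1_nonneg hq hK 0
  have h1 := X0_nonneg (q := q) hK
  rcases le_total x (X0 q K) with h | h
  · exact mul_le_mul (cc1_le hq x) h hx h0
  · rw [cc1_big hq hK h, zero_mul]; positivity
lemma cc_bdd {x : ℝ} (hx : 0 ≤ x) : cc q K x ≤ cc1 q K 0 * X0 q K := by
  have h1 := X0_nonneg (q := q) hK
  rcases le_total x (X0 q K) with h | h
  · exact (cc_mono hq hK h).trans (cc_le hq hK h1)
  · refine le_trans (le_of_eq ?_) (cc_le hq hK h1)
    refine constant_of_has_deriv_right_zero (cc_cont hq).continuousOn ?_ x ⟨h, le_rfl⟩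
    intro y hy
    have := (cc_der (K := K) hq y).hasDerivWithinAt (s := Ici y)
    rwa [cc1_big hq hK hy.1] at this
omit hK in
lemma cc_concave {x l : ℝ} (hl0 : 0 ≤ l) (hl : l ≤ 1) : l * cc q K x ≤ cc q K (l * x) := by
  have : ConcaveOn ℝ univ (cc q K) := by
    refine AntitoneOn.concaveOn_of_deriv convex_univ (cc_cont hq).continuousOn
      (fun x _ => (cc_der hq x).differentiableAt.differentiableWithinAt) ?_
    intro y _ z _ hyz
    rw [(cc_der hq y).deriv, (cc_der hq z).deriv]
    exact cc1_anti hq hyz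
  have := this.2 (mem_univ x) (mem_univ 0) hl0 (by linarith : 0 ≤ 1 - l) (by ring)
  simpa [cc_zero] using this
end


/-! ### from a classical solution to the abstract core -/
namespace SS
variable {VF VE gL gin a σE : ℝ} {p : ℝ → ℝ → ℝ}

def cl (VF v : ℝ) : ℝ := max 0 (min v VF)
lemma cl_mem (hVF : 0 < VF) (v : ℝ) : cl VF v ∈ Icc 0 VF :=
  ⟨le_max_left _ _, max_le hVF.le (min_le_right _ _)⟩
lemma cl_id {v : ℝ} (hv : v ∈ Icc 0 VF) : cl VF v = v := by
  unfold cl; rw [min_eq_left hv.2, max_eq_right hv.1]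
lemma cl_cont : Continuous (cl VF) := by unfold cl; fun_prop

def PP (VF : ℝ) (p : ℝ → ℝ → ℝ) (v g : ℝ) : ℝ := p (cl VF v) (max g 0)
def PPg (p : ℝ → ℝ → ℝ) (v g : ℝ) : ℝ := derivWithin (p v) (Ici 0) g
def PPgg (p : ℝ → ℝ → ℝ) (v g : ℝ) : ℝ := derivWithin (PPg p v) (Ici 0) g

lemma PP_eq {v g : ℝ} (hv : v ∈ Icc 0 VF) (hg : 0 ≤ g) : PP VF p v g = p v g := by
  unfold PP; rw [cl_id hv, max_eq_left hg]

section
variable (hVF : 0 < VF) (S : StatSol VF VE gL gin a σE p)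
include hVF S
lemma PP_cont (g : ℝ) : Continuous fun v => PP VF p v g := by
  have := S.cont_v (max g 0) (mem_Ici.2 (le_max_right _ _))
  exact this.comp_continuous cl_cont fun v => cl_mem hVF v
lemma seq (v : ℝ) : ∃ w : ℕ → ℝ, (∀ n, w n ∈ Ioo 0 VF) ∧
    ∀ g, Tendsto (fun n => PP VF p (w n) g) atTop (nhds (PP VF p v g)) := by
  have h : cl VF v ∈ closure (Ioo 0 VF) := by
    rw [closure_Ioo hVF.ne]; exact cl_mem hVF v
  obtain ⟨w, h1, h2⟩ := mem_closure_iff_seq_limit.1 h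
  refine ⟨w, h1, fun g => ?_⟩
  have := ((PP_cont hVF S g).tendsto (cl VF v)).comp h2
  have e : PP VF p (cl VF v) g = PP VF p v g := by
    unfold PP; rw [cl_id (cl_mem hVF v)]
  rwa [e] at this
lemma PP_nonneg (v g : ℝ) : 0 ≤ PP VF p v g := by
  obtain ⟨w, h1, h2⟩ := seq hVF S v
  refine ge_of_tendsto' (h2 g) fun n => ?_
  unfold PP
  rw [cl_id (Ioo_subset_Icc_self (h1 n))]
  exact S.nonneg _ (h1 n) _ (mem_Ici.2 (le_max_right _ _))
lemma PP_meas : Measurable (Function.uncurry (PP VF p)) := by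
  refine (stronglyMeasurable_uncurry_of_continuous_of_stronglyMeasurable (PP_cont hVF S)
    fun v => ?_).measurable
  refine Measurable.stronglyMeasurable ?_
  obtain ⟨w, h1, h2⟩ := seq hVF S v
  refine measurable_of_tendsto_metrizable (f := fun n => PP VF p (w n)) (fun n => ?_)
    (tendsto_pi_nhds.2 fun g => h2 g)
  refine Continuous.measurable ?_
  unfold PP
  rw [cl_id (Ioo_subset_Icc_self (h1 n))]
  exact (S.smooth_g _ (h1 n)).continuousOn.comp_continuous (by fun_prop) fun g => mem_Ici.2 (le_max_right _ _)
omit hVF in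
lemma p_der {v g : ℝ} (hv : v ∈ Ioo 0 VF) (hg : g ∈ Ici (0:ℝ)) :
    HasDerivWithinAt (p v) (PPg p v g) (Ici 0) g :=
  ((S.smooth_g v hv).differentiableOn (by norm_num) g hg).hasDerivWithinAt
omit hVF in
lemma PPg_smooth {v : ℝ} (hv : v ∈ Ioo 0 VF) : ContDiffOn ℝ 1 (PPg p v) (Ici 0) :=
  (S.smooth_g v hv).derivWithin (uniqueDiffOn_Ici 0) (by norm_num)
omit hVF in
lemma PPg_der {v g : ℝ} (hv : v ∈ Ioo 0 VF) (hg : g ∈ Ici (0:ℝ)) :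
    HasDerivWithinAt (PPg p v) (PPgg p v g) (Ici 0) g :=
  ((PPg_smooth S hv).differentiableOn (by norm_num) g hg).hasDerivWithinAt
omit hVF in
lemma PPgg_cont {v : ℝ} (hv : v ∈ Ioo 0 VF) : ContinuousOn (PPgg p v) (Ici 0) :=
  (PPg_smooth S hv).continuousOn_derivWithin (uniqueDiffOn_Ici 0) (by norm_num)
omit hVF in
lemma p_der' {v g : ℝ} (hv : v ∈ Ioo 0 VF) (hg : 0 < g) : HasDerivAt (p v) (PPg p v g) g :=
  (p_der S hv (mem_Ici.2 hg.le)).hasDerivAt (Ici_mem_nhds hg)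
omit hVF in
lemma PPg_der' {v g : ℝ} (hv : v ∈ Ioo 0 VF) (hg : 0 < g) : HasDerivAt (PPg p v) (PPgg p v g) g :=
  (PPg_der S hv (mem_Ici.2 hg.le)).hasDerivAt (Ici_mem_nhds hg)
omit hVF in
lemma dd {v g : ℝ} (hv : v ∈ Ioo 0 VF) (hg : 0 < g) :
    deriv (deriv (fun g' => p v g')) g = PPgg p v g := by
  refine HasDerivAt.deriv ((PPg_der' S hv hg).congr_of_eventuallyEq ?_)
  filter_upwards [Ioi_mem_nhds hg] with x hx
  exact (p_der' S hv hx).deriv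
omit hVF in
lemma pde' (hσ : 0 < σE) {v g : ℝ} (hv : v ∈ Ioo 0 VF) (hg : 0 < g) :
    Jflux VE gL v g * deriv (fun v' => p v' g) v =
    a / σE * PPgg p v g - (gin / σE - 1 / σE * g) * PPg p v g + 1 / σE * p v g + (g + gL) * p v g := by
  have h := S.pde v hv g hg
  rw [dd S hv hg] at h
  have d1 : HasDerivAt (fun v' => Jflux VE gL v' g) (-(g + gL)) v := by
    unfold Jflux
    have := ((hasDerivAt_id v).const_mul (-gL)).add (((hasDerivAt_id v).const_sub VE).const_mul g)
    refine this.congr_deriv (by ring)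
  have d2 := (S.diff_v v hv g hg).hasDerivAt
  have d3 : HasDerivAt (fun g' => (gin - g') / σE) (-1 / σE) g := by
    simpa using ((hasDerivAt_id g).const_sub gin).div_const σE
  have d4 := p_der' S hv hg
  rw [(d1.fun_mul d2).deriv, (d3.fun_mul d4).deriv] at h
  field_simp at h ⊢
  linarith
omit hVF in
lemma robin (hσ : 0 < σE) (hgin : 0 < gin) (ha : 0 < a)
    (hp : ∀ v ∈ Ioo 0 VF, ∀ g ∈ Ici (0:ℝ), 0 < p v g) {v : ℝ} (hv : v ∈ Ioo 0 VF) :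
    a / σE * PPg p v 0 = gin / σE * p v 0 := by
  have h := S.bc_g v hv
  have h0 := hp v hv 0 (self_mem_Ici)
  have hne : deriv (fun g' => p v g') 0 ≠ 0 := by
    intro h1
    rw [h1] at h
    nlinarith [mul_pos hgin h0]
  have hd := (differentiableAt_of_deriv_ne_zero hne).hasDerivAt
  have : deriv (fun g' => p v g') 0 = PPg p v 0 :=
    ((uniqueDiffOn_Ici (0:ℝ)) 0 self_mem_Ici).eq_deriv _ hd.hasDerivWithinAt (p_der S hv self_mem_Ici)
  rw [this] at h
  field_simp
  linarith

lemma ev_pp {v g : ℝ} (hv : v ∈ Ioo 0 VF) (hg : 0 ≤ g) :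
    (fun v' => PP VF p v' g) =ᶠ[nhds v] fun v' => p v' g := by
  filter_upwards [Ioo_mem_nhds hv.1 hv.2] with x hx
  exact PP_eq (Ioo_subset_Icc_self hx) hg
end

/-- the core data with cutoff at height `R` -/
def core (hVF : 0 < VF) (hVE : VF < VE) (hgL : 0 < gL) (hgin : 0 < gin)
    (ha : 0 < a) (hσE : 0 < σE) (S : StatSol VF VE gL gin a σE p)
    (hp : ∀ v ∈ Ioo 0 VF, ∀ g ∈ Ici (0:ℝ), 0 < p v g) (R : ℝ) (hR : 0 < R)
    (hRF : gL * VF / (VE - VF) < 2 * R) : Core where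
  VF := VF
  VE := VE
  gL := gL
  κ := a / σE
  b0 := gin / σE
  s := 1 / σE
  G := 2 * R
  P := PP VF p
  Pg := PPg p
  Pgg := PPgg p
  Pv := fun v g => deriv (fun v' => p v' g) v
  ψ := fun g => eta (2 - g / R)
  ψ1 := fun g => -eta1 (2 - g / R) / R
  ψ2 := fun g => eta2 (2 - g / R) / R ^ 2
  hVF := hVF
  hVE := hVE
  hgL := hgL
  hκ := div_pos ha hσE
  hb0 := div_pos hgin hσE
  hs := div_pos one_pos hσE
  hG := hRF
  hPc := PP_cont hVF S
  hPm := PP_meas hVF S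
  hP0 := PP_nonneg hVF S
  hPg := fun v hv g hg => (p_der S hv hg).congr (fun x hx => PP_eq (Ioo_subset_Icc_self hv) hx)
    (PP_eq (Ioo_subset_Icc_self hv) hg)
  hPgg := fun v hv g hg => PPg_der S hv hg
  hPggc := fun v hv => PPgg_cont S hv
  hPv := fun v hv g hg =>
    ((S.diff_v v hv g hg).hasDerivAt).congr_of_eventuallyEq (ev_pp hVF S hv (le_of_lt hg))
  hpde := fun v hv g hg => by
    rw [PP_eq (Ioo_subset_Icc_self hv) (le_of_lt hg)]; exact pde' S hσE hv hg
  hrobin := fun v hv => by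
    rw [PP_eq (Ioo_subset_Icc_self hv) le_rfl]; exact robin S hσE hgin ha hp hv
  hψ := fun g => by
    have h1 : HasDerivAt (fun g : ℝ => 2 - g / R) (-(1 / R)) g :=
      ((hasDerivAt_id g).div_const R).const_sub 2
    exact ((eta_der (2 - g / R)).comp g h1).congr_deriv (by ring)
  hψ1 := fun g => by
    have h1 : HasDerivAt (fun g : ℝ => 2 - g / R) (-(1 / R)) g :=
      ((hasDerivAt_id g).div_const R).const_sub 2
    exact ((((eta1_der (2 - g / R)).comp g h1).fun_neg).div_const R).congr_deriv (by field_simp; try ring)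
  hψ2 := by
    have := eta2_cont
    fun_prop
  ψ_nonneg := fun g => eta_nonneg _
  ψ_le := fun g => eta_le _
  ψ_zero := eta_of_ge (by simp)
  ψ1_zero := by simp [eta1_of_ge (x := 2) (by norm_num)]
  ψ_G := by
    have : 2 - 2 * R / R = 0 := by field_simp; ring
    rw [this, eta_of_nonpos le_rfl]
  ψ1_G := by
    have : 2 - 2 * R / R = 0 := by field_simp; ring
    rw [this, eta1_of_nonpos le_rfl]; simp

end SS


/-! ### the power-type entropy estimate -/
section pw
variable (c : Core) {q K : ℝ} (hq : 1 < q) (hK : 0 < K)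
  (hpos : ∀ v ∈ Ioo 0 c.VF, ∀ g ∈ Icc 0 c.G, 0 < c.P v g)

def pL (q K : ℝ) : ℝ := cc1 q K 0 + cc1 q K 0 * X0 q K

def pAdm : Adm c where
  Θ := fun u => -cc q K (-u)
  Θ1 := fun u => cc1 q K (-u)
  Θ2 := fun u => q * (q - 1) * (-u) ^ (q - 2) * om K ((-u) ^ (q - 1))
  k := fun _ => 0
  k1 := fun _ => 0
  k2 := fun _ => 0
  L := pL q K
  I := Iio 0
  hI := isOpen_Iio
  hrange := fun v hv g hg => by simpa using hpos v hv g hg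
  hΘ := fun u _ => by
    exact (((cc_der (K := K) hq (-u)).comp u (hasDerivAt_neg u)).fun_neg).congr_deriv (by ring)
  hΘ1 := fun u hu => by
    have hu : 0 < -u := by simpa using hu
    exact ((cc1_der (K := K) hq hu).comp u (hasDerivAt_neg u)).congr_deriv (by ring)
  hΘ2c := by
    have h := om_cont K
    have h1 : ∀ r : ℝ, ContinuousOn (fun u : ℝ => (-u) ^ r) (Iio 0) := fun r =>
      (continuous_neg.continuousOn).rpow_const fun u hu => Or.inl (by
        have : u < 0 := hu
        simp; exact this.ne)
    have h2 := h1 (q - 2)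
    have h3 := h1 (q - 1)
    exact (continuousOn_const.mul h2).mul (h.comp_continuousOn h3)
  hΘ2 := fun u hu => by
    have hu : 0 < -u := by simpa using hu
    have := om_nonneg K ((-u) ^ (q - 1))
    have : 0 < q - 1 := by linarith
    positivity
  hL := by
    have h1 := cc1_nonneg hq hK 0
    have h2 := X0_nonneg (q := q) hK
    unfold pL; positivity
  hlip := fun u u' => by
    have h := cc_lip hq hK (x := -u) (y := -u')
    have h1 := cc1_nonneg hq hK 0
    have h2 := X0_nonneg (q := q) hK
    have h3 : 0 ≤ cc1 q K 0 * X0 q K := by positivity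
    have e : -u - -u' = u' - u := by ring
    rw [e] at h
    have h4 : 0 ≤ max (u' - u) 0 := le_max_right _ _
    unfold pL
    nlinarith
  hb := fun v hv g hg => by
    have hp := (hpos v hv g hg).le
    have h1 := cc1_nonneg hq hK 0
    have h3 := cc_bdd hq hK hp
    have h4 := cc_nonneg hq hK hp
    simp only [zero_sub, neg_neg, abs_neg, abs_of_nonneg h4]
    unfold pL; linarith
  hb1 := fun v hv g hg => by
    have h1 := cc1_nonneg hq hK 0
    have h2 := X0_nonneg (q := q) hK
    have h3 : 0 ≤ cc1 q K 0 * X0 q K := by positivity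
    have h4 := cc1_nonneg hq hK (c.P v g)
    have h5 := cc1_le (K := K) hq (c.P v g)
    simp only [zero_sub, neg_neg, abs_of_nonneg h4]
    unfold pL; linarith
  hb2 := fun v hv g hg => by
    have hp := (hpos v hv g hg).le
    have h1 := cc1_nonneg hq hK 0
    have h4 := cc1_nonneg hq hK (c.P v g)
    have h5 := cc1x_le hq hK hp
    simp only [zero_sub, neg_neg, mul_neg, abs_neg]
    rw [abs_of_nonneg (mul_nonneg h4 hp)]
    unfold pL; linarith
  hk := fun g _ => hasDerivWithinAt_const _ _ _
  hk1 := fun g _ => hasDerivWithinAt_const _ _ _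
  hk2c := continuousOn_const
  hkm := measurable_const
  hrob := by simp

lemma pAdm_T (hlow : ∀ g ∈ Ioo 0 (c.gL * c.VF / (c.VE - c.VF)),
      c.J 0 g * c.P 0 g = 0 ∧ c.J c.VF g * c.P c.VF g = 0)
    (hhigh : ∀ g ∈ Ici (c.gL * c.VF / (c.VE - c.VF)),
      c.J 0 g * c.P 0 g = c.J c.VF g * c.P c.VF g) :
    0 ≤ (pAdm c hq hK hpos).T c.VF - (pAdm c hq hK hpos).T 0 := by
  set A := pAdm c hq hK hpos
  unfold Adm.T
  rw [sub_nonneg]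
  have hVF := c.hVF
  have hd : 0 < c.VE - c.VF := sub_pos.2 c.hVE
  refine setIntegral_mono_on (A.W_int ⟨le_rfl, hVF.le⟩) (A.W_int ⟨hVF.le, le_rfl⟩)
    measurableSet_Ioo fun g hg => ?_
  have hψ := c.ψ_nonneg g
  have e : ∀ v, A.W v g = -(c.ψ g * (c.J v g * cc q K (c.P v g))) := fun v => by
    simp only [Adm.W, Adm.u, A, pAdm]; rw [zero_sub, neg_neg]; ring
  rw [e, e]
  suffices h : c.J c.VF g * cc q K (c.P c.VF g) ≤ c.J 0 g * cc q K (c.P 0 g) by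
    have := mul_le_mul_of_nonneg_left h hψ
    linarith
  have J0 : c.J 0 g = g * c.VE := by simp [Core.J, Jflux]
  have JF : c.J c.VF g = g * (c.VE - c.VF) - c.gL * c.VF := by simp [Core.J, Jflux]; ring
  have J0p : 0 < c.J 0 g := by rw [J0]; exact mul_pos hg.1 (by linarith)
  have P0 := c.hP0 0 g
  have PF := c.hP0 c.VF g
  have c0 := cc_nonneg hq hK P0
  have cF := cc_nonneg hq hK PF
  rcases lt_or_ge g (c.gL * c.VF / (c.VE - c.VF)) with hlt | hge
  · have : c.J c.VF g ≤ 0 := by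
      rw [JF]; rw [lt_div_iff₀ hd] at hlt; linarith
    nlinarith
  · have hJF : 0 ≤ c.J c.VF g := by
      rw [JF]; rw [div_le_iff₀ hd] at hge; linarith
    have hJ : c.J c.VF g ≤ c.J 0 g := by
      rw [JF, J0]; nlinarith [mul_pos hg.1 hVF, mul_pos c.hgL hVF]
    have hh := hhigh g hge
    have e2 : c.P 0 g = (c.J c.VF g / c.J 0 g) * c.P c.VF g := by
      field_simp; linarith
    have := cc_concave (K := K) (x := c.P c.VF g) hq (div_nonneg hJF J0p.le) ((div_le_one J0p).2 hJ)
    rw [← e2] at this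
    rw [div_mul_eq_mul_div, div_le_iff₀ J0p] at this
    linarith

lemma pAdm_e1 (v g : ℝ) : (pAdm c hq hK hpos).e1 v g =
    -((c.κ * c.ψ2 g + (c.b0 - c.s * g) * c.ψ1 g) * cc q K (c.P v g)) +
      c.ψ g * (g + c.gL + c.s) * ee q K (c.P v g) := by
  simp only [Adm.e1, Adm.u, Adm.R, pAdm, zero_sub, neg_neg, ee]; ring

def pdis (q K v g : ℝ) : ℝ := c.κ * c.ψ g * (q * (q - 1) * c.P v g ^ (q - 2) *
  om K (c.P v g ^ (q - 1))) * c.Pg v g ^ 2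
lemma pAdm_dis (v g : ℝ) : (pAdm c hq hK hpos).dis v g = pdis c q K v g := by
  simp only [Adm.dis, Adm.u, Adm.u1, pAdm, zero_sub, neg_neg, pdis, neg_sq]

/-- Fatou in a convenient form -/
lemma fatou_le {α : Type*} [MeasurableSpace α] {μ : Measure α} {F : ℕ → α → ENNReal}
    {F' : α → ENNReal} {B : ℕ → ENNReal} {B' : ENNReal} (hF : ∀ n, AEMeasurable (F n) μ)
    (hl : ∀ᵐ x ∂μ, Tendsto (fun n => F n x) atTop (nhds (F' x)))
    (hB : ∀ n, ∫⁻ x, F n x ∂μ ≤ B n) (hB' : Tendsto B atTop (nhds B')) :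
    ∫⁻ x, F' x ∂μ ≤ B' := by
  calc ∫⁻ x, F' x ∂μ = ∫⁻ x, liminf (fun n => F n x) atTop ∂μ := by
        refine lintegral_congr_ae ?_
        filter_upwards [hl] with x hx using hx.liminf_eq.symm
    _ ≤ liminf (fun n => ∫⁻ x, F n x ∂μ) atTop := lintegral_liminf_le' hF
    _ ≤ liminf B atTop := liminf_le_liminf (Eventually.of_forall hB)
    _ = B' := hB'.liminf_eq

lemma neg_part_lemma {VF : ℝ} (hVF : 0 ≤ VF) {f Y : ℝ → ℝ} (hf : Measurable f) (hY : Measurable Y)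
    (hY0 : ∀ v ∈ Ioo 0 VF, 0 ≤ Y v) (hfY : ∀ v ∈ Ioo 0 VF, f v ≤ Y v)
    (hi : ∀ N : ℝ, IntegrableOn (fun v => max (f v) (-N)) (Ioo 0 VF))
    (hn : ∀ N : ℝ, 0 ≤ ∫ v in Ioo 0 VF, max (f v) (-N)) :
    ∫⁻ v in Ioo 0 VF, ENNReal.ofReal (Y v - f v) ≤ ∫⁻ v in Ioo 0 VF, ENNReal.ofReal (Y v) := by
  by_cases htop : ∫⁻ v in Ioo 0 VF, ENNReal.ofReal (Y v) = ⊤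
  · rw [htop]; exact le_top
  have hYi : IntegrableOn Y (Ioo 0 VF) :=
    (lintegral_ofReal_ne_top_iff_integrable hY.aestronglyMeasurable
      ((ae_restrict_iff' measurableSet_Ioo).2 (Eventually.of_forall hY0))).1 htop
  have key : ∀ n : ℕ, ∫⁻ v in Ioo 0 VF, ENNReal.ofReal (Y v - max (f v) (-(n:ℝ))) ≤
      ∫⁻ v in Ioo 0 VF, ENNReal.ofReal (Y v) := by
    intro n
    have hsub : IntegrableOn (fun v => Y v - max (f v) (-(n:ℝ))) (Ioo 0 VF) := hYi.sub (hi n)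
    rw [← ofReal_integral_eq_lintegral_ofReal hsub, ← ofReal_integral_eq_lintegral_ofReal hYi]
    · refine ENNReal.ofReal_le_ofReal ?_
      have := integral_sub hYi (hi n)
      rw [this]; linarith [hn n]
    · exact (ae_restrict_iff' measurableSet_Ioo).2 (Eventually.of_forall hY0)
    · refine (ae_restrict_iff' measurableSet_Ioo).2 (Eventually.of_forall fun v hv => ?_)
      have : (0:ℝ) ≤ n := Nat.cast_nonneg n
      simp only [Pi.zero_apply, Pi.sub_apply, sub_nonneg]
      exact max_le (hfY v hv) (by linarith [hY0 v hv])
  refine fatou_le (B := fun _ => _) (fun n => ?_) (Eventually.of_forall fun v => ?_) key tendsto_const_nhds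
  · exact (ENNReal.measurable_ofReal.comp (hY.sub (hf.max measurable_const))).aemeasurable
  · refine tendsto_const_nhds.congr' ?_
    obtain ⟨m, hm⟩ := exists_nat_ge (-(f v))
    filter_upwards [eventually_ge_atTop m] with n hn
    have : (m:ℝ) ≤ n := by exact_mod_cast hn
    rw [max_eq_left (by linarith)]

include hpos in
theorem key_est (hlow : ∀ g ∈ Ioo 0 (c.gL * c.VF / (c.VE - c.VF)),
      c.J 0 g * c.P 0 g = 0 ∧ c.J c.VF g * c.P c.VF g = 0)
    (hhigh : ∀ g ∈ Ici (c.gL * c.VF / (c.VE - c.VF)),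
      c.J 0 g * c.P 0 g = c.J c.VF g * c.P c.VF g) {δ : ℝ} (hδ : 0 ≤ δ) (hq : 1 < q) (hK : 0 < K)
    (herr : ∀ v ∈ Ioo 0 c.VF, ∫ g in Ioo 0 c.G,
      -((c.κ * c.ψ2 g + (c.b0 - c.s * g) * c.ψ1 g) * cc q K (c.P v g)) ≤ δ) :
    ∫⁻ v in Ioo 0 c.VF, (ENNReal.ofReal (c.b0 * ee q K (c.P v 0)) +
      ∫⁻ g in Ioo 0 c.G, ENNReal.ofReal (pdis c q K v g)) ≤
    ENNReal.ofReal δ * ENNReal.ofReal c.VF + ∫⁻ v in Ioo 0 c.VF, ∫⁻ g in Ioi (0:ℝ),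
      ENNReal.ofReal ((q - 1) * (g + c.gL + c.s) * c.P v g ^ q) := by
  have hgL := c.hgL
  have hs := c.hs
  have hb0 := c.hb0
  set A := pAdm c hq hK hpos with hA
  set B : ℝ → ℝ → ℝ := fun v g => c.ψ g * (g + c.gL + c.s) * ee q K (c.P v g) with hB
  set E : ℝ → ℝ → ℝ := fun v g =>
    -((c.κ * c.ψ2 g + (c.b0 - c.s * g) * c.ψ1 g) * cc q K (c.P v g)) with hE
  have hBm : Measurable (Function.uncurry B) := by
    have h1 : Measurable fun x : ℝ × ℝ => c.ψ x.2 := c.ψ_cont.measurable.comp measurable_snd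
    have h2 : Measurable fun x : ℝ × ℝ => ee q K (c.P x.1 x.2) :=
      (ee_cont (K := K) hq).measurable.comp c.hPm
    exact (h1.mul (by fun_prop)).mul h2
  have hBc : ∀ v ∈ Ioo 0 c.VF, ContinuousOn (B v) (Icc 0 c.G) := fun v hv => by
    have h1 := (ee_cont (K := K) hq).comp_continuousOn ((c.P_contOn hv).mono (Adm.Icc_sub (c := c)))
    exact ((c.ψ_cont.continuousOn).mul (by fun_prop)).mul h1
  have hEc : ∀ v ∈ Ioo 0 c.VF, ContinuousOn (E v) (Icc 0 c.G) := fun v hv => by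
    have h1 := (cc_cont (K := K) hq).comp_continuousOn ((c.P_contOn hv).mono (Adm.Icc_sub (c := c)))
    have h2 := c.hψ2
    have h3 := c.ψ1_cont
    exact ((Continuous.continuousOn (by fun_prop)).mul h1).neg
  have hB0 : ∀ v, ∀ g ∈ Ioo 0 c.G, 0 ≤ B v g := fun v g hg => by
    have h1 := c.ψ_nonneg g
    have h2 := ee_nonneg (K := K) hq (c.hP0 v g)
    have := hg.1
    simp only [hB]; positivity
  have hd0 : ∀ v, ∀ g, 0 ≤ pdis c q K v g := fun v g => by
    have h1 := c.ψ_nonneg g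
    have h2 := c.hP0 v g
    have h3 := om_nonneg K (c.P v g ^ (q - 1))
    have h4 := c.hκ
    have h5 : 0 < q - 1 := by linarith
    unfold pdis; positivity
  have hdi : ∀ v ∈ Ioo 0 c.VF, IntegrableOn (pdis c q K v) (Ioo 0 c.G) := fun v hv => by
    have := Adm.intOn (c := c) (A.dis_contOn hv)
    rwa [show A.dis v = pdis c q K v from funext fun g => pAdm_dis c hq hK hpos v g] at this
  have hf : ∀ v ∈ Ioo 0 c.VF, A.f v = -(c.b0 * ee q K (c.P v 0)) + ((∫ g in Ioo 0 c.G, E v g) +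
      (∫ g in Ioo 0 c.G, B v g) - ∫ g in Ioo 0 c.G, pdis c q K v g) := fun v hv => by
    rw [A.ibp hv, ← integral_add (Adm.intOn (hEc v hv)) (Adm.intOn (hBc v hv))]
    rw [show A.dis v = pdis c q K v from funext fun g => pAdm_dis c hq hK hpos v g]
    rw [show A.e1 v = fun g => E v g + B v g from funext fun g => pAdm_e1 c hq hK hpos v g]
    congr 1
    simp only [A, pAdm, Adm.u, zero_sub, neg_neg, ee]; ring
  set Y : ℝ → ℝ := fun v => δ + ∫ g in Ioo 0 c.G, B v g with hY
  have hYm : Measurable Y :=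
    measurable_const.add (hBm.stronglyMeasurable.integral_prod_right).measurable
  have hBi0 : ∀ v, 0 ≤ ∫ g in Ioo 0 c.G, B v g := fun v =>
    setIntegral_nonneg measurableSet_Ioo (hB0 v)
  have hY0 : ∀ v, 0 ≤ Y v := fun v => add_nonneg hδ (hBi0 v)
  have hlb : ∀ v ∈ Ioo 0 c.VF, c.b0 * ee q K (c.P v 0) + ∫ g in Ioo 0 c.G, pdis c q K v g ≤
      Y v - A.f v := fun v hv => by
    rw [hf v hv]
    have := herr v hv
    simp only [hY]
    linarith
  have hdi0 : ∀ v, 0 ≤ ∫ g in Ioo 0 c.G, pdis c q K v g := fun v =>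
    setIntegral_nonneg measurableSet_Ioo fun g _ => hd0 v g
  have hee0 : ∀ v, 0 ≤ c.b0 * ee q K (c.P v 0) := fun v =>
    mul_nonneg hb0.le (ee_nonneg (K := K) hq (c.hP0 v 0))
  calc _ ≤ ∫⁻ v in Ioo 0 c.VF, ENNReal.ofReal (Y v - A.f v) := by
        refine setLIntegral_mono' measurableSet_Ioo fun v hv => ?_
        rw [← ofReal_integral_eq_lintegral_ofReal (hdi v hv) (Eventually.of_forall (hd0 v)),
          ← ENNReal.ofReal_add (hee0 v) (hdi0 v)]
        exact ENNReal.ofReal_le_ofReal (hlb v hv)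
    _ ≤ ∫⁻ v in Ioo 0 c.VF, ENNReal.ofReal (Y v) := by
        refine neg_part_lemma c.hVF.le A.f_meas hYm (fun v _ => hY0 v) (fun v hv => ?_) (fun N => ?_)
          fun N => ?_
        · linarith [hlb v hv, hee0 v, hdi0 v]
        · exact A.h_int N le_rfl le_rfl
        · have := A.main N
          have h2 := pAdm_T c hq hK hpos hlow hhigh
          rw [intervalIntegral.integral_of_le c.hVF.le, integral_Ioc_eq_integral_Ioo] at this
          exact le_trans h2 this
    _ ≤ _ := by
        simp only [hY]
        simp_rw [ENNReal.ofReal_add hδ (hBi0 _)]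
        rw [lintegral_add_left measurable_const]
        refine add_le_add ?_ ?_
        · simp
        · refine setLIntegral_mono' measurableSet_Ioo fun v hv => ?_
          rw [ofReal_integral_eq_lintegral_ofReal (Adm.intOn (hBc v hv))
            ((ae_restrict_iff' measurableSet_Ioo).2 (Eventually.of_forall (hB0 v)))]
          refine le_trans ?_ (lintegral_mono_set (show Ioo 0 c.G ⊆ Ioi 0 from Ioo_subset_Ioi_self))
          refine setLIntegral_mono' measurableSet_Ioo fun g hg => ENNReal.ofReal_le_ofReal ?_
          have h1 := c.ψ_nonneg g
          have h1' := c.ψ_le g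
          have h2 := ee_nonneg (K := K) hq (c.hP0 v g)
          have h3 := ee_le (K := K) hq (c.hP0 v g)
          have h4 : 0 < g + c.gL + c.s := by have := hg.1; positivity
          calc B v g ≤ 1 * (g + c.gL + c.s) * ((q - 1) * c.P v g ^ q) := by
                simp only [hB]; gcongr
            _ = _ := by ring
end pw


namespace SS
variable {VF VE gL gin a σE : ℝ} {p : ℝ → ℝ → ℝ}

def EE (VF : ℝ) : Set (ℝ × ℝ) := Ioo 0 VF ×ˢ Ioi (0:ℝ)
lemma EE_meas (VF : ℝ) : MeasurableSet (EE VF) := measurableSet_Ioo.prod measurableSet_Ioi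
lemma EE_restrict (VF : ℝ) : (volume : Measure (ℝ × ℝ)).restrict (EE VF) =
    ((volume : Measure ℝ).restrict (Ioo 0 VF)).prod ((volume : Measure ℝ).restrict (Ioi 0)) := by
  rw [Measure.prod_restrict]; rfl

lemma PPg_meas (hVF : 0 < VF) (S : StatSol VF VE gL gin a σE p) :
    Measurable ((EE VF).indicator fun x : ℝ × ℝ => PPg p x.1 x.2) := by
  have hm := PP_meas hVF S
  have hq : ∀ n : ℕ, Measurable ((EE VF).indicator fun x : ℝ × ℝ =>
      ((n:ℝ) + 1) * (PP VF p x.1 (x.2 + 1 / ((n:ℝ) + 1)) - PP VF p x.1 x.2)) := by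
    intro n
    refine Measurable.indicator ?_ (EE_meas VF)
    refine measurable_const.mul (Measurable.sub ?_ hm)
    exact hm.comp (measurable_fst.prodMk (measurable_snd.add_const _))
  refine measurable_of_tendsto_metrizable hq ?_
  rw [tendsto_pi_nhds]
  rintro ⟨v, g⟩
  by_cases hx : (v, g) ∈ EE VF
  · simp only [indicator_of_mem hx]
    have hv : v ∈ Ioo 0 VF := (mem_prod.1 hx).1
    have hg : 0 < g := (mem_prod.1 hx).2
    have := (p_der' S hv hg).tendsto_slope
    have ht : Tendsto (fun n : ℕ => g + 1 / ((n:ℝ) + 1)) atTop (nhdsWithin g {g}ᶜ) := by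
      refine tendsto_nhdsWithin_iff.2 ⟨?_, Eventually.of_forall fun n => ?_⟩
      · simpa using (tendsto_const_nhds (x := g)).add tendsto_one_div_add_atTop_nhds_zero_nat
      · have : (0:ℝ) < 1 / ((n:ℝ) + 1) := by positivity
        simp only [mem_compl_iff, mem_singleton_iff]; linarith
    refine (this.comp ht).congr fun n => ?_
    have h1 : (0:ℝ) < 1 / ((n:ℝ) + 1) := by positivity
    rw [PP_eq (Ioo_subset_Icc_self hv) hg.le, PP_eq (Ioo_subset_Icc_self hv) (by linarith)]
    simp only [Function.comp, slope_def_field]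
    field_simp
    ring
  · simp only [indicator_of_notMem hx]
    exact tendsto_const_nhds

/-- truncated dissipation density -/
def pd (a σE q K R : ℝ) (p : ℝ → ℝ → ℝ) (x : ℝ × ℝ) : ℝ :=
  a / σE * eta (2 - x.2 / R) * (q * (q - 1) * p x.1 x.2 ^ (q - 2) *
    om K (p x.1 x.2 ^ (q - 1))) * PPg p x.1 x.2 ^ 2

lemma pd_meas (hVF : 0 < VF) (S : StatSol VF VE gL gin a σE p) (q K R : ℝ) :
    AEMeasurable (fun x => ENNReal.ofReal (pd a σE q K R p x)) (volume.restrict (EE VF)) := by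
  have hm : Measurable fun x : ℝ × ℝ => PP VF p x.1 x.2 := PP_meas hVF S
  have hg := PPg_meas hVF S
  have h1 : Measurable fun x : ℝ × ℝ => eta (2 - x.2 / R) := eta_cont.measurable.comp (by fun_prop)
  have h2 : Measurable fun x : ℝ × ℝ => om K (PP VF p x.1 x.2 ^ (q - 1)) :=
    (om_cont K).measurable.comp (by fun_prop)
  have : Measurable fun x : ℝ × ℝ => ENNReal.ofReal (a / σE * eta (2 - x.2 / R) *
      (q * (q - 1) * PP VF p x.1 x.2 ^ (q - 2) * om K (PP VF p x.1 x.2 ^ (q - 1))) *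
      (EE VF).indicator (fun x : ℝ × ℝ => PPg p x.1 x.2) x ^ 2) := by
    fun_prop
  refine this.aemeasurable.congr ?_
  refine (ae_restrict_iff' (EE_meas VF)).2 (Eventually.of_forall fun x hx => ?_)
  simp only [indicator_of_mem hx, pd]
  rw [PP_eq (Ioo_subset_Icc_self (mem_prod.1 hx).1) (le_of_lt (mem_prod.1 hx).2)]

lemma pq_meas (hVF : 0 < VF) (S : StatSol VF VE gL gin a σE p) {w : ℝ → ℝ} (hw : Measurable w) (q : ℝ) :
    AEMeasurable (fun x : ℝ × ℝ => ENNReal.ofReal (w x.2 * p x.1 x.2 ^ q)) (volume.restrict (EE VF)) := by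
  have hm : Measurable fun x : ℝ × ℝ => PP VF p x.1 x.2 := PP_meas hVF S
  have : Measurable fun x : ℝ × ℝ => ENNReal.ofReal (w x.2 * PP VF p x.1 x.2 ^ q) := by
    fun_prop
  refine this.aemeasurable.congr ?_
  refine (ae_restrict_iff' (EE_meas VF)).2 (Eventually.of_forall fun x hx => ?_)
  simp only
  rw [PP_eq (Ioo_subset_Icc_self (mem_prod.1 hx).1) (le_of_lt (mem_prod.1 hx).2)]

theorem est (hVF : 0 < VF) (hVE : VF < VE) (hgL : 0 < gL) (hgin : 0 < gin)
    (ha : 0 < a) (hσE : 0 < σE) (S : StatSol VF VE gL gin a σE p)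
    (hp : ∀ v ∈ Ioo 0 VF, ∀ g ∈ Ici (0:ℝ), 0 < p v g) {q K δ M : ℝ} (hq : 1 < q) (hK : 0 < K)
    (hδ : 0 < δ) : ∃ R : ℝ, M ≤ R ∧ 0 < R ∧
    (∫⁻ v in Ioo 0 VF, ENNReal.ofReal (gin / σE * ee q K (p v 0))) +
      ∫⁻ x in EE VF, ENNReal.ofReal (pd a σE q K R p x) ≤
    ENNReal.ofReal δ * ENNReal.ofReal VF + ∫⁻ x in EE VF,
      ENNReal.ofReal (((q - 1) * (x.2 + gL + 1 / σE)) * p x.1 x.2 ^ q) := by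
  obtain ⟨G1, hG1⟩ := S.decay 1 one_pos
  set c0 := cc1 q K 0 with hc0
  have hc0n : 0 ≤ c0 := cc1_nonneg hq hK 0
  set C1 := (a / σE + gin / σE + 2 * (1 / σE)) * etaK with hC1
  have hek := etaK_nonneg
  have hC1n : 0 ≤ C1 := by positivity
  set R := max M (max 1 (max G1 (max (gL * VF / (VE - VF)) (2 * C1 * c0 / δ)))) with hR
  have hR1 : 1 ≤ R := (le_max_left _ _).trans (le_max_right _ _)
  have hRG : G1 ≤ R := (le_max_left _ _).trans ((le_max_right _ _).trans (le_max_right _ _))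
  have hRF : gL * VF / (VE - VF) ≤ R := (le_max_left _ _).trans
    ((le_max_right _ _).trans ((le_max_right _ _).trans (le_max_right _ _)))
  have hRd : 2 * C1 * c0 / δ ≤ R := (le_max_right _ _).trans
    ((le_max_right _ _).trans ((le_max_right _ _).trans (le_max_right _ _)))
  have hR0 : 0 < R := by linarith
  refine ⟨R, le_max_left _ _, hR0, ?_⟩
  clear_value R
  have hd : 0 < VE - VF := sub_pos.2 hVE
  set c := core hVF hVE hgL hgin ha hσE S hp R hR0 (by linarith) with hc
  have cP : ∀ v ∈ Icc 0 VF, ∀ g, 0 ≤ g → c.P v g = p v g := fun v hv g hg => PP_eq hv hg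
  have h0 : (0:ℝ) ∈ Icc 0 VF := ⟨le_rfl, hVF.le⟩
  have hF : VF ∈ Icc 0 VF := ⟨hVF.le, le_rfl⟩
  have key := key_est c (q := q) (K := K) (δ := δ) (fun v hv g hg => by
      rw [cP v (Ioo_subset_Icc_self hv) g hg.1]; exact hp v hv g hg.1)
    (fun g hg => by
      have := S.bc_v_low g hg
      change Jflux VE gL 0 g * c.P 0 g = 0 ∧ Jflux VE gL VF g * c.P VF g = 0
      rwa [cP 0 h0 g hg.1.le, cP VF hF g hg.1.le])
    (fun g hg => by
      have h1 := S.bc_v_high g hg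
      have h2 : 0 ≤ g := le_trans (by positivity) (mem_Ici.1 hg)
      change Jflux VE gL 0 g * c.P 0 g = Jflux VE gL VF g * c.P VF g
      rwa [cP 0 h0 g h2, cP VF hF g h2]) hδ.le hq hK ?_
  · rw [EE_restrict, lintegral_prod _ (by rw [← EE_restrict]; exact pd_meas hVF S q K R),
      lintegral_prod _ (by
        rw [← EE_restrict]
        exact pq_meas hVF S (w := fun g => (q - 1) * (g + gL + 1 / σE)) (by fun_prop) q)]
    have hm : Measurable fun v => ENNReal.ofReal (gin / σE * ee q K (PP VF p v 0)) := by
      have h1 : Continuous fun v => ee q K (PP VF p v 0) := (ee_cont hq).comp (PP_cont hVF S 0)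
      exact (ENNReal.continuous_ofReal.comp (continuous_const.mul h1)).measurable
    have e1 : ∫⁻ v in Ioo 0 VF, ENNReal.ofReal (gin / σE * ee q K (p v 0)) =
        ∫⁻ v in Ioo 0 VF, ENNReal.ofReal (gin / σE * ee q K (PP VF p v 0)) :=
      setLIntegral_congr_fun measurableSet_Ioo fun v hv => by
        rw [PP_eq (Ioo_subset_Icc_self hv) le_rfl]
    rw [e1, ← lintegral_add_left hm]
    refine le_trans (le_of_eq ?_) (key.trans (le_of_eq ?_))
    · refine setLIntegral_congr_fun measurableSet_Ioo fun v hv => ?_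
      congr 1
      have e2 : ∫⁻ g in Ioi (0:ℝ), ENNReal.ofReal (pd a σE q K R p (v, g)) =
          ∫⁻ g in Ioi (0:ℝ), (Iio (2 * R)).indicator (fun g => ENNReal.ofReal (pd a σE q K R p (v, g))) g := by
        refine lintegral_congr fun g => ?_
        by_cases hg : g ∈ Iio (2 * R)
        · rw [indicator_of_mem hg]
        · rw [indicator_of_notMem hg]
          have hg' : 2 * R ≤ g := by simpa using hg
          have : 2 ≤ g / R := (le_div_iff₀ hR0).2 hg'
          simp only [pd]
          rw [eta_of_nonpos (by linarith)]; simp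
      rw [e2, setLIntegral_indicator measurableSet_Iio, inter_comm, Ioi_inter_Iio]
      refine setLIntegral_congr_fun measurableSet_Ioo fun g hg => ?_
      have := cP v (Ioo_subset_Icc_self hv) g hg.1.le
      simp only [pd, pdis, this]
      rfl
    · congr 1
      refine setLIntegral_congr_fun measurableSet_Ioo fun v hv => ?_
      refine setLIntegral_congr_fun measurableSet_Ioi fun g hg => ?_
      have := cP v (Ioo_subset_Icc_self hv) g (le_of_lt hg)
      simp only [this]
      rfl
  · intro v hv
    have hb : ∀ g ∈ Ioo 0 (2 * R), ‖-((c.κ * c.ψ2 g + (c.b0 - c.s * g) * c.ψ1 g) * cc q K (c.P v g))‖ ≤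
        C1 * c0 / R ^ 2 := by
      intro g hg
      have hc0' : 0 ≤ C1 * c0 / R ^ 2 := by positivity
      change ‖-((a / σE * (eta2 (2 - g / R) / R ^ 2) + (gin / σE - 1 / σE * g) * (-eta1 (2 - g / R) / R)) *
        cc q K (c.P v g))‖ ≤ _
      rw [cP v (Ioo_subset_Icc_self hv) g hg.1.le]
      rcases le_or_gt g R with hgR | hgR
      · have : g / R ≤ 1 := (div_le_one hR0).2 hgR
        rw [eta2_of_ge (by linarith), eta1_of_ge (by linarith)]
        simpa using hc0'
      · have hpv := hp v hv g (mem_Ici.2 hg.1.le)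
        have hdec := (hG1 g (mem_Ici.2 (by linarith)) v hv).2.1
        have hcc := cc_le hq hK hpv.le
        have hcc0 := cc_nonneg hq hK hpv.le
        have hpR : p v g ≤ 1 / R ^ 2 := by
          rw [le_div_iff₀ (by positivity)]
          have : R ^ 2 ≤ g ^ 2 := by gcongr
          nlinarith
        rw [norm_neg, norm_mul, Real.norm_eq_abs, Real.norm_eq_abs, abs_of_nonneg hcc0]
        have t1 : |a / σE * (eta2 (2 - g / R) / R ^ 2)| ≤ a / σE * etaK := by
          rw [abs_mul, abs_of_pos (div_pos ha hσE), abs_div, abs_of_pos (by positivity : 0 < R ^ 2)]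
          refine mul_le_mul_of_nonneg_left ?_ (by positivity)
          refine (div_le_self (abs_nonneg _) (by nlinarith)).trans (eta2_le _)
        have t2 : |(gin / σE - 1 / σE * g) * (-eta1 (2 - g / R) / R)| ≤
            (gin / σE + 2 * (1 / σE)) * etaK := by
          have u1 : |gin / σE - 1 / σE * g| ≤ (gin / σE + 2 * (1 / σE)) * R := by
            have x1 : 0 < gin / σE := by positivity
            have x2 : 0 < 1 / σE := by positivity
            have x3 := hg.1
            have x4 := hg.2
            rw [abs_le]; constructor <;> nlinarith
          rw [abs_mul, abs_div, abs_neg, abs_of_pos hR0]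
          calc _ ≤ (gin / σE + 2 * (1 / σE)) * R * (etaK / R) := by
                refine mul_le_mul u1 ?_ (by positivity) (by positivity)
                exact div_le_div_of_nonneg_right (eta1_le _) hR0.le
            _ = _ := by field_simp
        have t3 := abs_add_le (a / σE * (eta2 (2 - g / R) / R ^ 2))
          ((gin / σE - 1 / σE * g) * (-eta1 (2 - g / R) / R))
        have t4 : |a / σE * (eta2 (2 - g / R) / R ^ 2) +
          (gin / σE - 1 / σE * g) * (-eta1 (2 - g / R) / R)| ≤ C1 := by
          refine t3.trans ((add_le_add t1 t2).trans (le_of_eq ?_))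
          rw [hC1]; ring
        calc _ ≤ C1 * (c0 * (1 / R ^ 2)) :=
              mul_le_mul t4 (hcc.trans (mul_le_mul_of_nonneg_left hpR hc0n)) hcc0 hC1n
          _ = _ := by ring
    have hn := norm_setIntegral_le_of_norm_le_const (μ := volume) (s := Ioo 0 (2 * R))
      measure_Ioo_lt_top hb
    refine (le_abs_self _).trans (hn.trans ?_)
    rw [Real.volume_real_Ioo_of_le (by positivity)]
    rw [div_le_iff₀ hδ] at hRd
    rw [sub_zero, div_mul_eq_mul_div, div_le_iff₀ (by positivity)]
    nlinarith [mul_le_mul_of_nonneg_right hRd hR0.le]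
end SS


namespace SS
variable {VF VE gL gin a σE : ℝ} {p : ℝ → ℝ → ℝ}

theorem fin_est (hVF : 0 < VF) (hVE : VF < VE) (hgL : 0 < gL) (hgin : 0 < gin)
    (ha : 0 < a) (hσE : 0 < σE) (S : StatSol VF VE gL gin a σE p)
    (hp : ∀ v ∈ Ioo 0 VF, ∀ g ∈ Ici (0:ℝ), 0 < p v g) {q : ℝ} (hq : 1 < q) :
    (∫⁻ v in Ioo 0 VF, ENNReal.ofReal (gin / σE * ((q - 1) * p v 0 ^ q)) ≤
      ∫⁻ x in EE VF, ENNReal.ofReal (((q - 1) * (x.2 + gL + 1 / σE)) * p x.1 x.2 ^ q)) ∧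
    (∫⁻ x in EE VF, ENNReal.ofReal (a / σE * (q * (q - 1) * p x.1 x.2 ^ (q - 2)) * PPg p x.1 x.2 ^ 2) ≤
      ∫⁻ x in EE VF, ENNReal.ofReal (((q - 1) * (x.2 + gL + 1 / σE)) * p x.1 x.2 ^ q)) := by
  set D := ∫⁻ x in EE VF, ENNReal.ofReal (((q - 1) * (x.2 + gL + 1 / σE)) * p x.1 x.2 ^ q) with hD
  have hex := fun n : ℕ => est hVF hVE hgL hgin ha hσE S hp (q := q) (K := (n:ℝ) + 1)
    (δ := 1 / ((n:ℝ) + 1)) (M := n) hq (by positivity) (by positivity)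
  choose R hRn hR0 hR using hex
  have hlim : Tendsto (fun n : ℕ => ENNReal.ofReal (1 / ((n:ℝ) + 1)) * ENNReal.ofReal VF + D) atTop
      (nhds D) := by
    have h1 : Tendsto (fun n : ℕ => ENNReal.ofReal (1 / ((n:ℝ) + 1))) atTop (nhds 0) := by
      have := ENNReal.tendsto_ofReal (tendsto_one_div_add_atTop_nhds_zero_nat (𝕜 := ℝ))
      simpa using this
    have h2 := (ENNReal.Tendsto.mul_const h1 (b := ENNReal.ofReal VF) (Or.inr ENNReal.ofReal_ne_top)).add
      (tendsto_const_nhds (x := D))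
    simpa using h2
  constructor
  · refine fatou_le (F := fun n v => ENNReal.ofReal (gin / σE * ee q ((n:ℝ) + 1) (p v 0)))
      (fun n => ?_) ?_ (fun n => le_trans (le_add_of_nonneg_right zero_le) (hR n)) hlim
    · have h1 : Continuous fun v => ee q ((n:ℝ) + 1) (PP VF p v 0) := (ee_cont hq).comp (PP_cont hVF S 0)
      have h2 : Measurable fun v => ENNReal.ofReal (gin / σE * ee q ((n:ℝ) + 1) (PP VF p v 0)) :=
        (ENNReal.continuous_ofReal.comp (continuous_const.mul h1)).measurable
      refine h2.aemeasurable.congr ((ae_restrict_iff' measurableSet_Ioo).2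
        (Eventually.of_forall fun v hv => ?_))
      simp only
      rw [PP_eq (Ioo_subset_Icc_self hv) le_rfl]
    · refine (ae_restrict_iff' measurableSet_Ioo).2 (Eventually.of_forall fun v hv => ?_)
      refine tendsto_const_nhds.congr' ?_
      obtain ⟨m, hm⟩ := exists_nat_ge (p v 0 ^ (q - 1))
      filter_upwards [eventually_ge_atTop m] with n hn
      have : (m:ℝ) ≤ n := by exact_mod_cast hn
      rw [ee_eq hq (by positivity) (hp v hv 0 (mem_Ici.2 le_rfl)).le (by linarith)]
  · refine fatou_le (F := fun n x => ENNReal.ofReal (pd a σE q ((n:ℝ) + 1) (R n) p x))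
      (fun n => pd_meas hVF S _ _ _) ?_ (fun n => le_trans (le_add_of_nonneg_left zero_le) (hR n)) hlim
    refine (ae_restrict_iff' (EE_meas VF)).2 (Eventually.of_forall fun x hx => ?_)
    refine tendsto_const_nhds.congr' ?_
    obtain ⟨m, hm⟩ := exists_nat_ge (p x.1 x.2 ^ (q - 1))
    obtain ⟨m', hm'⟩ := exists_nat_ge x.2
    filter_upwards [eventually_ge_atTop m, eventually_ge_atTop m'] with n hn hn'
    have h1 : (m:ℝ) ≤ n := by exact_mod_cast hn
    have h2 : (m':ℝ) ≤ n := by exact_mod_cast hn'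
    have h3 : x.2 / R n ≤ 1 := (div_le_one (hR0 n)).2 (by linarith [hRn n])
    simp only [pd]
    rw [eta_of_ge (by linarith), om_one (by positivity) (by linarith)]
    simp

theorem final (hVF : 0 < VF) (hVE : VF < VE) (hgL : 0 < gL) (hgin : 0 < gin)
    (ha : 0 < a) (hσE : 0 < σE) (S : StatSol VF VE gL gin a σE p)
    (hp : ∀ v ∈ Ioo 0 VF, ∀ g ∈ Ici (0:ℝ), 0 < p v g) {q : ℝ} (hq : 1 < q) :
      ENNReal.ofReal q * (∫⁻ v in Ioo (0:ℝ) VF, ENNReal.ofReal ((p v 0) ^ q)) +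
        (∫⁻ x in (Ioo (0:ℝ) VF) ×ˢ (Ioi (0:ℝ)),
          ENNReal.ofReal ((deriv (fun g' => (p x.1 g') ^ (q / 2)) x.2) ^ 2)) ≤
      ENNReal.ofReal (((1 / gL + 1 / (σE * gL ^ 2)) * (σE / gin + σE / (4 * a))) * q) *
        ∫⁻ x in (Ioo (0:ℝ) VF) ×ˢ (Ioi (0:ℝ)),
          ENNReal.ofReal ((x.2 + gL) ^ 2 * (p x.1 x.2) ^ q) := by
  obtain ⟨h1, h2⟩ := fin_est hVF hVE hgL hgin ha hσE S hp hq
  change _ + (∫⁻ x in EE VF, _) ≤ _ * ∫⁻ x in EE VF, _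
  set D := ∫⁻ x in EE VF, ENNReal.ofReal (((q - 1) * (x.2 + gL + 1 / σE)) * p x.1 x.2 ^ q) with hD
  set d := ∫⁻ x in EE VF, ENNReal.ofReal ((x.2 + gL) ^ 2 * (p x.1 x.2) ^ q) with hd
  set K0 := 1 / gL + 1 / (σE * gL ^ 2) with hK0
  have hK0p : 0 < K0 := by positivity
  have hq1 : 0 < q - 1 := by linarith
  have hDd : D ≤ ENNReal.ofReal ((q - 1) * K0) * d := by
    rw [hD, hd, ← lintegral_const_mul' _ _ ENNReal.ofReal_ne_top]
    refine setLIntegral_mono' (EE_meas VF) fun x hx => ?_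
    rw [← ENNReal.ofReal_mul (by positivity)]
    refine ENNReal.ofReal_le_ofReal ?_
    have hg : 0 < x.2 := (mem_prod.1 hx).2
    have hP : 0 < p x.1 x.2 := hp _ (mem_prod.1 hx).1 _ (mem_Ici.2 hg.le)
    have hPq : 0 < p x.1 x.2 ^ q := by positivity
    have hle : x.2 + gL + 1 / σE ≤ K0 * (x.2 + gL) ^ 2 := by
      have t1 : x.2 + gL ≤ 1 / gL * (x.2 + gL) ^ 2 := by
        rw [div_mul_eq_mul_div, le_div_iff₀ hgL]; nlinarith
      have t2 : 1 / σE ≤ 1 / (σE * gL ^ 2) * (x.2 + gL) ^ 2 := by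
        rw [div_mul_eq_mul_div, one_mul, div_le_div_iff₀ hσE (by positivity)]
        have : gL ^ 2 ≤ (x.2 + gL) ^ 2 := by nlinarith
        nlinarith
      rw [hK0, add_mul]; linarith
    calc _ ≤ (q - 1) * (K0 * (x.2 + gL) ^ 2) * p x.1 x.2 ^ q := by gcongr
      _ = _ := by ring
  have b1 : ENNReal.ofReal q * (∫⁻ v in Ioo (0:ℝ) VF, ENNReal.ofReal ((p v 0) ^ q)) ≤
      ENNReal.ofReal (K0 * (σE / gin) * q) * d := by
    calc _ = ENNReal.ofReal (q * (σE / gin) / (q - 1)) *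
          ∫⁻ v in Ioo 0 VF, ENNReal.ofReal (gin / σE * ((q - 1) * p v 0 ^ q)) := by
          rw [← lintegral_const_mul' _ _ ENNReal.ofReal_ne_top, ← lintegral_const_mul' _ _ ENNReal.ofReal_ne_top]
          refine setLIntegral_congr_fun measurableSet_Ioo fun v hv => ?_
          rw [← ENNReal.ofReal_mul (by positivity), ← ENNReal.ofReal_mul (by positivity)]
          congr 1
          field_simp
      _ ≤ ENNReal.ofReal (q * (σE / gin) / (q - 1)) * (ENNReal.ofReal ((q - 1) * K0) * d) := by
          gcongr; exact h1.trans hDd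
      _ = _ := by
          rw [← mul_assoc, ← ENNReal.ofReal_mul (by positivity)]
          congr 2
          field_simp
  have b2 : (∫⁻ x in EE VF, ENNReal.ofReal ((deriv (fun g' => (p x.1 g') ^ (q / 2)) x.2) ^ 2)) ≤
      ENNReal.ofReal (K0 * (σE / (4 * a)) * q) * d := by
    calc _ = ENNReal.ofReal (q * (σE / (4 * a)) / (q - 1)) *
          ∫⁻ x in EE VF, ENNReal.ofReal (a / σE * (q * (q - 1) * p x.1 x.2 ^ (q - 2)) * PPg p x.1 x.2 ^ 2) := by
          rw [← lintegral_const_mul' _ _ ENNReal.ofReal_ne_top]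
          refine setLIntegral_congr_fun (EE_meas VF) fun x hx => ?_
          rw [← ENNReal.ofReal_mul (by positivity)]
          congr 1
          have hg : 0 < x.2 := (mem_prod.1 hx).2
          have hP : 0 < p x.1 x.2 := hp _ (mem_prod.1 hx).1 _ (mem_Ici.2 hg.le)
          have hder := (p_der' S (mem_prod.1 hx).1 hg).rpow_const (p := q / 2) (Or.inl hP.ne')
          rw [hder.deriv]
          have e : p x.1 x.2 ^ (q - 2) = (p x.1 x.2 ^ (q / 2 - 1)) ^ 2 := by
            rw [sq, ← Real.rpow_add hP]; congr 1; ring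
          rw [e]
          field_simp
          ring
      _ ≤ ENNReal.ofReal (q * (σE / (4 * a)) / (q - 1)) * (ENNReal.ofReal ((q - 1) * K0) * d) := by
          gcongr; exact h2.trans hDd
      _ = _ := by
          rw [← mul_assoc, ← ENNReal.ofReal_mul (by positivity)]
          congr 2
          field_simp
  refine (add_le_add b1 b2).trans (le_of_eq ?_)
  rw [← add_mul, ← ENNReal.ofReal_add (by positivity) (by positivity)]
  congr 2
  ring
end SS

/-- boundary term and dissipation bound `q ∫ p(v,0)^q + ∫∫ |∂_g p^{q/2}|²
≤ C q d_q`, with `C` independent of `q`. -/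
theorem stmt8 (VF VE gL gin a σE : ℝ)
    (hVF : 0 < VF) (hVE : VF < VE) (hgL : 0 < gL) (hgin : 0 < gin)
    (ha : 0 < a) (hσE : 0 < σE) :
    ∃ C : ℝ, ∀ (p : ℝ → ℝ → ℝ), StatSol VF VE gL gin a σE p →
      (∀ v ∈ Ioo 0 VF, ∀ g ∈ Ici (0:ℝ), 0 < p v g) →
      ∀ q : ℝ, 4 / 3 ≤ q →
      (∫⁻ x in (Ioo (0:ℝ) VF) ×ˢ (Ioi (0:ℝ)),
        ENNReal.ofReal ((x.2 + gL) ^ 2 * (p x.1 x.2) ^ q) < ⊤) →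
      (∀ ε > 0, ∃ G : ℝ, ∀ g ∈ Ici G, ∀ v ∈ Ioo 0 VF,
        (p v g) ^ q < ε ∧ g ^ 2 * (p v g) ^ q < ε ∧
          |deriv (fun g' => (p v g') ^ q) g| < ε) →
      ENNReal.ofReal q * (∫⁻ v in Ioo (0:ℝ) VF, ENNReal.ofReal ((p v 0) ^ q)) +
        (∫⁻ x in (Ioo (0:ℝ) VF) ×ˢ (Ioi (0:ℝ)),
          ENNReal.ofReal ((deriv (fun g' => (p x.1 g') ^ (q / 2)) x.2) ^ 2)) ≤
      ENNReal.ofReal (C * q) *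
        ∫⁻ x in (Ioo (0:ℝ) VF) ×ˢ (Ioi (0:ℝ)),
          ENNReal.ofReal ((x.2 + gL) ^ 2 * (p x.1 x.2) ^ q) := by
  refine ⟨(1 / gL + 1 / (σE * gL ^ 2)) * (σE / gin + σE / (4 * a)), ?_⟩
  intro p S hp q hq _ _
  exact SS.final hVF hVE hgL hgin ha hσE S hp (by linarith)
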